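/- Let N ≥ 1 be an integer, q ∈ (1, ∞), σ ∈ (0, π/2), and ρ > 0. There exists a constant C = C(N, q, σ, ρ) > 0 such that for every λ ∈ ℂ with λ ≠ 0 and |arg λ| < π − σ, and every Schwartz function g ∈ 𝓢(ℝ^N; ℂ), the function W(x) = (2π)^{−N} ∫_{ℝ^N} e^{i x·ξ} 𝓕g(ξ) / (ρλ + ‖ξ‖²) dξ is a well-defined Schwartz function which satisfies ρλ W(x) − ΔW(x) = g(x) for all x ∈ ℝ^N, together with the estimates |λ| · ‖W‖_{L^q(ℝ^N)} + |λ|^{1/2} ‖∇W‖_{L^q(ℝ^N)} + ‖D²W‖_{L^q(ℝ^N)} ≤ C ‖g‖_{L^q(ℝ^N)}, with C independent of λ and g. -/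

import Mathlib

open Real MeasureTheory
open scoped RealInnerProductSpace

/-- The `L^p` norm (real exponent `p`) of `f` with respect to the measure `μ`. -/
noncomputable def LqNorm {α : Type*} [MeasurableSpace α] {E : Type*} [NormedAddCommGroup E]
    (μ : Measure α) (p : ℝ) (f : α → E) : ℝ :=
  (∫ x, ‖f x‖ ^ p ∂μ) ^ (1 / p)

/-- The Laplacian of `f : ℝ^N → ℂ`, as the sum of the second partial derivatives
along the standard coordinate directions. -/
noncomputable def lapl {N : ℕ} (f : EuclideanSpace ℝ (Fin N) → ℂ)
    (x : EuclideanSpace ℝ (Fin N)) : ℂ :=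
  ∑ i : Fin N, fderiv ℝ (fun y => fderiv ℝ f y (EuclideanSpace.single i 1)) x
    (EuclideanSpace.single i 1)

namespace ResolventEstimate

open Filter Topology
open scoped ENNReal NNReal LineDeriv SchwartzMap FourierTransform Laplacian

/-- Euclidean space of dimension `N`. -/
abbrev Eu (N : ℕ) := EuclideanSpace ℝ (Fin N)

variable {N : ℕ}

/-- The `j`-th standard basis vector. -/
noncomputable abbrev ee (j : Fin N) : Eu N := EuclideanSpace.single j 1

/-- The `j`-th partial derivative. -/
noncomputable def pd (j : Fin N) (f : Eu N → ℝ) : Eu N → ℝ := fun x => fderiv ℝ f x (ee j)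

/-! ### The standard Gaussian measure -/

lemma integrable_exp_neg_mul_norm_sq {b : ℝ} (hb : 0 < b) :
    Integrable (fun y : Eu N => exp (-b * ‖y‖ ^ 2)) := by
  have h := (GaussianFourier.integrable_cexp_neg_mul_sq_norm_add (V := Eu N) (b := (b : ℂ))
    (by simpa using hb) 0 0).norm
  refine h.congr (Filter.Eventually.of_forall fun y => ?_)
  simp only [zero_mul, add_zero, Complex.norm_exp]
  congr 1
  norm_cast

lemma one_add_pow_mul_exp_le (m : ℕ) :
    ∃ C : ℝ, 0 ≤ C ∧ ∀ t : ℝ, 0 ≤ t → (1 + t) ^ m * exp (-t ^ 2 / 2) ≤ C * exp (-(1 / 4) * t ^ 2) := by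
  refine ⟨m.factorial * exp 2, by positivity, fun t ht => ?_⟩
  have h1 : (1 + t) ^ m ≤ m.factorial * exp (1 + t) := by
    have := Real.pow_div_factorial_le_exp (1 + t) (by positivity) m
    rw [div_le_iff₀ (by positivity)] at this
    linarith
  calc (1 + t) ^ m * exp (-t ^ 2 / 2) ≤ m.factorial * exp (1 + t) * exp (-t ^ 2 / 2) := by gcongr
    _ = m.factorial * exp (1 + t + -t ^ 2 / 2) := by rw [exp_add (1 + t)]; ring
    _ ≤ m.factorial * exp (2 + -(1 / 4) * t ^ 2) := by
        refine mul_le_mul_of_nonneg_left (exp_le_exp.2 ?_) (by positivity)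
        nlinarith [sq_nonneg (t - 2)]
    _ = _ := by rw [exp_add]; ring

lemma integrable_pow_mul_exp (m : ℕ) :
    Integrable (fun y : Eu N => (1 + ‖y‖) ^ m * exp (-‖y‖ ^ 2 / 2)) := by
  obtain ⟨C, hC, h⟩ := one_add_pow_mul_exp_le m
  refine ((integrable_exp_neg_mul_norm_sq (N := N) (b := 1 / 4) (by norm_num)).const_mul C).mono'
    (Continuous.aestronglyMeasurable (by fun_prop)) (Filter.Eventually.of_forall fun y => ?_)
  rw [Real.norm_of_nonneg (by positivity)]
  exact h _ (norm_nonneg y)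

/-- The standard Gaussian probability measure on `ℝ^N`. -/
noncomputable def gm (N : ℕ) : Measure (Eu N) := volume.tilted (fun y => -‖y‖ ^ 2 / 2)

instance : IsProbabilityMeasure (gm N) := by
  apply isProbabilityMeasure_tilted
  simpa using integrable_pow_mul_exp (N := N) 0

lemma integrable_gm_iff (f : Eu N → ℝ) :
    Integrable f (gm N) ↔ Integrable (fun y => f y * exp (-‖y‖ ^ 2 / 2)) := by
  have hZ : 0 < ∫ x : Eu N, exp (-‖x‖ ^ 2 / 2) :=
    integral_exp_pos (by simpa using integrable_pow_mul_exp (N := N) 0)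
  rw [gm, tilted_eq_withDensity_nnreal]
  rw [integrable_withDensity_iff_integrable_smul (by
    refine Measurable.subtype_mk ?_
    fun_prop)]
  have : (fun y : Eu N => f y * exp (-‖y‖ ^ 2 / 2)) =
    fun y => (∫ x : Eu N, exp (-‖x‖ ^ 2 / 2)) *
      ((exp (-‖y‖ ^ 2 / 2) / ∫ x : Eu N, exp (-‖x‖ ^ 2 / 2)) * f y) := by
    ext y
    rw [← mul_assoc, mul_div_cancel₀ _ hZ.ne', mul_comm]
  rw [this, integrable_const_mul_iff (IsUnit.mk0 _ hZ.ne')]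
  rfl

lemma integrable_one_add_norm_pow (m : ℕ) : Integrable (fun y : Eu N => (1 + ‖y‖) ^ m) (gm N) :=
  (integrable_gm_iff _).2 (integrable_pow_mul_exp m)

lemma integrable_gm_of_bound {f : Eu N → ℝ} (hf : Continuous f) (m : ℕ) (C : ℝ)
    (h : ∀ y, |f y| ≤ C * (1 + ‖y‖) ^ m) : Integrable f (gm N) :=
  ((integrable_one_add_norm_pow m).const_mul C).mono' hf.aestronglyMeasurable
    (Filter.Eventually.of_forall h)

lemma abs_coord_le (y : Eu N) (j : Fin N) : |y j| ≤ ‖y‖ := by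
  simpa using PiLp.norm_apply_le y j

/-- Gaussian integration by parts. -/
lemma integral_coord_mul_gm (j : Fin N) {F F' : Eu N → ℝ} (hF : Continuous F) (hF' : Continuous F')
    {C : ℝ} (hb : ∀ y, |F y| ≤ C) (hb' : ∀ y, |F' y| ≤ C)
    (hd : ∀ y, HasLineDerivAt ℝ F (F' y) y (ee j)) :
    ∫ y, y j * F y ∂(gm N) = ∫ y, F' y ∂(gm N) := by
  set Z := ∫ x : Eu N, exp (-‖x‖ ^ 2 / 2) with hZ
  set G : Eu N → ℝ := fun y => exp (-‖y‖ ^ 2 / 2) / Z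
  have hG : ∀ y, HasLineDerivAt ℝ G (-(y j) * G y) y (ee j) := by
    intro y
    have h1 : HasFDerivAt (fun y : Eu N => ‖y‖ ^ 2) (2 • (innerSL ℝ y)) y :=
      (hasStrictFDerivAt_norm_sq y).hasFDerivAt
    have h2 := ((h1.const_mul (-(1 / 2) : ℝ)).exp.mul_const (1 / Z)).hasLineDerivAt (ee j)
    have e : ∀ z : Eu N, -(1 / 2) * ‖z‖ ^ 2 = -‖z‖ ^ 2 / 2 := fun z => by ring
    simp only [e, mul_one_div] at h2
    refine HasDerivAt.congr_deriv h2 ?_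
    simp [G, EuclideanSpace.inner_single_right]
    ring
  have hC : 0 ≤ C := (abs_nonneg _).trans (hb 0)
  have hGi : ∀ (H : Eu N → ℝ), Continuous H → (m : ℕ) → (∀ y, |H y| ≤ C * (1 + ‖y‖) ^ m) →
      Integrable (fun y => H y * G y) := by
    intro H hH m h
    have := ((integrable_gm_iff H).1 (integrable_gm_of_bound hH m C h)).mul_const (1 / Z)
    refine this.congr (Filter.Eventually.of_forall fun y => ?_)
    simp [G]; ring
  have key := integral_bilinear_hasLineDerivAt_right_eq_neg_left_of_integrable
    (μ := (volume : Measure (Eu N))) (f := F) (f' := F') (g := G) (g' := fun y => -(y j) * G y)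
    (v := ee j) (B := ContinuousLinearMap.mul ℝ ℝ) ?_ ?_ ?_ (fun y _ => hd y) (fun y _ => hG y)
  · simp only [ContinuousLinearMap.mul_apply'] at key
    rw [gm, integral_tilted, integral_tilted]
    simp only [smul_eq_mul]
    change ∫ y, G y * (y j * F y) = ∫ y, G y * F' y
    have e1 : ∫ y, G y * (y j * F y) = - ∫ y, F y * (-(y j) * G y) := by
      rw [← integral_neg]; congr 1; ext y; ring
    rw [e1, key, neg_neg]; congr 1; ext y; ring
  · exact hGi F' hF' 0 (by simpa using hb')
  · have := hGi (fun y => F y * (-(y j))) (by fun_prop) 1 (fun y => by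
      rw [abs_mul, abs_neg, pow_one]
      exact mul_le_mul (hb y) ((abs_coord_le y j).trans (by linarith)) (abs_nonneg _) hC)
    refine this.congr (Filter.Eventually.of_forall fun y => ?_)
    simp; ring
  · exact hGi F hF 0 (by simpa using hb)

/-! ### The heat operator -/

/-- The heat operator at time `s ^ 2 / 2`. -/
noncomputable def heat (s : ℝ) (f : Eu N → ℝ) (x : Eu N) : ℝ := ∫ y, f (x + s • y) ∂(gm N)

lemma heat_zero (f : Eu N → ℝ) (x : Eu N) : heat 0 f x = f x := by simp [heat]

lemma integrable_heat {f : Eu N → ℝ} (hf : Continuous f) {C : ℝ} (hC : ∀ x, |f x| ≤ C)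
    (s : ℝ) (x : Eu N) : Integrable (fun y => f (x + s • y)) (gm N) :=
  integrable_gm_of_bound (by fun_prop) 0 C (by simpa using fun y => hC _)

lemma continuous_heat {f : Eu N → ℝ} (hf : Continuous f) {C : ℝ} (hC : ∀ x, |f x| ≤ C) (s : ℝ) :
    Continuous (heat s f) := by
  refine continuous_of_dominated (bound := fun _ => C) (fun x => ?_) (fun x => ?_)
    (integrable_const C) ?_
  · exact Continuous.aestronglyMeasurable (by fun_prop)
  · exact Eventually.of_forall fun y => hC _
  · exact Eventually.of_forall fun y => by fun_prop

lemma heat_mono {f g : Eu N → ℝ} (hf : Continuous f) (hg : Continuous g) {C : ℝ}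
    (hC : ∀ x, |f x| ≤ C) {C' : ℝ} (hC' : ∀ x, |g x| ≤ C') (h : ∀ x, f x ≤ g x) (s : ℝ) (x : Eu N) :
    heat s f x ≤ heat s g x :=
  integral_mono (integrable_heat hf hC s x) (integrable_heat hg hC' s x) fun _ => h _

lemma abs_heat_le {f g : Eu N → ℝ} (hg : Continuous g)
    {C' : ℝ} (hC' : ∀ x, |g x| ≤ C') (h : ∀ x, |f x| ≤ g x) (s : ℝ) (x : Eu N) :
    |heat s f x| ≤ heat s g x :=
  norm_integral_le_of_norm_le (f := fun y => f (x + s • y))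
    (integrable_heat hg hC' s x) (Eventually.of_forall fun _ => h _)

lemma heat_pos {f : Eu N → ℝ} (hf : Continuous f) {C : ℝ} (hC : ∀ x, |f x| ≤ C)
    (h : ∀ x, 0 < f x) (s : ℝ) (x : Eu N) : 0 < heat s f x := by
  rw [heat, integral_pos_iff_support_of_nonneg (fun _ => (h _).le) (integrable_heat hf hC s x)]
  have : Function.support (fun y => f (x + s • y)) = Set.univ :=
    Set.eq_univ_of_forall fun y => (h _).ne'
  rw [this]; simp

lemma heat_const_mul (c : ℝ) (f : Eu N → ℝ) (s : ℝ) (x : Eu N) :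
    heat s (fun y => c * f y) x = c * heat s f x := integral_const_mul _ _

lemma heat_rpow_le {f : Eu N → ℝ} (hf : Continuous f) {C : ℝ} (hC : ∀ x, |f x| ≤ C)
    (h : ∀ x, 0 < f x) {b : ℝ} (hb0 : 0 < b) (hb1 : b ≤ 1) (s : ℝ) (x : Eu N) :
    heat s (fun y => f y ^ b) x ≤ heat s f x ^ b := by
  refine (Real.concaveOn_rpow hb0.le hb1).le_map_integral (μ := gm N)
    (f := fun y => f (x + s • y)) ?_ isClosed_Ici (Eventually.of_forall fun y => (h _).le)
    (integrable_heat hf hC s x) ?_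
  · exact (Real.continuous_rpow_const hb0.le).continuousOn
  · refine integrable_heat (f := fun y => f y ^ b) ?_ (C := C ^ b) (fun y => ?_) s x
    · exact hf.rpow_const fun _ => Or.inr hb0.le
    · rw [abs_of_nonneg (rpow_nonneg (h _).le _)]
      exact rpow_le_rpow (h _).le ((le_abs_self _).trans (hC _)) hb0.le

lemma pd_hasDerivAt {f : Eu N → ℝ} (hf : Differentiable ℝ f) (j : Fin N) (a : Eu N) (t : ℝ) :
    HasDerivAt (fun t : ℝ => f (a + t • ee j)) (pd j f (a + t • ee j)) t := by
  have h1 : HasDerivAt (fun t : ℝ => a + t • ee j) (ee j) t := by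
    simpa using ((hasDerivAt_id t).smul_const (ee j)).const_add a
  exact (hf _).hasFDerivAt.comp_hasDerivAt t h1

lemma pd_hasLineDerivAt {f : Eu N → ℝ} (hf : Differentiable ℝ f) (j : Fin N) (x : Eu N) :
    HasLineDerivAt ℝ f (pd j f x) x (ee j) := (hf x).hasFDerivAt.hasLineDerivAt _

lemma continuous_pd {f : Eu N → ℝ} (hf : ContDiff ℝ 1 f) (j : Fin N) : Continuous (pd j f) :=
  (hf.continuous_fderiv one_ne_zero).clm_apply continuous_const

lemma contDiff_pd {f : Eu N → ℝ} (hf : ContDiff ℝ 2 f) (j : Fin N) : ContDiff ℝ 1 (pd j f) :=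
  (hf.fderiv_right (m := 1) (by norm_num)).clm_apply contDiff_const

lemma heat_hasLineDerivAt {f : Eu N → ℝ} (hf : ContDiff ℝ 1 f) {C : ℝ} (hC : ∀ x, |f x| ≤ C)
    (j : Fin N) (hC' : ∀ x, |pd j f x| ≤ C) (s : ℝ) (x : Eu N) :
    HasLineDerivAt ℝ (heat s f) (heat s (pd j f) x) x (ee j) := by
  have hd := hf.differentiable one_ne_zero
  have hc := hf.continuous
  have hc' := continuous_pd hf j
  have := (hasDerivAt_integral_of_dominated_loc_of_deriv_le (μ := gm N) (x₀ := (0 : ℝ))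
    (F := fun t y => f (x + t • ee j + s • y)) (F' := fun t y => pd j f (x + t • ee j + s • y))
    (s := Set.univ) (bound := fun _ => C) univ_mem ?_ ?_ ?_ ?_ (integrable_const C) ?_).2
  · simpa [HasLineDerivAt, heat] using this
  · exact Eventually.of_forall fun t => Continuous.aestronglyMeasurable (by fun_prop)
  · exact integrable_heat hc hC s _
  · exact Continuous.aestronglyMeasurable (by fun_prop)
  · exact Eventually.of_forall fun y t _ => hC' _
  · refine Eventually.of_forall fun y t _ => ?_
    have := pd_hasDerivAt hd j (x + s • y) t
    simpa only [add_right_comm x (s • y)] using this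

lemma fderiv_eq_sum_pd (f : Eu N → ℝ) (x y : Eu N) :
    fderiv ℝ f x y = ∑ j, y j * pd j f x := by
  conv_lhs => rw [← (EuclideanSpace.basisFun (Fin N) ℝ).sum_repr y]
  simp [pd]

lemma heat_hasDerivAt {f : Eu N → ℝ} (hf : ContDiff ℝ 2 f) {C : ℝ} (hC : ∀ x, |f x| ≤ C)
    (hC' : ∀ j x, |pd j f x| ≤ C) (hC'' : ∀ j x, |pd j (pd j f) x| ≤ C) (s : ℝ) (x : Eu N) :
    HasDerivAt (fun s => heat s f x) (s * ∑ j, heat s (pd j (pd j f)) x) s := by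
  have hd := hf.differentiable two_ne_zero
  have hc := hf.continuous
  have hc' := fun j => continuous_pd (hf.of_le (by norm_num)) j
  have hc'' := fun j => continuous_pd (contDiff_pd hf j) j
  have hinteg : ∀ (j : Fin N) (s : ℝ), Integrable (fun y : Eu N => y j * pd j f (x + s • y)) (gm N) := by
    intro j s
    have := hc' j
    refine integrable_gm_of_bound (by fun_prop) 1 C fun y => ?_
    rw [abs_mul, mul_comm, pow_one]
    exact mul_le_mul (hC' j _) ((abs_coord_le y j).trans (by linarith)) (abs_nonneg _)
      ((abs_nonneg _).trans (hC x))
  have := (hasDerivAt_integral_of_dominated_loc_of_deriv_le (μ := gm N) (x₀ := s)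
    (F := fun t y => f (x + t • y)) (F' := fun t y => ∑ j, y j * pd j f (x + t • y))
    (s := Set.univ) (bound := fun y => ∑ j : Fin N, (1 + ‖y‖) ^ 1 * C) univ_mem
    ?_ ?_ ?_ ?_ ?_ ?_).2
  · refine this.congr_deriv ?_
    rw [integral_finsetSum _ fun j _ => hinteg j s, Finset.mul_sum]
    refine Finset.sum_congr rfl fun j _ => ?_
    have h1 := integral_coord_mul_gm j (F := fun y => pd j f (x + s • y))
      (F' := fun y => s * pd j (pd j f) (x + s • y)) (C := max C (|s| * C))
      (by have := hc' j; fun_prop) (by have := hc'' j; fun_prop)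
      (fun y => (hC' j _).trans (le_max_left _ _))
      (fun y => by
        rw [abs_mul]
        exact (mul_le_mul_of_nonneg_left (hC'' j _) (abs_nonneg _)).trans (le_max_right _ _))
      (fun y => by
        have h2 := pd_hasDerivAt ((contDiff_pd hf j).differentiable one_ne_zero) j (x + s • y) (s * 0)
        have h3 : HasDerivAt (fun t : ℝ => s * t) s 0 := by simpa using (hasDerivAt_id (0:ℝ)).const_mul s
        have h4 := h2.scomp 0 h3
        simp only [Function.comp_def, mul_zero, zero_smul, add_zero, smul_eq_mul] at h4
        simpa [HasLineDerivAt, smul_add, add_assoc, mul_smul] using h4)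
    rw [h1, integral_const_mul]; rfl
  · exact Eventually.of_forall fun t => Continuous.aestronglyMeasurable (by fun_prop)
  · exact integrable_heat hc hC s _
  · refine Continuous.aestronglyMeasurable ?_
    exact continuous_finsetSum _ fun j _ => by have := hc' j; fun_prop
  · refine Eventually.of_forall fun y t _ => (norm_sum_le _ _).trans (Finset.sum_le_sum fun j _ => ?_)
    rw [norm_mul, pow_one]
    exact mul_le_mul ((abs_coord_le y j).trans (by linarith)) (hC' j _) (abs_nonneg _)
      (by positivity)
  · exact integrable_finsetSum _ fun j _ => (integrable_one_add_norm_pow 1).mul_const C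
  · refine Eventually.of_forall fun y t _ => ?_
    have h1 : HasDerivAt (fun t : ℝ => x + t • y) y t := by
      simpa using ((hasDerivAt_id t).smul_const y).const_add x
    rw [← fderiv_eq_sum_pd]
    exact (hd _).hasFDerivAt.comp_hasDerivAt t h1

/-! ### A polynomially decaying weight -/

/-- An integrable weight with polynomial decay. -/
noncomputable def wt (N : ℕ) (x : Eu N) : ℝ := ((1 + ‖x‖ ^ 2) ^ (N + 1))⁻¹

lemma wt_pos (x : Eu N) : 0 < wt N x := by unfold wt; positivity

lemma wt_le_one (x : Eu N) : wt N x ≤ 1 := by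
  unfold wt
  exact inv_le_one_of_one_le₀ (one_le_pow₀ (by nlinarith [sq_nonneg ‖x‖]))

lemma continuous_wt : Continuous (wt N) := by
  unfold wt
  exact Continuous.inv₀ (by fun_prop) fun x => by positivity

lemma abs_wt_le (x : Eu N) : |wt N x| ≤ 1 := by rw [abs_of_pos (wt_pos x)]; exact wt_le_one x

lemma integrable_wt : Integrable (wt N) := by
  have h := integrable_rpow_neg_one_add_norm_sq (E := Eu N) (μ := volume) (r := 2 * (N + 1 : ℕ))
    (by simp; linarith [(Nat.cast_nonneg N : (0:ℝ) ≤ N)])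
  refine h.congr (Eventually.of_forall fun x => ?_)
  simp only [wt]
  rw [show -(2 * ((N + 1 : ℕ) : ℝ)) / 2 = -((N + 1 : ℕ) : ℝ) by ring, rpow_neg (by positivity),
    rpow_natCast]

lemma wt_add_le (x z : Eu N) : wt N (x + z) ≤ 2 ^ (N + 1) * (1 + ‖z‖) ^ (2 * (N + 1)) * wt N x := by
  unfold wt
  rw [pow_mul, ← mul_pow, ← div_eq_mul_inv, inv_le_comm₀ (by positivity) (by positivity), inv_div,
    ← div_pow]
  refine pow_le_pow_left₀ (by positivity) ?_ _
  rw [div_le_iff₀ (by positivity)]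
  have h : ‖x‖ ≤ ‖x + z‖ + ‖z‖ := by simpa using norm_sub_le (x + z) z
  have h0 := norm_nonneg x
  have h1 := norm_nonneg (x + z)
  have h2 := norm_nonneg z
  have : ‖x‖ ^ 2 ≤ (‖x + z‖ + ‖z‖) ^ 2 := by gcongr
  nlinarith [sq_nonneg (‖x + z‖ - ‖z‖), mul_nonneg h1 h2,
    mul_nonneg (sq_nonneg ‖x+z‖) h2, mul_nonneg (sq_nonneg ‖x+z‖) (sq_nonneg ‖z‖)]

lemma heat_wt_le (S : ℝ) :
    ∃ C : ℝ, 0 ≤ C ∧ ∀ s, |s| ≤ S → ∀ x : Eu N, heat s (wt N) x ≤ C * wt N x := by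
  by_cases hS : 0 ≤ S
  swap
  · exact ⟨0, le_rfl, fun s hs => absurd ((abs_nonneg s).trans hs) hS⟩
  refine ⟨∫ y, 2 ^ (N + 1) * (1 + S) ^ (2 * (N + 1)) * (1 + ‖y‖) ^ (2 * (N + 1)) ∂(gm N),
    integral_nonneg fun y => by positivity, fun s hs x => ?_⟩
  rw [← integral_mul_const]
  refine integral_mono (integrable_heat continuous_wt abs_wt_le s x)
    (((integrable_one_add_norm_pow _).const_mul _).mul_const _) fun y => ?_
  refine (wt_add_le x (s • y)).trans ?_
  refine mul_le_mul_of_nonneg_right ?_ (wt_pos x).le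
  rw [mul_assoc, ← mul_pow]
  have : 1 + ‖s • y‖ ≤ (1 + S) * (1 + ‖y‖) := by
    rw [norm_smul, Real.norm_eq_abs]
    nlinarith [norm_nonneg y, mul_le_mul_of_nonneg_right hs (norm_nonneg y)]
  gcongr

/-! ### Locally uniform bounds by powers of a positive function -/

/-- `T s x` is bounded by a multiple of `k s x ^ a`, locally uniformly in `s`. -/
def OB (k : ℝ → Eu N → ℝ) (a : ℝ) (T : ℝ → Eu N → ℝ) : Prop :=
  ∀ S : ℝ, ∃ C : ℝ, 0 ≤ C ∧ ∀ s, |s| ≤ S → ∀ x, |T s x| ≤ C * k s x ^ a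

namespace OB

variable {k T U : ℝ → Eu N → ℝ} {a b : ℝ}

lemma mul (hk : ∀ s x, 0 < k s x) (hT : OB k a T) (hU : OB k b U) :
    OB k (a + b) (fun s x => T s x * U s x) := by
  intro S
  obtain ⟨C, hC, h⟩ := hT S
  obtain ⟨D, hD, h'⟩ := hU S
  refine ⟨C * D, by positivity, fun s hs x => ?_⟩
  rw [abs_mul, rpow_add (hk s x), mul_mul_mul_comm]
  exact mul_le_mul (h s hs x) (h' s hs x) (abs_nonneg _) (mul_nonneg hC (rpow_nonneg (hk s x).le _))

lemma add (hT : OB k a T) (hU : OB k a U) : OB k a (fun s x => T s x + U s x) := by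
  intro S
  obtain ⟨C, hC, h⟩ := hT S
  obtain ⟨D, hD, h'⟩ := hU S
  refine ⟨C + D, by positivity, fun s hs x => ?_⟩
  rw [add_mul]
  exact (abs_add_le _ _).trans (add_le_add (h s hs x) (h' s hs x))

lemma const_mul (hT : OB k a T) (c : ℝ) : OB k a (fun s x => c * T s x) := by
  intro S
  obtain ⟨C, hC, h⟩ := hT S
  refine ⟨|c| * C, by positivity, fun s hs x => ?_⟩
  rw [abs_mul, mul_assoc]
  exact mul_le_mul_of_nonneg_left (h s hs x) (abs_nonneg _)

lemma id_mul (hT : OB k a T) : OB k a (fun s x => s * T s x) := by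
  intro S
  obtain ⟨C, hC, h⟩ := hT S
  refine ⟨|S| * C, by positivity, fun s hs x => ?_⟩
  rw [abs_mul, mul_assoc]
  exact mul_le_mul (hs.trans (le_abs_self S)) (h s hs x) (abs_nonneg _) (abs_nonneg _)

lemma sum {ι : Type*} (t : Finset ι) {T : ι → ℝ → Eu N → ℝ}
    (h : ∀ i ∈ t, OB k a (T i)) : OB k a (fun s x => ∑ i ∈ t, T i s x) := by
  classical
  induction t using Finset.induction_on with
  | empty => exact fun S => ⟨0, le_rfl, fun s _ x => by simp⟩
  | insert i t hi ih =>
    simp only [Finset.sum_insert hi]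
    exact (h i (by simp)).add (ih fun i' hi' => h i' (by simp [hi']))

lemma rpow (hk : ∀ s x, 0 < k s x) (a : ℝ) : OB k a (fun s x => k s x ^ a) := fun S =>
  ⟨1, zero_le_one, fun s _ x => by rw [abs_of_pos (rpow_pos_of_pos (hk s x) _), one_mul]⟩

lemma mono {T' : ℝ → Eu N → ℝ} (hT : OB k a T) (h : ∀ s x, T s x = T' s x) (hab : a = b) :
    OB k b T' := by
  subst hab
  have : T = T' := by ext s x; exact h s x
  exact this ▸ hT

lemma wt_bound (hk : ∀ s x, 0 < k s x) (hk' : OB (fun _ x => wt N x) 1 k) (ha : 1 ≤ a)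
    (hT : OB k a T) : OB (fun _ x => wt N x) 1 T := by
  intro S
  obtain ⟨C, hC, h⟩ := hT S
  obtain ⟨D, hD, h'⟩ := hk' S
  refine ⟨C * D ^ a, by positivity, fun s hs x => (h s hs x).trans ?_⟩
  rw [mul_assoc]
  refine mul_le_mul_of_nonneg_left ?_ hC
  have h1 : k s x ≤ D * wt N x := by
    have := h' s hs x
    rw [rpow_one] at this
    exact (le_abs_self _).trans this
  calc k s x ^ a ≤ (D * wt N x) ^ a := rpow_le_rpow (hk s x).le h1 (by linarith)
    _ = D ^ a * wt N x ^ a := mul_rpow hD (wt_pos x).le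
    _ ≤ D ^ a * wt N x ^ (1 : ℝ) := by
        refine mul_le_mul_of_nonneg_left ?_ (by positivity)
        exact rpow_le_rpow_of_exponent_ge (wt_pos x) (wt_le_one x) ha

lemma integrable (hT : OB (fun _ x => wt N x) 1 T) {s : ℝ} (hc : Continuous (T s)) :
    Integrable (T s) := by
  obtain ⟨C, hC, h⟩ := hT |s|
  refine (integrable_wt.const_mul C).mono' hc.aestronglyMeasurable (Eventually.of_forall fun x => ?_)
  simpa using h s le_rfl x

end OB

/-- Differentiation under the integral sign with a polynomially decaying majorant. -/
lemma hasDerivAt_integral_of_OB {F F' : ℝ → Eu N → ℝ} (hF : OB (fun _ x => wt N x) 1 F)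
    (hF' : OB (fun _ x => wt N x) 1 F') (hc : ∀ s, Continuous (F s)) (hc' : ∀ s, Continuous (F' s))
    (hd : ∀ s x, HasDerivAt (fun s => F s x) (F' s x) s) (s : ℝ) :
    HasDerivAt (fun s => ∫ x, F s x) (∫ x, F' s x) s := by
  obtain ⟨C, hC, h⟩ := hF' (|s| + 1)
  refine (hasDerivAt_integral_of_dominated_loc_of_deriv_le (bound := fun x => C * wt N x)
    (s := Metric.ball s 1) (Metric.ball_mem_nhds s one_pos) ?_ ?_ ?_ ?_ ?_ ?_).2
  · exact Eventually.of_forall fun t => (hc t).aestronglyMeasurable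
  · exact hF.integrable (hc s)
  · exact (hc' s).aestronglyMeasurable
  · refine Eventually.of_forall fun x t ht => ?_
    rw [Metric.mem_ball, Real.dist_eq] at ht
    have : |t| ≤ |s| + 1 := by
      have := abs_add_le (t - s) s
      rw [sub_add_cancel] at this
      linarith
    simpa using h t this x
  · exact integrable_wt.const_mul C
  · exact Eventually.of_forall fun x t _ => hd t x

/-- Integration by parts for real functions. -/
lemma integral_ibp {a a' b b' : Eu N → ℝ} {j : Fin N} (h1 : Integrable (fun x => a x * b' x))
    (h2 : Integrable (fun x => a' x * b x)) (h3 : Integrable (fun x => a x * b x))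
    (ha : ∀ x, HasLineDerivAt ℝ a (a' x) x (ee j)) (hb : ∀ x, HasLineDerivAt ℝ b (b' x) x (ee j)) :
    ∫ x, a x * b' x = - ∫ x, a' x * b x :=
  integral_bilinear_hasLineDerivAt_right_eq_neg_left_of_integrable
    (B := ContinuousLinearMap.mul ℝ ℝ) h2 h1 h3 (fun x _ => ha x) (fun x _ => hb x)

/-! ### Functions controlled by a weight, together with their derivatives -/

/-- `w` and its pure derivatives up to order two are bounded by a multiple of `κ ^ β`. -/
structure Ctrl (β : ℝ) (κ w : Eu N → ℝ) : Prop where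
  contDiff : ContDiff ℝ 2 w
  bound : ∃ C : ℝ, 0 ≤ C ∧ ∀ x, |w x| ≤ C * κ x ^ β ∧
    ∀ j, |pd j w x| ≤ C * κ x ^ β ∧ |pd j (pd j w) x| ≤ C * κ x ^ β

/-- A positive weight with polynomial decay which controls its own derivatives. -/
structure Weight (κ : Eu N → ℝ) : Prop where
  pos : ∀ x, 0 < κ x
  le_wt : ∃ C : ℝ, 0 ≤ C ∧ ∀ x, κ x ≤ C * wt N x
  ctrl : Ctrl 1 κ κ

namespace Weight

variable {κ w : Eu N → ℝ} {β : ℝ}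

lemma continuous (hκ : Weight κ) : Continuous κ := hκ.ctrl.contDiff.continuous

lemma bdd (hκ : Weight κ) : ∃ C : ℝ, 0 ≤ C ∧ ∀ x, |κ x| ≤ C := by
  obtain ⟨C, hC, h⟩ := hκ.le_wt
  refine ⟨C, hC, fun x => ?_⟩
  rw [abs_of_pos (hκ.pos x)]
  exact (h x).trans (mul_le_of_le_one_right hC (wt_le_one x))

lemma heat_pos (hκ : Weight κ) (s : ℝ) (x : Eu N) : 0 < heat s κ x := by
  obtain ⟨C, hC, h⟩ := hκ.bdd
  exact ResolventEstimate.heat_pos hκ.continuous h hκ.pos s x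

lemma heat_wt (hκ : Weight κ) : OB (fun _ x => wt N x) 1 (fun s x => heat s κ x) := by
  intro S
  obtain ⟨C, hC, h⟩ := hκ.le_wt
  obtain ⟨D, hD, h'⟩ := heat_wt_le (N := N) S
  obtain ⟨M, hM, hb⟩ := hκ.bdd
  refine ⟨C * D, by positivity, fun s hs x => ?_⟩
  rw [abs_of_pos (hκ.heat_pos s x), rpow_one, mul_assoc]
  refine le_trans ?_ (mul_le_mul_of_nonneg_left (h' s hs x) hC)
  rw [← heat_const_mul]
  refine heat_mono hκ.continuous (continuous_const.mul continuous_wt) hb (C' := C) (fun x => ?_) h s x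
  change |C * wt N x| ≤ C
  rw [abs_mul, abs_of_nonneg hC]
  exact mul_le_of_le_one_right hC (abs_wt_le x)

lemma continuous_rpow (hκ : Weight κ) (β : ℝ) : Continuous (fun x => κ x ^ β) :=
  hκ.continuous.rpow_const fun x => Or.inl (hκ.pos x).ne'

lemma rpow_bdd (hκ : Weight κ) (hβ : 0 < β) : ∃ C : ℝ, 0 ≤ C ∧ ∀ x, |κ x ^ β| ≤ C := by
  obtain ⟨C, hC, h⟩ := hκ.bdd
  refine ⟨C ^ β, by positivity, fun x => ?_⟩
  rw [abs_of_pos (rpow_pos_of_pos (hκ.pos x) _)]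
  exact rpow_le_rpow (hκ.pos x).le ((le_abs_self _).trans (h x)) hβ.le

lemma abs_heat_le_rpow (hκ : Weight κ) (hβ : 0 < β) (hβ1 : β ≤ 1) {w : Eu N → ℝ} {C : ℝ}
    (hC : 0 ≤ C) (h : ∀ x, |w x| ≤ C * κ x ^ β) (s : ℝ) (x : Eu N) :
    |heat s w x| ≤ C * heat s κ x ^ β := by
  obtain ⟨M, hM, hb⟩ := hκ.bdd
  obtain ⟨M', hM', hb'⟩ := hκ.rpow_bdd hβ
  have h1 := abs_heat_le (g := fun x => C * κ x ^ β) (continuous_const.mul (hκ.continuous_rpow β))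
    (C' := C * M') (fun x => by
      rw [abs_mul, abs_of_nonneg hC]; exact mul_le_mul_of_nonneg_left (hb' x) hC) h s x
  rw [heat_const_mul] at h1
  exact h1.trans (mul_le_mul_of_nonneg_left (heat_rpow_le hκ.continuous hb hκ.pos hβ hβ1 s x) hC)

end Weight

namespace Ctrl

variable {κ w : Eu N → ℝ} {β : ℝ}

lemma bdd (hw : Ctrl β κ w) (hκ : Weight κ) (hβ : 0 < β) :
    ∃ C : ℝ, (∀ x, |w x| ≤ C) ∧ (∀ j x, |pd j w x| ≤ C) ∧ ∀ j x, |pd j (pd j w) x| ≤ C := by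
  obtain ⟨C, hC, h⟩ := hw.bound
  obtain ⟨M, hM, hb⟩ := hκ.rpow_bdd hβ
  have : ∀ x, C * κ x ^ β ≤ C * M := fun x =>
    mul_le_mul_of_nonneg_left ((le_abs_self _).trans (hb x)) hC
  exact ⟨C * M, fun x => (h x).1.trans (this x), fun j x => ((h x).2 j).1.trans (this x),
    fun j x => ((h x).2 j).2.trans (this x)⟩

lemma continuous_pd (hw : Ctrl β κ w) (j : Fin N) : Continuous (pd j w) :=
  ResolventEstimate.continuous_pd (hw.contDiff.of_le (by norm_num)) j

lemma continuous_pd_pd (hw : Ctrl β κ w) (j : Fin N) : Continuous (pd j (pd j w)) :=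
  ResolventEstimate.continuous_pd (contDiff_pd hw.contDiff j) j

variable (hw : Ctrl β κ w) (hκ : Weight κ) (hβ : 0 < β)
include hw hκ hβ

lemma continuous_heat (s : ℝ) : Continuous (heat s w) := by
  obtain ⟨C, h, -⟩ := hw.bdd hκ hβ
  exact ResolventEstimate.continuous_heat hw.contDiff.continuous h s

lemma continuous_heat_pd (j : Fin N) (s : ℝ) : Continuous (heat s (pd j w)) := by
  obtain ⟨C, -, h, -⟩ := hw.bdd hκ hβ
  exact ResolventEstimate.continuous_heat (hw.continuous_pd j) (h j) s

lemma continuous_heat_pd_pd (j : Fin N) (s : ℝ) : Continuous (heat s (pd j (pd j w))) := by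
  obtain ⟨C, -, -, h⟩ := hw.bdd hκ hβ
  exact ResolventEstimate.continuous_heat (hw.continuous_pd_pd j) (h j) s

lemma lineDeriv_heat (j : Fin N) (s : ℝ) (x : Eu N) :
    HasLineDerivAt ℝ (heat s w) (heat s (pd j w) x) x (ee j) := by
  obtain ⟨C, h, h1, -⟩ := hw.bdd hκ hβ
  exact heat_hasLineDerivAt (hw.contDiff.of_le (by norm_num)) h j (h1 j) s x

lemma lineDeriv_heat_pd (j : Fin N) (s : ℝ) (x : Eu N) :
    HasLineDerivAt ℝ (heat s (pd j w)) (heat s (pd j (pd j w)) x) x (ee j) := by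
  obtain ⟨C, h, h1, h2⟩ := hw.bdd hκ hβ
  exact heat_hasLineDerivAt (contDiff_pd hw.contDiff j) (h1 j) j (h2 j) s x

lemma deriv_heat (s : ℝ) (x : Eu N) :
    HasDerivAt (fun s => heat s w x) (s * ∑ j, heat s (pd j (pd j w)) x) s := by
  obtain ⟨C, h, h1, h2⟩ := hw.bdd hκ hβ
  exact heat_hasDerivAt hw.contDiff h h1 h2 s x

lemma ob (hβ1 : β ≤ 1) : OB (fun s x => heat s κ x) β (fun s x => heat s w x) := fun _ => by
  obtain ⟨C, hC, h⟩ := hw.bound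
  exact ⟨C, hC, fun s _ x => hκ.abs_heat_le_rpow hβ hβ1 hC (fun x => (h x).1) s x⟩

lemma ob_pd (hβ1 : β ≤ 1) (j : Fin N) :
    OB (fun s x => heat s κ x) β (fun s x => heat s (pd j w) x) := fun _ => by
  obtain ⟨C, hC, h⟩ := hw.bound
  exact ⟨C, hC, fun s _ x => hκ.abs_heat_le_rpow hβ hβ1 hC (fun x => ((h x).2 j).1) s x⟩

lemma ob_pd_pd (hβ1 : β ≤ 1) (j : Fin N) :
    OB (fun s x => heat s κ x) β (fun s x => heat s (pd j (pd j w)) x) := fun _ => by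
  obtain ⟨C, hC, h⟩ := hw.bound
  exact ⟨C, hC, fun s _ x => hκ.abs_heat_le_rpow hβ hβ1 hC (fun x => ((h x).2 j).2) s x⟩

end Ctrl

/-! ### The energy identity -/

lemma hasLineDerivAt_mul {f g : Eu N → ℝ} {f' g' : ℝ} {x v : Eu N}
    (hf : HasLineDerivAt ℝ f f' x v) (hg : HasLineDerivAt ℝ g g' x v) :
    HasLineDerivAt ℝ (fun x => f x * g x) (f' * g x + f x * g') x v := by
  have := HasDerivAt.mul hf hg
  simp only [zero_smul, add_zero] at this
  exact this

lemma hasLineDerivAt_rpow {f : Eu N → ℝ} {f' : ℝ} {x v : Eu N}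
    (hf : HasLineDerivAt ℝ f f' x v) (hpos : 0 < f x) (a : ℝ) :
    HasLineDerivAt ℝ (fun x => f x ^ a) (a * f x ^ (a - 1) * f') x v := by
  have := HasDerivAt.rpow_const (p := a) hf (Or.inl (by simpa using hpos.ne'))
  simp only [zero_smul, add_zero] at this
  exact this.congr_deriv (by ring)

/-- The quadratic form produced by differentiating `∫ k ^ a * W ^ 2` along the heat flow. -/
noncomputable def qform (a k W k' W' : ℝ) : ℝ :=
  a * (a - 1) * (k ^ (a - 2) * (W * W) * (k' * k')) + 4 * a * (k ^ (a - 1) * W * (k' * W')) +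
    2 * (k ^ a * (W' * W'))

section Energy

variable {κ w : Eu N → ℝ} {β a p : ℝ} (hκ : Weight κ) (hw : Ctrl β κ w)
  (hβ : 0 < β) (hβ1 : β ≤ 1) (hp : 1 ≤ p) (hap : a + 2 * β = p)
include hκ hw hβ hβ1 hp hap

omit hp in
lemma ob_qform (j : Fin N) : OB (fun s x => heat s κ x) p (fun s x =>
    qform a (heat s κ x) (heat s w x) (heat s (pd j κ) x) (heat s (pd j w) x)) := by
  have hk := hκ.heat_pos
  have hW := hw.ob hκ hβ hβ1
  have hW1 := hw.ob_pd hκ hβ hβ1 j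
  have hk1 := hκ.ctrl.ob_pd hκ one_pos le_rfl j
  have h1 := (((OB.rpow hk (a - 2)).mul hk (hW.mul hk hW)).mul hk (hk1.mul hk hk1)).const_mul
    (a * (a - 1))
  have h2 := (((OB.rpow hk (a - 1)).mul hk hW).mul hk (hk1.mul hk hW1)).const_mul (4 * a)
  have h3 := ((OB.rpow hk a).mul hk (hW1.mul hk hW1)).const_mul 2
  exact ((h1.mono (fun _ _ => rfl) (b := p) (by linarith)).add
    (h2.mono (fun _ _ => rfl) (by linarith))).add (h3.mono (fun _ _ => rfl) (by linarith))

omit hβ1 hp hap in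
lemma continuous_qform (j : Fin N) (s : ℝ) : Continuous (fun x =>
    qform a (heat s κ x) (heat s w x) (heat s (pd j κ) x) (heat s (pd j w) x)) := by
  have hk := hκ.heat_pos
  have hr : ∀ b : ℝ, Continuous fun x => heat s κ x ^ b := fun b =>
    (hκ.ctrl.continuous_heat hκ one_pos s).rpow_const fun x => Or.inl (hk s x).ne'
  have c1 := hw.continuous_heat hκ hβ s
  have c2 := hw.continuous_heat_pd hκ hβ j s
  have c3 := hκ.ctrl.continuous_heat_pd hκ one_pos j s
  have r1 := hr a
  have r2 := hr (a - 1)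
  have r3 := hr (a - 2)
  unfold qform
  fun_prop

lemma integrable_qform (j : Fin N) (s : ℝ) : Integrable (fun x =>
    qform a (heat s κ x) (heat s w x) (heat s (pd j κ) x) (heat s (pd j w) x)) :=
  (OB.wt_bound hκ.heat_pos hκ.heat_wt hp (ob_qform hκ hw hβ hβ1 hap j)).integrable
    (continuous_qform hκ hw hβ j s)

lemma hasDerivAt_energy (s : ℝ) :
    HasDerivAt (fun s => ∫ x, heat s κ x ^ a * (heat s w x * heat s w x))
      (- s * ∑ j, ∫ x,
        qform a (heat s κ x) (heat s w x) (heat s (pd j κ) x) (heat s (pd j w) x)) s := by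
  have hk := hκ.heat_pos
  have hr : ∀ b s : ℝ, Continuous fun x => heat s κ x ^ b := fun b s =>
    (hκ.ctrl.continuous_heat hκ one_pos s).rpow_const fun x => Or.inl (hk s x).ne'
  have hW := hw.ob hκ hβ hβ1
  have hW1 := hw.ob_pd hκ hβ hβ1
  have hW2 := hw.ob_pd_pd hκ hβ hβ1
  have hk1 := hκ.ctrl.ob_pd hκ one_pos le_rfl
  have hk2 := hκ.ctrl.ob_pd_pd hκ one_pos le_rfl
  have cW := hw.continuous_heat hκ hβ
  have cW1 := hw.continuous_heat_pd hκ hβ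
  have cW2 := hw.continuous_heat_pd_pd hκ hβ
  have ck1 := hκ.ctrl.continuous_heat_pd hκ one_pos
  have ck2 := hκ.ctrl.continuous_heat_pd_pd hκ one_pos
  have toWt : ∀ {b : ℝ} {T : ℝ → Eu N → ℝ}, OB (fun s x => heat s κ x) b T → b = p →
      OB (fun _ x => wt N x) 1 T := fun hT hb =>
    OB.wt_bound hk hκ.heat_wt hp (hT.mono (fun _ _ => rfl) hb)
  have t1 : ∀ j, OB (fun _ x => wt N x) 1 (fun s x =>
      heat s κ x ^ (a - 1) * (heat s w x * heat s w x) * heat s (pd j (pd j κ)) x) := fun j =>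
    toWt (((OB.rpow hk (a - 1)).mul hk (hW.mul hk hW)).mul hk (hk2 j)) (by linarith)
  have t2 : ∀ j, OB (fun _ x => wt N x) 1 (fun s x =>
      heat s κ x ^ a * heat s w x * heat s (pd j (pd j w)) x) := fun j =>
    toWt (((OB.rpow hk a).mul hk hW).mul hk (hW2 j)) (by linarith)
  have c1 : ∀ j s, Continuous (fun x =>
      heat s κ x ^ (a - 1) * (heat s w x * heat s w x) * heat s (pd j (pd j κ)) x) := fun j s =>
    ((hr (a - 1) s).mul ((cW s).mul (cW s))).mul (ck2 j s)
  have c2 : ∀ j s, Continuous (fun x =>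
      heat s κ x ^ a * heat s w x * heat s (pd j (pd j w)) x) := fun j s =>
    ((hr a s).mul (cW s)).mul (cW2 j s)
  have key : HasDerivAt (fun s => ∫ x, heat s κ x ^ a * (heat s w x * heat s w x))
      (∫ x, s * ∑ j, (a * (heat s κ x ^ (a - 1) * (heat s w x * heat s w x) *
        heat s (pd j (pd j κ)) x) +
        2 * (heat s κ x ^ a * heat s w x * heat s (pd j (pd j w)) x))) s := by
    refine hasDerivAt_integral_of_OB
      (F' := fun s x => s * ∑ j, (a * (heat s κ x ^ (a - 1) * (heat s w x * heat s w x) *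
        heat s (pd j (pd j κ)) x) +
        2 * (heat s κ x ^ a * heat s w x * heat s (pd j (pd j w)) x))) ?_ ?_ (fun s => ?_)
      (fun s => ?_) (fun s x => ?_) s
    · exact toWt ((OB.rpow hk a).mul hk (hW.mul hk hW)) (by linarith)
    · exact OB.id_mul (OB.sum _ fun j _ => ((t1 j).const_mul a).add ((t2 j).const_mul 2))
    · exact (hr a s).mul ((cW s).mul (cW s))
    · exact continuous_const.mul (continuous_finsetSum _ fun j _ =>
        (continuous_const.mul (c1 j s)).add (continuous_const.mul (c2 j s)))
    · have h1 := hκ.ctrl.deriv_heat hκ one_pos s x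
      have h2 := hw.deriv_heat hκ hβ s x
      have h3 := (h1.rpow_const (p := a) (Or.inl (hk s x).ne')).mul (h2.mul h2)
      refine h3.congr_deriv ?_
      simp only [Finset.sum_add_distrib, ← Finset.mul_sum, Pi.mul_apply]
      ring
  refine key.congr_deriv ?_
  have m0 : ∀ j, Integrable fun x => a * (heat s κ x ^ (a - 1) * (heat s w x * heat s w x) *
      heat s (pd j (pd j κ)) x) + 2 * (heat s κ x ^ a * heat s w x * heat s (pd j (pd j w)) x) :=
    fun j => (((t1 j).integrable (c1 j s)).const_mul a).add
      (((t2 j).integrable (c2 j s)).const_mul 2)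
  rw [integral_const_mul, integral_finsetSum _ fun j _ => m0 j, neg_mul, ← mul_neg,
    ← Finset.sum_neg_distrib]
  congr 1
  refine Finset.sum_congr rfl fun j _ => ?_
  have dk := hκ.ctrl.lineDeriv_heat hκ one_pos j s
  have dk1 := hκ.ctrl.lineDeriv_heat_pd hκ one_pos j s
  have dW := hw.lineDeriv_heat hκ hβ j s
  have dW1 := hw.lineDeriv_heat_pd hκ hβ j s
  have m1 : Integrable (fun x => heat s κ x ^ (a - 2) * (heat s w x * heat s w x) *
      (heat s (pd j κ) x * heat s (pd j κ) x)) :=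
    (toWt (((OB.rpow hk (a - 2)).mul hk (hW.mul hk hW)).mul hk ((hk1 j).mul hk (hk1 j)))
      (by linarith)).integrable (s := s)
      (((hr (a - 2) s).mul ((cW s).mul (cW s))).mul ((ck1 j s).mul (ck1 j s)))
  have m2 : Integrable (fun x => heat s κ x ^ (a - 1) * heat s w x *
      (heat s (pd j κ) x * heat s (pd j w) x)) :=
    (toWt (((OB.rpow hk (a - 1)).mul hk hW).mul hk ((hk1 j).mul hk (hW1 j)))
      (by linarith)).integrable (s := s)
      (((hr (a - 1) s).mul (cW s)).mul ((ck1 j s).mul (cW1 j s)))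
  have m3 : Integrable (fun x => heat s κ x ^ a * (heat s (pd j w) x * heat s (pd j w) x)) :=
    (toWt ((OB.rpow hk a).mul hk ((hW1 j).mul hk (hW1 j))) (by linarith)).integrable (s := s)
      ((hr a s).mul ((cW1 j s).mul (cW1 j s)))
  have i1 := integral_ibp (j := j)
    (a := fun x => heat s κ x ^ (a - 1) * (heat s w x * heat s w x))
    (a' := fun x => (a - 1) * heat s κ x ^ (a - 1 - 1) * heat s (pd j κ) x *
      (heat s w x * heat s w x) + heat s κ x ^ (a - 1) *
        (heat s (pd j w) x * heat s w x + heat s w x * heat s (pd j w) x))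
    (b := fun x => heat s (pd j κ) x) (b' := fun x => heat s (pd j (pd j κ)) x)
    ((t1 j).integrable (c1 j s))
    (by
      refine ((m1.const_mul (a - 1)).add (m2.const_mul 2)).congr
        (Eventually.of_forall fun x => ?_)
      simp only [Pi.add_apply, show a - 1 - 1 = a - 2 by ring]
      ring)
    ((toWt (((OB.rpow hk (a - 1)).mul hk (hW.mul hk hW)).mul hk (hk1 j))
      (by linarith)).integrable (s := s) (((hr (a - 1) s).mul ((cW s).mul (cW s))).mul (ck1 j s)))
    (fun x => hasLineDerivAt_mul (hasLineDerivAt_rpow (dk x) (hk s x) _)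
      (hasLineDerivAt_mul (dW x) (dW x))) dk1
  have i2 := integral_ibp (j := j)
    (a := fun x => heat s κ x ^ a * heat s w x)
    (a' := fun x => a * heat s κ x ^ (a - 1) * heat s (pd j κ) x * heat s w x +
      heat s κ x ^ a * heat s (pd j w) x)
    (b := fun x => heat s (pd j w) x) (b' := fun x => heat s (pd j (pd j w)) x)
    ((t2 j).integrable (c2 j s))
    (by
      refine ((m2.const_mul a).add m3).congr (Eventually.of_forall fun x => ?_)
      simp only [Pi.add_apply]
      ring)
    ((toWt (((OB.rpow hk a).mul hk hW).mul hk (hW1 j))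
      (by linarith)).integrable (s := s) (((hr a s).mul (cW s)).mul (cW1 j s)))
    (fun x => hasLineDerivAt_mul (hasLineDerivAt_rpow (dk x) (hk s x) _) (dW x)) dW1
  rw [integral_add (((t1 j).integrable (c1 j s)).const_mul a)
    (((t2 j).integrable (c2 j s)).const_mul 2), integral_const_mul, integral_const_mul, i1, i2]
  have e1 : ∀ x, ((a - 1) * heat s κ x ^ (a - 1 - 1) * heat s (pd j κ) x *
      (heat s w x * heat s w x) + heat s κ x ^ (a - 1) *
        (heat s (pd j w) x * heat s w x + heat s w x * heat s (pd j w) x)) * heat s (pd j κ) x =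
      (a - 1) * (heat s κ x ^ (a - 2) * (heat s w x * heat s w x) *
      (heat s (pd j κ) x * heat s (pd j κ) x)) + 2 * (heat s κ x ^ (a - 1) * heat s w x *
      (heat s (pd j κ) x * heat s (pd j w) x)) := fun x => by
    rw [show a - 1 - 1 = a - 2 by ring]; ring
  have e2 : ∀ x, (a * heat s κ x ^ (a - 1) * heat s (pd j κ) x * heat s w x +
      heat s κ x ^ a * heat s (pd j w) x) * heat s (pd j w) x =
      a * (heat s κ x ^ (a - 1) * heat s w x * (heat s (pd j κ) x * heat s (pd j w) x)) +
      heat s κ x ^ a * (heat s (pd j w) x * heat s (pd j w) x) := fun x => by ring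
  simp only [e1, e2, qform]
  have m12 := (m1.const_mul (a * (a - 1))).add (m2.const_mul (4 * a))
  simp only [Pi.add_def] at m12
  rw [integral_add (m1.const_mul _) (m2.const_mul _), integral_add (m2.const_mul _) m3,
    integral_add m12 (m3.const_mul _), integral_add (m1.const_mul _) (m2.const_mul _)]
  simp only [integral_const_mul]
  ring

end Energy

/-! ### The Bellman function argument -/

lemma qform_eq {a k : ℝ} (hk : 0 < k) (W k' W' : ℝ) : qform a k W k' W' =
    k ^ a * (a * (a - 1) * (W / k) ^ 2 * k' ^ 2 + 4 * a * (W / k) * k' * W' + 2 * W' ^ 2) := by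
  unfold qform
  rw [rpow_sub hk, rpow_sub hk, rpow_one, rpow_two]
  field_simp

lemma le_bellman {p k u v k' u' v' : ℝ} (hp : 1 < p) (hp2 : p ≤ 2) (hk : 0 < k)
    (hu : |u| ≤ k) (hv : |v| ≤ k ^ (p - 1)) :
    k ^ (p - 2) * u' ^ 2 + k ^ (2 - p) * v' ^ 2 ≤ 9 / (p * (p - 1)) * qform (p - 2) k k k' k' +
      qform (p - 2) k u k' u' + qform (2 - p) k v k' v' := by
  have hpp : 0 < p * (p - 1) := by nlinarith
  rw [qform_eq hk, qform_eq hk, qform_eq hk, div_self hk.ne']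
  have hm : 0 < k ^ (p - 2) := rpow_pos_of_pos hk _
  have h1 : k ^ (2 - p) = (k ^ (p - 2))⁻¹ := by rw [← rpow_neg hk.le]; congr 1; ring
  have h2 : k ^ (p - 1) = k ^ (p - 2) * k := by
    rw [← rpow_add_one hk.ne']; congr 1; ring
  rw [h1]
  rw [h2] at hv
  generalize k ^ (p - 2) = m at hm hv
  obtain ⟨t, rfl⟩ : ∃ t, u = t * k := ⟨u / k, by field_simp⟩
  obtain ⟨τ, rfl⟩ : ∃ τ, v = τ * (m * k) := ⟨v / (m * k), by field_simp⟩
  obtain ⟨z, rfl⟩ : ∃ z, v' = m * z := ⟨v' / m, by field_simp⟩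
  rw [abs_mul, abs_of_pos hk] at hu
  rw [abs_mul, abs_of_pos (by positivity : 0 < m * k)] at hv
  have ht : t ^ 2 ≤ 1 := (sq_le_one_iff_abs_le_one t).2 (by nlinarith)
  have hτ : τ ^ 2 ≤ 1 := (sq_le_one_iff_abs_le_one τ).2 (by
    have : 0 < m * k := by positivity
    nlinarith)
  have e1 : 9 / (p * (p - 1)) * (m * ((p - 2) * (p - 2 - 1) * 1 ^ 2 * k' ^ 2 +
      4 * (p - 2) * 1 * k' * k' + 2 * k' ^ 2)) = m * (9 * k' ^ 2) := by
    have : p - 1 ≠ 0 := by linarith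
    field_simp
    ring
  have e2 : t * k / k = t := by field_simp
  have e3 : m⁻¹ * ((2 - p) * (2 - p - 1) * (τ * (m * k) / k) ^ 2 * k' ^ 2 +
      4 * (2 - p) * (τ * (m * k) / k) * k' * (m * z) + 2 * (m * z) ^ 2) =
      m * ((2 - p) * (1 - p) * τ ^ 2 * k' ^ 2 + 4 * (2 - p) * τ * k' * z + 2 * z ^ 2) := by
    field_simp
    ring
  have e4 : m⁻¹ * (m * z) ^ 2 = m * z ^ 2 := by field_simp
  rw [e1, e2, e3, e4, ← mul_add, ← mul_add, ← mul_add]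
  refine mul_le_mul_of_nonneg_left ?_ hm.le
  have a1 : 0 ≤ (p - 2) * (p - 2 - 1) * t ^ 2 * k' ^ 2 :=
    mul_nonneg (mul_nonneg (by nlinarith) (sq_nonneg _)) (sq_nonneg _)
  have a2 : 0 ≤ (2 * (p - 2) * t * k' + u') ^ 2 := sq_nonneg _
  have a3 : 0 ≤ (2 * (2 - p) * τ * k' + z) ^ 2 := sq_nonneg _
  have hr : (2 - p) ^ 2 ≤ 1 := by nlinarith
  have a4 : (2 - p) ^ 2 * t ^ 2 ≤ 1 := mul_le_one₀ hr (sq_nonneg _) ht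
  have a5 : (2 - p) ^ 2 * τ ^ 2 ≤ 1 := mul_le_one₀ hr (sq_nonneg _) hτ
  have a6 : (2 - p) * (p - 1) * τ ^ 2 ≤ 1 / 4 := by
    have : (2 - p) * (p - 1) ≤ 1 / 4 := by nlinarith [sq_nonneg (2 * p - 3)]
    have h0 : 0 ≤ (2 - p) * (p - 1) := mul_nonneg (by linarith) (by linarith)
    nlinarith [sq_nonneg τ]
  have a4' := mul_le_mul_of_nonneg_right a4 (sq_nonneg k')
  have a5' := mul_le_mul_of_nonneg_right a5 (sq_nonneg k')
  have a6' := mul_le_mul_of_nonneg_right a6 (sq_nonneg k')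
  linarith [sq_nonneg k']

lemma Weight.integrable_rpow {κ : Eu N → ℝ} (hκ : Weight κ) {p : ℝ} (hp : 1 ≤ p) :
    Integrable (fun x => κ x ^ p) := by
  have := (OB.wt_bound hκ.heat_pos hκ.heat_wt hp (OB.rpow hκ.heat_pos p)).integrable (s := 0)
    ((hκ.ctrl.continuous_heat hκ one_pos 0).rpow_const
      fun x => Or.inl (hκ.heat_pos 0 x).ne')
  simpa only [heat_zero] using this

theorem bellman_bound {κ f φ : Eu N → ℝ} {p : ℝ} (hp : 1 < p) (hp2 : p ≤ 2) (hκ : Weight κ)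
    (hf : Ctrl 1 κ f) (hφ : Ctrl (p - 1) κ φ) (hfk : ∀ x, |f x| ≤ κ x)
    (hφk : ∀ x, |φ x| ≤ κ x ^ (p - 1)) {i j : Fin N} {A : ℝ → ℝ}
    (hA : ∀ s, HasDerivAt A (-2 * s * ∫ x, heat s (pd i f) x * heat s (pd j φ) x) s)
    (hlim : Tendsto A atTop (𝓝 0)) :
    |A 0| ≤ (9 / (p * (p - 1)) + 2) * ∫ x, κ x ^ p := by
  have hK : 0 < 9 / (p * (p - 1)) := div_pos (by norm_num) (by nlinarith)
  have hk := hκ.heat_pos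
  have hp0 : 0 < p - 1 := by linarith
  have hp1 : p - 1 ≤ 1 := by linarith
  set K := 9 / (p * (p - 1)) with hKdef
  set Φ : ℝ → ℝ := fun s => K * (∫ x, heat s κ x ^ (p - 2) * (heat s κ x * heat s κ x)) +
    (∫ x, heat s κ x ^ (p - 2) * (heat s f x * heat s f x)) +
    ∫ x, heat s κ x ^ (2 - p) * (heat s φ x * heat s φ x) with hΦ
  let Q : Fin N → ℝ → Eu N → ℝ := fun l s x =>
    K * qform (p - 2) (heat s κ x) (heat s κ x) (heat s (pd l κ) x) (heat s (pd l κ) x) +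
    qform (p - 2) (heat s κ x) (heat s f x) (heat s (pd l κ) x) (heat s (pd l f) x) +
    qform (2 - p) (heat s κ x) (heat s φ x) (heat s (pd l κ) x) (heat s (pd l φ) x)
  have q1 := fun l s => integrable_qform hκ hκ.ctrl one_pos le_rfl hp.le
    (a := p - 2) (by ring) l s
  have q2 := fun l s => integrable_qform hκ hf one_pos le_rfl hp.le (a := p - 2) (by ring) l s
  have q3 := fun l s => integrable_qform hκ hφ hp0 hp1 hp.le (a := 2 - p) (by ring) l s
  have hQi : ∀ l s, Integrable (Q l s) := fun l s => (((q1 l s).const_mul K).add (q2 l s)).add (q3 l s)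
  have hΦd : ∀ s, HasDerivAt Φ (-s * ∫ x, ∑ l, Q l s x) s := by
    intro s
    have e1 := hasDerivAt_energy hκ hκ.ctrl one_pos le_rfl hp.le (a := p - 2) (by ring) s
    have e2 := hasDerivAt_energy hκ hf one_pos le_rfl hp.le (a := p - 2) (by ring) s
    have e3 := hasDerivAt_energy hκ hφ hp0 hp1 hp.le (a := 2 - p) (by ring) s
    refine (((e1.const_mul K).add e2).add e3).congr_deriv ?_
    rw [integral_finsetSum _ fun l _ => hQi l s]
    have : ∀ l, ∫ x, Q l s x = K * (∫ x, qform (p - 2) (heat s κ x) (heat s κ x)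
        (heat s (pd l κ) x) (heat s (pd l κ) x)) + (∫ x, qform (p - 2) (heat s κ x) (heat s f x)
        (heat s (pd l κ) x) (heat s (pd l f) x)) + ∫ x, qform (2 - p) (heat s κ x) (heat s φ x)
        (heat s (pd l κ) x) (heat s (pd l φ) x) := fun l => by
      have h12 := ((q1 l s).const_mul K).add (q2 l s)
      simp only [Pi.add_def] at h12
      rw [integral_add h12 (q3 l s), integral_add ((q1 l s).const_mul K) (q2 l s),
        integral_const_mul]
    simp only [this, Finset.sum_add_distrib, ← Finset.mul_sum]
    ring
  have hbd_u : ∀ s x, |heat s f x| ≤ heat s κ x := fun s x => by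
    have := hκ.abs_heat_le_rpow one_pos le_rfl zero_le_one (w := f)
      (fun x => by rw [rpow_one, one_mul]; exact hfk x) s x
    rwa [rpow_one, one_mul] at this
  have hbd_v : ∀ s x, |heat s φ x| ≤ heat s κ x ^ (p - 1) := fun s x => by
    have := hκ.abs_heat_le_rpow hp0 hp1 zero_le_one (w := φ)
      (fun x => by rw [one_mul]; exact hφk x) s x
    rwa [one_mul] at this
  have hQ : ∀ l s x, heat s κ x ^ (p - 2) * heat s (pd l f) x ^ 2 +
      heat s κ x ^ (2 - p) * heat s (pd l φ) x ^ 2 ≤ Q l s x := fun l s x =>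
    le_bellman hp hp2 (hk s x) (hbd_u s x) (hbd_v s x)
  have hpt : ∀ s x, |2 * (heat s (pd i f) x * heat s (pd j φ) x)| ≤ ∑ l, Q l s x := by
    intro s x
    have hm : 0 < heat s κ x ^ (p - 2) := rpow_pos_of_pos (hk s x) _
    have hm' : 0 < heat s κ x ^ (2 - p) := rpow_pos_of_pos (hk s x) _
    have hmm : heat s κ x ^ (p - 2) * heat s κ x ^ (2 - p) = 1 := by
      rw [← rpow_add (hk s x)]; simp
    have h1 : heat s κ x ^ (p - 2) * heat s (pd i f) x ^ 2 ≤
        ∑ l, heat s κ x ^ (p - 2) * heat s (pd l f) x ^ 2 :=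
      Finset.single_le_sum (f := fun l => heat s κ x ^ (p - 2) * heat s (pd l f) x ^ 2)
        (fun l _ => by positivity) (Finset.mem_univ i)
    have h2 : heat s κ x ^ (2 - p) * heat s (pd j φ) x ^ 2 ≤
        ∑ l, heat s κ x ^ (2 - p) * heat s (pd l φ) x ^ 2 :=
      Finset.single_le_sum (f := fun l => heat s κ x ^ (2 - p) * heat s (pd l φ) x ^ 2)
        (fun l _ => by positivity) (Finset.mem_univ j)
    have h3 := Finset.sum_le_sum fun l (_ : l ∈ Finset.univ) => hQ l s x
    rw [Finset.sum_add_distrib] at h3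
    refine le_trans ?_ ((add_le_add h1 h2).trans h3)
    generalize heat s κ x ^ (p - 2) = m at hm hmm
    generalize heat s κ x ^ (2 - p) = m' at hm' hmm
    generalize heat s (pd i f) x = u
    generalize heat s (pd j φ) x = v
    rw [abs_le]
    have e : m' = m⁻¹ := by field_simp; linarith
    subst e
    have r1 : m * u ^ 2 + m⁻¹ * v ^ 2 - 2 * (u * v) = m⁻¹ * (m * u - v) ^ 2 := by field_simp; ring
    have r2 : m * u ^ 2 + m⁻¹ * v ^ 2 + 2 * (u * v) = m⁻¹ * (m * u + v) ^ 2 := by field_simp; ring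
    have r3 : 0 ≤ m⁻¹ * (m * u - v) ^ 2 := by positivity
    have r4 : 0 ≤ m⁻¹ * (m * u + v) ^ 2 := by positivity
    constructor <;> linarith
  have hder : ∀ s, 0 ≤ s → |-2 * s * ∫ x, heat s (pd i f) x * heat s (pd j φ) x| ≤
      s * ∫ x, ∑ l, Q l s x := by
    intro s hs
    have h := norm_integral_le_of_norm_le
      (f := fun x => 2 * (heat s (pd i f) x * heat s (pd j φ) x))
        (integrable_finsetSum _ fun l _ => hQi l s)
      (Eventually.of_forall fun x => hpt s x)
    rw [integral_const_mul, norm_eq_abs] at h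
    rw [show -2 * s * (∫ x, heat s (pd i f) x * heat s (pd j φ) x) =
      -(s * (2 * ∫ x, heat s (pd i f) x * heat s (pd j φ) x)) by ring, abs_neg, abs_mul,
      abs_of_nonneg hs]
    exact mul_le_mul_of_nonneg_left h hs
  have hΦ0 : ∀ s, 0 ≤ Φ s := fun s => by
    have : ∀ (w : Eu N → ℝ) (a : ℝ), 0 ≤ ∫ x, heat s κ x ^ a * (heat s w x * heat s w x) :=
      fun w a => integral_nonneg fun x =>
        mul_nonneg (rpow_nonneg (hk s x).le _) (mul_self_nonneg _)
    have h1 := this κ (p - 2)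
    have h2 := this f (p - 2)
    have h3 := this φ (2 - p)
    simp only [hΦ]
    positivity
  have hanti : ∀ ε : ℝ, |ε| = 1 → AntitoneOn (fun s => Φ s + ε * A s) (Set.Ici 0) := by
    intro ε hε
    have hd : ∀ s, HasDerivAt (fun s => Φ s + ε * A s) (-s * (∫ x, ∑ l, Q l s x) +
      ε * (-2 * s * ∫ x, heat s (pd i f) x * heat s (pd j φ) x)) s := fun s =>
      (hΦd s).add ((hA s).const_mul ε)
    refine antitoneOn_of_deriv_nonpos (convex_Ici 0)
      (fun s _ => (hd s).continuousAt.continuousWithinAt)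
      (fun s _ => (hd s).differentiableAt.differentiableWithinAt) fun s hs => ?_
    rw [interior_Ici] at hs
    rw [(hd s).deriv]
    have h1 := hder s (le_of_lt hs)
    have h2 := le_abs_self (ε * (-2 * s * ∫ x, heat s (pd i f) x * heat s (pd j φ) x))
    rw [abs_mul, hε, one_mul] at h2
    linarith
  have hfin : ∀ ε : ℝ, |ε| = 1 → -(ε * A 0) ≤ Φ 0 := by
    intro ε hε
    have h1 : ∀ s : ℝ, 0 ≤ s → ε * A s ≤ Φ 0 + ε * A 0 := fun s hs => by
      have := hanti ε hε (Set.mem_Ici.2 le_rfl) (Set.mem_Ici.2 hs) hs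
      simp only at this
      linarith [hΦ0 s]
    have h2 := le_of_tendsto (hlim.const_mul ε) (Filter.eventually_atTop.2 ⟨0, h1⟩)
    linarith
  have hA0 : |A 0| ≤ Φ 0 := by
    rw [abs_le]
    have := hfin 1 (by simp)
    have := hfin (-1) (by simp)
    constructor <;> linarith
  refine hA0.trans ?_
  have hI := hκ.integrable_rpow hp.le
  have hpow : ∀ x, κ x ^ (p - 2) * (κ x * κ x) = κ x ^ p := fun x => by
    rw [← sq, ← rpow_two, ← rpow_add (hκ.pos x)]; congr 1; ring
  have hpow' : ∀ x, κ x ^ (2 - p) * (κ x ^ (p - 1) * κ x ^ (p - 1)) = κ x ^ p := fun x => by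
    rw [← rpow_add (hκ.pos x), ← rpow_add (hκ.pos x)]; congr 1; ring
  have b2 : ∫ x, κ x ^ (p - 2) * (f x * f x) ≤ ∫ x, κ x ^ p := by
    refine integral_mono_of_nonneg (Eventually.of_forall fun x =>
      mul_nonneg (rpow_nonneg (hκ.pos x).le _) (mul_self_nonneg _)) hI
      (Eventually.of_forall fun x => ?_)
    simp only
    rw [← hpow x, ← abs_mul_abs_self (f x)]
    exact mul_le_mul_of_nonneg_left (mul_self_le_mul_self (abs_nonneg _) (hfk x))
      (rpow_nonneg (hκ.pos x).le _)
  have b3 : ∫ x, κ x ^ (2 - p) * (φ x * φ x) ≤ ∫ x, κ x ^ p := by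
    refine integral_mono_of_nonneg (Eventually.of_forall fun x =>
      mul_nonneg (rpow_nonneg (hκ.pos x).le _) (mul_self_nonneg _)) hI
      (Eventually.of_forall fun x => ?_)
    simp only
    rw [← hpow' x, ← abs_mul_abs_self (φ x)]
    exact mul_le_mul_of_nonneg_left (mul_self_le_mul_self (abs_nonneg _) (hφk x))
      (rpow_nonneg (hκ.pos x).le _)
  simp only [hΦ, heat_zero, hpow]
  linarith

/-! ### Construction of weights -/

lemma pd_eq {f : Eu N → ℝ} (hf : Differentiable ℝ f) {j : Fin N} {x : Eu N} {f' : ℝ}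
    (h : HasLineDerivAt ℝ f f' x (ee j)) : pd j f x = f' := by
  rw [← h.lineDeriv, (hf x).lineDeriv_eq_fderiv]; rfl

/-- A positive function which controls its own derivatives. -/
structure SelfCtrl (F : Eu N → ℝ) : Prop where
  pos : ∀ x, 0 < F x
  ctrl : Ctrl 1 F F

namespace SelfCtrl

variable {F G f : Eu N → ℝ}

lemma exists_bound (hF : SelfCtrl F) : ∃ C : ℝ, 0 ≤ C ∧ ∀ x j,
    |pd j F x| ≤ C * F x ∧ |pd j (pd j F) x| ≤ C * F x := by
  obtain ⟨C, hC, h⟩ := hF.ctrl.bound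
  exact ⟨C, hC, fun x j => by simpa only [rpow_one] using (h x).2 j⟩

lemma differentiable (hF : SelfCtrl F) : Differentiable ℝ F :=
  hF.ctrl.contDiff.differentiable two_ne_zero

lemma of_bound (hpos : ∀ x, 0 < F x) (hc : ContDiff ℝ 2 F) {C : ℝ}
    (h1 : ∀ x j, |pd j F x| ≤ C * F x) (h2 : ∀ x j, |pd j (pd j F) x| ≤ C * F x) :
    SelfCtrl F := by
  refine ⟨hpos, hc, max C 1, le_max_of_le_right zero_le_one, fun x => ?_⟩
  simp only [rpow_one]
  have hx := (hpos x).le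
  have h3 : C * F x ≤ max C 1 * F x := mul_le_mul_of_nonneg_right (le_max_left _ _) hx
  refine ⟨?_, fun j => ⟨(h1 x j).trans h3, (h2 x j).trans h3⟩⟩
  rw [abs_of_nonneg hx]
  exact le_mul_of_one_le_left hx (le_max_right _ _)

lemma pd_pd_eq {F' : Eu N → ℝ} {x : Eu N} {j : Fin N} {F'' : ℝ} (hc : ContDiff ℝ 2 F)
    (h1 : ∀ x, HasLineDerivAt ℝ F (F' x) x (ee j))
    (h2 : HasLineDerivAt ℝ F' F'' x (ee j)) : pd j (pd j F) x = F'' := by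
  have : pd j F = F' := by
    ext y; exact pd_eq (hc.differentiable two_ne_zero) (h1 y)
  refine pd_eq ((contDiff_pd hc j).differentiable one_ne_zero) ?_
  rwa [this]

lemma hasLineDerivAt (hc : ContDiff ℝ 2 F) (j : Fin N) (x : Eu N) :
    HasLineDerivAt ℝ F (pd j F x) x (ee j) :=
  pd_hasLineDerivAt (hc.differentiable two_ne_zero) j x

lemma hasLineDerivAt_pd (hc : ContDiff ℝ 2 F) (j : Fin N) (x : Eu N) :
    HasLineDerivAt ℝ (pd j F) (pd j (pd j F) x) x (ee j) :=
  pd_hasLineDerivAt ((contDiff_pd hc j).differentiable one_ne_zero) j x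

lemma add (hF : SelfCtrl F) (hG : SelfCtrl G) : SelfCtrl (fun x => F x + G x) := by
  obtain ⟨C, hC, h⟩ := hF.exists_bound
  obtain ⟨D, hD, h'⟩ := hG.exists_bound
  have cF := hF.ctrl.contDiff
  have cG := hG.ctrl.contDiff
  have d1 : ∀ j x, HasLineDerivAt ℝ (fun x => F x + G x) (pd j F x + pd j G x) x (ee j) :=
    fun j x => HasDerivAt.add (hasLineDerivAt cF j x) (hasLineDerivAt cG j x)
  have d2 : ∀ j x, HasLineDerivAt ℝ (fun x => pd j F x + pd j G x)
      (pd j (pd j F) x + pd j (pd j G) x) x (ee j) :=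
    fun j x => HasDerivAt.add (hasLineDerivAt_pd cF j x) (hasLineDerivAt_pd cG j x)
  have b : ∀ x, C * F x + D * G x ≤ max C D * (F x + G x) := fun x => by
    rw [mul_add]
    exact add_le_add (mul_le_mul_of_nonneg_right (le_max_left _ _) (hF.pos x).le)
      (mul_le_mul_of_nonneg_right (le_max_right _ _) (hG.pos x).le)
  refine of_bound (C := max C D) (fun x => add_pos (hF.pos x) (hG.pos x)) (cF.add cG)
    (fun x j => ?_) (fun x j => ?_)
  · rw [pd_eq ((cF.add cG).differentiable two_ne_zero) (d1 j x)]
    exact ((abs_add_le _ _).trans (add_le_add (h x j).1 (h' x j).1)).trans (b x)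
  · rw [pd_pd_eq (cF.add cG) (d1 j) (d2 j x)]
    exact ((abs_add_le _ _).trans (add_le_add (h x j).2 (h' x j).2)).trans (b x)

lemma rpow (hF : SelfCtrl F) (a : ℝ) : SelfCtrl (fun x => F x ^ a) := by
  obtain ⟨C, hC, h⟩ := hF.exists_bound
  have cF := hF.ctrl.contDiff
  have cFa : ContDiff ℝ 2 (fun x => F x ^ a) := cF.rpow_const_of_ne fun x => (hF.pos x).ne'
  have d1 : ∀ j x, HasLineDerivAt ℝ (fun x => F x ^ a) (a * F x ^ (a - 1) * pd j F x) x (ee j) :=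
    fun j x => hasLineDerivAt_rpow (hasLineDerivAt cF j x) (hF.pos x) a
  have hconst : ∀ (j : Fin N) (x : Eu N), HasLineDerivAt ℝ (fun _ => a) 0 x (ee j) := fun j x =>
    hasDerivAt_const _ _
  have d2 : ∀ j x, HasLineDerivAt ℝ (fun x => a * F x ^ (a - 1) * pd j F x) _ x (ee j) :=
    fun j x => hasLineDerivAt_mul (hasLineDerivAt_mul (hconst j x)
      (hasLineDerivAt_rpow (hasLineDerivAt cF j x) (hF.pos x) (a - 1))) (hasLineDerivAt_pd cF j x)
  have e1 : ∀ x, F x ^ (a - 1) * F x = F x ^ a := fun x => by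
    rw [← rpow_add_one (hF.pos x).ne']; congr 1; ring
  have e2 : ∀ x, F x ^ (a - 1 - 1) * (F x * F x) = F x ^ a := fun x => by
    rw [← mul_assoc, ← rpow_add_one (hF.pos x).ne', ← rpow_add_one (hF.pos x).ne']
    congr 1; ring
  refine of_bound (C := |a| * |a - 1| * (C * C) + |a| * C)
    (fun x => rpow_pos_of_pos (hF.pos x) _) cFa (fun x j => ?_) (fun x j => ?_)
  · rw [pd_eq (cFa.differentiable two_ne_zero) (d1 j x), abs_mul, abs_mul,
      abs_of_pos (rpow_pos_of_pos (hF.pos x) _)]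
    have h1 : 0 ≤ F x ^ (a - 1) := (rpow_pos_of_pos (hF.pos x) _).le
    have h2 : 0 ≤ F x ^ a := (rpow_pos_of_pos (hF.pos x) _).le
    calc |a| * F x ^ (a - 1) * |pd j F x| ≤ |a| * F x ^ (a - 1) * (C * F x) := by
          gcongr; exact (h x j).1
      _ = 0 + |a| * C * F x ^ a := by rw [← e1]; ring
      _ ≤ |a| * |a - 1| * (C * C) * F x ^ a + |a| * C * F x ^ a := by gcongr; positivity
      _ = _ := by ring
  · rw [pd_pd_eq cFa (d1 j) (d2 j x)]
    have h1 : 0 ≤ F x ^ (a - 1) := (rpow_pos_of_pos (hF.pos x) _).le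
    have h1' : 0 ≤ F x ^ (a - 1 - 1) := (rpow_pos_of_pos (hF.pos x) _).le
    have hx := hF.pos x
    calc |(0 * F x ^ (a - 1) + a * ((a - 1) * F x ^ (a - 1 - 1) * pd j F x)) * pd j F x +
          a * F x ^ (a - 1) * pd j (pd j F) x| =
        |a * (a - 1) * F x ^ (a - 1 - 1) * (pd j F x * pd j F x) +
          a * F x ^ (a - 1) * pd j (pd j F) x| := by congr 1; ring
      _ ≤ |a| * |a - 1| * F x ^ (a - 1 - 1) * (|pd j F x| * |pd j F x|) +
          |a| * F x ^ (a - 1) * |pd j (pd j F) x| := by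
        refine (abs_add_le _ _).trans_eq ?_
        simp only [abs_mul, abs_of_nonneg h1, abs_of_nonneg h1']
      _ ≤ |a| * |a - 1| * F x ^ (a - 1 - 1) * ((C * F x) * (C * F x)) +
          |a| * F x ^ (a - 1) * (C * F x) := by
        have b1 := (h x j).1
        have b2 := (h x j).2
        gcongr
      _ = |a| * |a - 1| * (C * C) * (F x ^ (a - 1 - 1) * (F x * F x)) +
          |a| * C * (F x ^ (a - 1) * F x) := by ring
      _ = _ := by rw [e1, e2]; ring

lemma sq_add_sq (hF : SelfCtrl F) (hf : Ctrl 1 F f) {ε : ℝ} (hε : 0 < ε) :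
    SelfCtrl (fun x => f x * f x + ε * (F x * F x)) := by
  obtain ⟨C, hC, h⟩ := hF.exists_bound
  obtain ⟨D, hD, h'⟩ := hf.bound
  simp only [rpow_one] at h'
  have cF := hF.ctrl.contDiff
  have cf := hf.contDiff
  have cG : ContDiff ℝ 2 (fun x => f x * f x + ε * (F x * F x)) :=
    (cf.mul cf).add (contDiff_const.mul (cF.mul cF))
  have d1 : ∀ j x, HasLineDerivAt ℝ (fun x => f x * f x + ε * (F x * F x))
      (2 * (f x * pd j f x) + 2 * ε * (F x * pd j F x)) x (ee j) := fun j x => by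
    have := (HasDerivAt.add (hasLineDerivAt_mul (hasLineDerivAt cf j x) (hasLineDerivAt cf j x))
      (HasDerivAt.const_mul ε
        (hasLineDerivAt_mul (hasLineDerivAt cF j x) (hasLineDerivAt cF j x))))
    exact this.congr_deriv (by ring)
  have d2 : ∀ j x, HasLineDerivAt ℝ (fun x => 2 * (f x * pd j f x) + 2 * ε * (F x * pd j F x))
      (2 * (pd j f x * pd j f x + f x * pd j (pd j f) x) +
        2 * ε * (pd j F x * pd j F x + F x * pd j (pd j F) x)) x (ee j) := fun j x =>
    HasDerivAt.add (HasDerivAt.const_mul 2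
      (hasLineDerivAt_mul (hasLineDerivAt cf j x) (hasLineDerivAt_pd cf j x)))
      (HasDerivAt.const_mul (2 * ε)
        (hasLineDerivAt_mul (hasLineDerivAt cF j x) (hasLineDerivAt_pd cF j x)))
  have key : ∀ x, ∀ K : ℝ, 0 ≤ K → K * (F x * F x) ≤ K / ε * (f x * f x + ε * (F x * F x)) := by
    intro x K hK
    have : K / ε * (f x * f x + ε * (F x * F x)) = K / ε * (f x * f x) + K * (F x * F x) := by
      field_simp
    rw [this]
    have : 0 ≤ K / ε * (f x * f x) := by have := mul_self_nonneg (f x); positivity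
    linarith
  refine of_bound (C := (4 * (D * D) + 2 * ε * (C * C + C)) / ε)
    (fun x => ?_) cG (fun x j => ?_) (fun x j => ?_)
  · have := hF.pos x
    have := mul_self_nonneg (f x)
    positivity
  · rw [pd_eq (cG.differentiable two_ne_zero) (d1 j x)]
    refine le_trans ?_ (key x _ (by positivity))
    have hx := hF.pos x
    refine (abs_add_le _ _).trans ?_
    simp only [abs_mul, abs_two, abs_of_pos hε, abs_of_pos hx]
    calc 2 * (|f x| * |pd j f x|) + 2 * ε * (F x * |pd j F x|) ≤
        2 * ((D * F x) * (D * F x)) + 2 * ε * (F x * (C * F x)) := by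
          have b0 := (h' x).1
          have b1 := ((h' x).2 j).1
          have b2 := (h x j).1
          gcongr
      _ = (2 * (D * D) + 2 * ε * C) * (F x * F x) := by ring
      _ ≤ _ := by
        gcongr
        · norm_num
        · exact le_add_of_nonneg_left (by positivity)
  · rw [pd_pd_eq cG (d1 j) (d2 j x)]
    refine le_trans ?_ (key x _ (by positivity))
    have hx := hF.pos x
    have a1 := abs_add_le (pd j f x * pd j f x) (f x * pd j (pd j f) x)
    have a2 := abs_add_le (pd j F x * pd j F x) (F x * pd j (pd j F) x)
    refine (abs_add_le _ _).trans ?_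
    simp only [abs_mul, abs_two, abs_of_pos hε, abs_of_pos hx] at a1 a2 ⊢
    calc 2 * |pd j f x * pd j f x + f x * pd j (pd j f) x| +
          2 * ε * |pd j F x * pd j F x + F x * pd j (pd j F) x| ≤
        2 * ((D * F x) * (D * F x) + (D * F x) * (D * F x)) +
          2 * ε * ((C * F x) * (C * F x) + F x * (C * F x)) := by
          have b0 := (h' x).1
          have b1 := ((h' x).2 j).1
          have b1' := ((h' x).2 j).2
          have b2 := (h x j).1
          have b2' := (h x j).2
          gcongr
          · exact a1.trans (by gcongr)
          · exact a2.trans (by gcongr)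
      _ = _ := by ring

lemma wt : SelfCtrl (wt N) := by
  have hc : ContDiff ℝ 2 (fun x : Eu N => 1 + ‖x‖ ^ 2) :=
    contDiff_const.add (contDiff_norm_sq ℝ)
  have d1 : ∀ j (x : Eu N), HasLineDerivAt ℝ (fun x : Eu N => 1 + ‖x‖ ^ 2) (2 * x j) x (ee j) := by
    intro j x
    have h : HasFDerivAt (fun x : Eu N => 1 + ‖x‖ ^ 2) (2 • innerSL ℝ x) x :=
      (hasStrictFDerivAt_norm_sq x).hasFDerivAt.const_add 1
    have := h.hasLineDerivAt (ee j)
    simpa [EuclideanSpace.inner_single_right] using this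
  have d2 : ∀ j (x : Eu N), HasLineDerivAt ℝ (fun x : Eu N => 2 * x j) 2 x (ee j) := by
    intro j x
    have h : HasFDerivAt (fun x : Eu N => 2 * x j) ((2 : ℝ) • EuclideanSpace.proj j) x :=
      (EuclideanSpace.proj (𝕜 := ℝ) j).hasFDerivAt.const_mul 2
    have := h.hasLineDerivAt (ee j)
    simpa using this
  have h1 : SelfCtrl (fun x : Eu N => 1 + ‖x‖ ^ 2) := by
    refine of_bound (C := 2) (fun x => by positivity) hc (fun x j => ?_) (fun x j => ?_)
    · rw [pd_eq (hc.differentiable two_ne_zero) (d1 j x), abs_mul, abs_two]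
      nlinarith [abs_coord_le x j, sq_nonneg (‖x‖ - 1)]
    · rw [pd_pd_eq hc (d1 j) (d2 j x), abs_two]
      nlinarith [sq_nonneg ‖x‖]
  convert h1.rpow (-(N + 1 : ℕ)) using 2 with x
  unfold ResolventEstimate.wt
  rw [rpow_neg (by positivity), rpow_natCast]

end SelfCtrl

lemma weight_wt : Weight (wt N) :=
  ⟨wt_pos, ⟨1, zero_le_one, fun x => by rw [one_mul]⟩, SelfCtrl.wt.ctrl⟩

/-! ### Schwartz functions -/

lemma pd_coe (j : Fin N) (h : 𝓢(Eu N, ℝ)) : pd j (h : Eu N → ℝ) = (∂_{ee j} h : 𝓢(Eu N, ℝ)) := by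
  ext x; rw [SchwartzMap.lineDerivOp_apply_eq_fderiv]; rfl

lemma lineDeriv_comm {F : Type*} [NormedAddCommGroup F] [NormedSpace ℝ F] (h : 𝓢(Eu N, F))
    (v w : Eu N) : (∂_{v} (∂_{w} h) : 𝓢(Eu N, F)) = ∂_{w} (∂_{v} h) := by
  have hd : Differentiable ℝ (fderiv ℝ h) :=
    ((h.smooth 2).fderiv_right (m := 1) (by norm_num)).differentiable one_ne_zero
  have key : ∀ v w x, (∂_{v} (∂_{w} h) : 𝓢(Eu N, F)) x = fderiv ℝ (fderiv ℝ h) x v w := by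
    intro v w x
    rw [SchwartzMap.lineDerivOp_apply_eq_fderiv]
    have : ((∂_{w} h : 𝓢(Eu N, F)) : Eu N → F) = fun y => fderiv ℝ h y w := by
      ext y; rw [SchwartzMap.lineDerivOp_apply_eq_fderiv]
    rw [this,
      fderiv_clm_apply (hd x) (differentiableAt_const _)]
    simp
  ext x
  rw [key, key]
  exact ((h.smooth 2).contDiffAt.isSymmSndFDerivAt (by simp)) v w

lemma exists_le_wt {F : Type*} [NormedAddCommGroup F] [NormedSpace ℝ F] (h : 𝓢(Eu N, F)) :
    ∃ C : ℝ, 0 ≤ C ∧ ∀ x, ‖h x‖ ≤ C * wt N x := by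
  obtain ⟨C, hC⟩ : ∃ C : ℝ, ∀ x, (1 + ‖x‖) ^ (2 * (N + 1)) * ‖h x‖ ≤ C :=
    ⟨_, fun x => by
      simpa using SchwartzMap.one_add_le_sup_seminorm_apply (𝕜 := ℝ) (m := (2 * (N + 1), 0))
        le_rfl le_rfl h x⟩
  have hC0 : 0 ≤ C := le_trans (by positivity) (hC 0)
  refine ⟨C, hC0, fun x => ?_⟩
  unfold wt
  rw [← div_eq_mul_inv, le_div_iff₀ (by positivity), mul_comm]
  refine le_trans (mul_le_mul_of_nonneg_right ?_ (norm_nonneg _)) (hC x)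
  rw [pow_mul]
  exact pow_le_pow_left₀ (by positivity) (by nlinarith [norm_nonneg x]) _

lemma ctrl_schwartz (h : 𝓢(Eu N, ℝ)) : Ctrl 1 (wt N) h := by
  obtain ⟨C, hC, hb⟩ := exists_le_wt h
  choose D hD hb1 using fun j : Fin N => exists_le_wt (∂_{ee j} h)
  choose E hE hb2 using fun j : Fin N => exists_le_wt (∂_{ee j} (∂_{ee j} h))
  refine ⟨h.smooth 2, C + ∑ j, D j + ∑ j, E j,
    add_nonneg (add_nonneg hC (Finset.sum_nonneg fun j _ => hD j))
      (Finset.sum_nonneg fun j _ => hE j), fun x => ?_⟩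
  have hw := (wt_pos x).le
  have sD : 0 ≤ ∑ j, D j := Finset.sum_nonneg fun j _ => hD j
  have sE : 0 ≤ ∑ j, E j := Finset.sum_nonneg fun j _ => hE j
  simp only [rpow_one, pd_coe]
  refine ⟨(hb x).trans (mul_le_mul_of_nonneg_right (by linarith) hw), fun j => ⟨?_, ?_⟩⟩
  · have : D j ≤ ∑ j, D j := Finset.single_le_sum (fun j _ => hD j) (Finset.mem_univ j)
    exact (hb1 j x).trans (mul_le_mul_of_nonneg_right (by linarith) hw)
  · have : E j ≤ ∑ j, E j := Finset.single_le_sum (fun j _ => hE j) (Finset.mem_univ j)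
    exact (hb2 j x).trans (mul_le_mul_of_nonneg_right (by linarith) hw)

/-! ### A convolution inequality -/

/-- Averages of translates are bounded on `L^q`, in integral form. -/
lemma integral_rpow_le_of_le_integral_translate {Z : Type*} [MeasurableSpace Z] {ν : Measure Z}
    [IsFiniteMeasure ν] {T : Z → Eu N} (hT : Measurable T) {G w : Eu N → ℝ} (hG : Continuous G)
    (hG0 : ∀ x, 0 ≤ G x) {C : ℝ} (hC : ∀ x, G x ≤ C) {q : ℝ} (hq : 1 ≤ q)
    (hi : Integrable (fun x => G x ^ q)) (hw0 : ∀ x, 0 ≤ w x)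
    (hw : ∀ x, w x ≤ ∫ z, G (x + T z) ∂ν) :
    ∫ x, w x ^ q ≤ ν.real Set.univ ^ q * ∫ x, G x ^ q := by
  have hq0 : 0 < q := by linarith
  rcases eq_or_ne ν 0 with rfl | hν
  · have : ∀ x, w x = 0 := fun x => le_antisymm (by simpa using hw x) (hw0 x)
    simp [this, zero_rpow hq0.ne']
  have hm : 0 < ν.real Set.univ := by
    rw [measureReal_def]
    exact ENNReal.toReal_pos (by simpa using hν) (measure_ne_top _ _)
  have : NeZero ν := ⟨hν⟩
  set m := ν.real Set.univ with hmdef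
  have hGq : Continuous fun x => G x ^ q := hG.rpow_const fun _ => Or.inr hq0.le
  have hGqC : ∀ x, ‖G x ^ q‖ ≤ C ^ q := fun x => by
    rw [norm_of_nonneg (rpow_nonneg (hG0 x) _)]
    exact rpow_le_rpow (hG0 x) (hC x) hq0.le
  have i1 : ∀ x, Integrable (fun z => G (x + T z)) ν := fun x =>
    Integrable.of_bound (hG.measurable.comp (measurable_const.add hT)).aestronglyMeasurable C
      (Eventually.of_forall fun z => by rw [norm_of_nonneg (hG0 _)]; exact hC _)
  have i2 : ∀ x, Integrable (fun z => G (x + T z) ^ q) ν := fun x =>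
    Integrable.of_bound (hGq.measurable.comp (measurable_const.add hT)).aestronglyMeasurable
      (C ^ q) (Eventually.of_forall fun z => hGqC _)
  have jensen : ∀ x, w x ^ q ≤ m ^ (q - 1) * ∫ z, G (x + T z) ^ q ∂ν := by
    intro x
    have h := (convexOn_rpow hq).map_average_le (μ := ν) (f := fun z => G (x + T z))
      (Real.continuous_rpow_const hq0.le).continuousOn isClosed_Ici
      (Eventually.of_forall fun z => hG0 _) (i1 x) (i2 x)
    rw [average_eq, average_eq, smul_eq_mul, smul_eq_mul, ← hmdef,
      mul_rpow (by positivity) (integral_nonneg fun z => hG0 _), inv_rpow hm.le] at h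
    have h1 : (∫ z, G (x + T z) ∂ν) ^ q ≤ m ^ q * (m⁻¹ * ∫ z, G (x + T z) ^ q ∂ν) := by
      rwa [inv_mul_le_iff₀ (by positivity)] at h
    refine (rpow_le_rpow (hw0 x) (hw x) hq0.le).trans (h1.trans_eq ?_)
    rw [rpow_sub_one hm.ne']
    ring
  have hinteg : Integrable (Function.uncurry fun x z => G (x + T z) ^ q) (volume.prod ν) := by
    rw [integrable_prod_iff']
    · refine ⟨Eventually.of_forall fun z => hi.comp_add_right (T z), ?_⟩
      have : ∀ z, ∫ x, ‖Function.uncurry (fun x z => G (x + T z) ^ q) (x, z)‖ =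
          ∫ x, ‖G x ^ q‖ := fun z =>
        integral_add_right_eq_self (fun x => ‖G x ^ q‖) (T z)
      simp only [this]
      exact integrable_const _
    · exact (hGq.measurable.comp
        (measurable_fst.add (hT.comp measurable_snd))).aestronglyMeasurable
  calc ∫ x, w x ^ q ≤ ∫ x, m ^ (q - 1) * ∫ z, G (x + T z) ^ q ∂ν :=
        integral_mono_of_nonneg (Eventually.of_forall fun x => rpow_nonneg (hw0 x) _)
          (hinteg.integral_prod_left.const_mul _) (Eventually.of_forall jensen)
    _ = m ^ (q - 1) * ∫ z, (∫ x, G (x + T z) ^ q) ∂ν := by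
        rw [integral_const_mul, integral_integral_swap hinteg]
    _ = m ^ (q - 1) * (m * ∫ x, G x ^ q) := by
        simp only [integral_add_right_eq_self (fun x => G x ^ q), integral_const, smul_eq_mul]
        rw [← hmdef]
    _ = m ^ q * ∫ x, G x ^ q := by rw [rpow_sub_one hm.ne']; field_simp

/-! ### Heat extensions of Schwartz functions -/

/-- The Laplacian as a sum of iterated directional derivatives. -/
noncomputable def lapS {F : Type*} [NormedAddCommGroup F] [NormedSpace ℝ F] (W : 𝓢(Eu N, F)) :
    𝓢(Eu N, F) := ∑ l : Fin N, ∂_{ee l} (∂_{ee l} W)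

lemma bdd_schwartz {F : Type*} [NormedAddCommGroup F] [NormedSpace ℝ F] (u : 𝓢(Eu N, F)) :
    ∃ C : ℝ, 0 ≤ C ∧ ∀ x, ‖u x‖ ≤ C := by
  obtain ⟨C, hC, h⟩ := exists_le_wt u
  exact ⟨C, hC, fun x => (h x).trans (mul_le_of_le_one_right hC (wt_le_one x))⟩

lemma heat_sum_schwartz {ι : Type*} (t : Finset ι) (u : ι → 𝓢(Eu N, ℝ)) (s : ℝ) (x : Eu N) :
    heat s (∑ l ∈ t, u l : 𝓢(Eu N, ℝ)) x = ∑ l ∈ t, heat s (u l) x := by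
  unfold heat
  simp only [sum_apply]
  refine integral_finsetSum _ fun l _ => ?_
  obtain ⟨C, -, h⟩ := bdd_schwartz (u l)
  exact integrable_heat (u l).continuous h s x

lemma ob_schwartz_mul (u v : 𝓢(Eu N, ℝ)) :
    OB (fun _ x => wt N x) 1 (fun s x => heat s u x * heat s v x) :=
  OB.wt_bound weight_wt.heat_pos weight_wt.heat_wt (by norm_num)
    (((ctrl_schwartz u).ob weight_wt one_pos le_rfl).mul weight_wt.heat_pos
      ((ctrl_schwartz v).ob weight_wt one_pos le_rfl))

lemma continuous_heat_schwartz (u : 𝓢(Eu N, ℝ)) (s : ℝ) : Continuous (heat s u) :=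
  (ctrl_schwartz u).continuous_heat weight_wt one_pos s

lemma integrable_schwartz_mul (u v : 𝓢(Eu N, ℝ)) (s : ℝ) :
    Integrable (fun x => heat s u x * heat s v x) :=
  (ob_schwartz_mul u v).integrable
    ((continuous_heat_schwartz u s).mul (continuous_heat_schwartz v s))

lemma heat_ibp (u v : 𝓢(Eu N, ℝ)) (j : Fin N) (s : ℝ) :
    ∫ x, heat s u x * heat s (∂_{ee j} v : 𝓢(Eu N, ℝ)) x =
      - ∫ x, heat s (∂_{ee j} u : 𝓢(Eu N, ℝ)) x * heat s v x := by
  refine integral_ibp (j := j) (integrable_schwartz_mul _ _ s) (integrable_schwartz_mul _ _ s)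
    (integrable_schwartz_mul _ _ s) (fun x => ?_) (fun x => ?_)
  · have := (ctrl_schwartz u).lineDeriv_heat weight_wt one_pos j s x
    rwa [pd_coe] at this
  · have := (ctrl_schwartz v).lineDeriv_heat weight_wt one_pos j s x
    rwa [pd_coe] at this

lemma lapS_lineDeriv {F : Type*} [NormedAddCommGroup F] [NormedSpace ℝ F] (W : 𝓢(Eu N, F))
    (v : Eu N) : lapS (∂_{v} W : 𝓢(Eu N, F)) = ∂_{v} (lapS W) := by
  unfold lapS
  rw [LineDeriv.lineDerivOp_sum]
  refine Finset.sum_congr rfl fun l _ => ?_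
  rw [lineDeriv_comm W, lineDeriv_comm _ (ee l) v]

lemma hasDerivAt_heat_form (W φ : 𝓢(Eu N, ℝ)) (i j : Fin N) (s : ℝ) :
    HasDerivAt (fun s => ∫ x, heat s (∂_{ee i} (∂_{ee j} W) : 𝓢(Eu N, ℝ)) x * heat s φ x)
      (-2 * s * ∫ x, heat s (pd i (lapS W)) x * heat s (pd j φ) x) s := by
  set h : 𝓢(Eu N, ℝ) := ∂_{ee i} (∂_{ee j} W) with hh
  have d : ∀ (u : 𝓢(Eu N, ℝ)) (s : ℝ) (x : Eu N), HasDerivAt (fun s => heat s u x)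
      (s * heat s (lapS u) x) s := fun u s x => by
    have := (ctrl_schwartz u).deriv_heat weight_wt one_pos s x
    simp only [pd_coe] at this
    rwa [← heat_sum_schwartz] at this
  have key := hasDerivAt_integral_of_OB (F := fun s x => heat s h x * heat s φ x)
    (F' := fun s x => s * (heat s (lapS h) x * heat s φ x + heat s h x * heat s (lapS φ) x))
    (ob_schwartz_mul _ _) (OB.id_mul ((ob_schwartz_mul _ _).add (ob_schwartz_mul _ _)))
    (fun s => (continuous_heat_schwartz h s).mul (continuous_heat_schwartz φ s))
    (fun s => continuous_const.mul (((continuous_heat_schwartz _ s).mul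
      (continuous_heat_schwartz φ s)).add
        ((continuous_heat_schwartz h s).mul (continuous_heat_schwartz _ s))))
    (fun s x => ((d h s x).mul (d φ s x)).congr_deriv (by ring)) s
  refine key.congr_deriv ?_
  rw [integral_const_mul, integral_add (integrable_schwartz_mul _ _ s)
    (integrable_schwartz_mul _ _ s)]
  have e1 : ∫ x, heat s h x * heat s (lapS φ) x = ∫ x, heat s (lapS h) x * heat s φ x := by
    unfold lapS
    simp only [heat_sum_schwartz, Finset.mul_sum, Finset.sum_mul]
    rw [integral_finsetSum _ fun l _ => integrable_schwartz_mul _ _ s,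
      integral_finsetSum _ fun l _ => integrable_schwartz_mul _ _ s]
    refine Finset.sum_congr rfl fun l _ => ?_
    rw [heat_ibp, ← neg_eq_iff_eq_neg.2 (heat_ibp (∂_{ee l} h : 𝓢(Eu N, ℝ)) φ l s)]
  have e2 : ∫ x, heat s (lapS h) x * heat s φ x =
      - ∫ x, heat s (pd i (lapS W)) x * heat s (pd j φ) x := by
    rw [hh, lapS_lineDeriv, lapS_lineDeriv, lineDeriv_comm, pd_coe, pd_coe, heat_ibp, neg_neg]
  rw [e1, e2]
  ring

lemma abs_heat_lineDeriv_le (u : 𝓢(Eu N, ℝ)) (i : Fin N) :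
    ∃ C : ℝ, ∀ s : ℝ, 0 < s → ∀ x, |heat s (∂_{ee i} u : 𝓢(Eu N, ℝ)) x| ≤ C / s := by
  obtain ⟨C, hC, h⟩ := bdd_schwartz u
  obtain ⟨D, hD, h'⟩ := bdd_schwartz (∂_{ee i} u : 𝓢(Eu N, ℝ))
  have iy : Integrable (fun y : Eu N => |y i| * C) (gm N) := by
    refine integrable_gm_of_bound (by fun_prop) 1 C fun y => ?_
    rw [abs_mul, abs_abs, abs_of_nonneg hC, pow_one, mul_comm]
    exact mul_le_mul_of_nonneg_left ((abs_coord_le y i).trans (by linarith)) hC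
  refine ⟨∫ y : Eu N, |y i| * C ∂(gm N), fun s hs x => ?_⟩
  have hd : ∀ y, HasLineDerivAt ℝ (fun y => u (x + s • y))
      (s * (∂_{ee i} u : 𝓢(Eu N, ℝ)) (x + s • y)) y (ee i) := fun y => by
    have h1 := pd_hasDerivAt (f := u) (u.smooth 1 |>.differentiable one_ne_zero) i (x + s • y) 0
    rw [zero_smul, add_zero, pd_coe] at h1
    have h2 : HasDerivAt (fun t : ℝ => s * t) s 0 := by
      simpa using (hasDerivAt_id (0 : ℝ)).const_mul s
    have h3 := HasDerivAt.comp (0 : ℝ) (h₂ := fun t : ℝ => u (x + s • y + t • ee i))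
      (h := fun t : ℝ => s * t) (by simpa only [mul_zero] using h1) h2
    refine (h3.congr_deriv (mul_comm _ _)).congr_of_eventuallyEq (Eventually.of_forall fun t => ?_)
    simp only [Function.comp_apply]
    congr 1
    rw [smul_add, smul_smul, add_assoc]
  have hI := integral_coord_mul_gm i (F := fun y => u (x + s • y))
    (F' := fun y => s * (∂_{ee i} u : 𝓢(Eu N, ℝ)) (x + s • y))
    (u.continuous.comp (by fun_prop))
    (continuous_const.mul ((∂_{ee i} u : 𝓢(Eu N, ℝ)).continuous.comp (by fun_prop)))
    (C := max C (s * D)) (fun y => (h _).trans (le_max_left _ _))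
    (fun y => by
      rw [abs_mul, abs_of_pos hs]
      exact (mul_le_mul_of_nonneg_left (h' _) hs.le).trans (le_max_right _ _)) hd
  rw [integral_const_mul] at hI
  have e : heat s (∂_{ee i} u : 𝓢(Eu N, ℝ)) x = (∫ y, y i * u (x + s • y) ∂(gm N)) / s := by
    rw [hI, mul_div_cancel_left₀ _ hs.ne']; rfl
  rw [e, abs_div, abs_of_pos hs]
  refine div_le_div_of_nonneg_right ?_ hs.le
  refine norm_integral_le_of_norm_le (f := fun y => y i * u (x + s • y)) iy
    (Eventually.of_forall fun y => ?_)
  rw [norm_mul]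
  exact mul_le_mul_of_nonneg_left (h _) (abs_nonneg _)

lemma integral_abs_heat_le (φ : 𝓢(Eu N, ℝ)) (s : ℝ) :
    ∫ x, |heat s φ x| ≤ ∫ x, |φ x| := by
  obtain ⟨C, -, h⟩ := bdd_schwartz φ
  have := integral_rpow_le_of_le_integral_translate (ν := gm N) (T := fun y => s • y)
    (measurable_const_smul s) (G := fun x => |φ x|) (w := fun x => |heat s φ x|)
    φ.continuous.abs (fun _ => abs_nonneg _) h le_rfl
    (by simpa only [rpow_one] using φ.integrable.abs) (fun _ => abs_nonneg _)
    (fun x => norm_integral_le_integral_norm (fun y => φ (x + s • y)))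
  simpa using this

lemma tendsto_heat_form (W φ : 𝓢(Eu N, ℝ)) (i j : Fin N) :
    Tendsto (fun s => ∫ x, heat s (∂_{ee i} (∂_{ee j} W) : 𝓢(Eu N, ℝ)) x * heat s φ x)
      atTop (𝓝 0) := by
  obtain ⟨C, hC⟩ := abs_heat_lineDeriv_le (∂_{ee j} W) i
  have h0 : Tendsto (fun s : ℝ => C / s * ∫ x, |φ x|) atTop (𝓝 0) := by
    simpa using (tendsto_const_nhds.div_atTop tendsto_id : Tendsto (fun s : ℝ => C / s) atTop
      (𝓝 0)).mul_const (∫ x, |φ x|)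
  refine squeeze_zero_norm' ?_ h0
  filter_upwards [eventually_gt_atTop 0] with s hs
  have hinteg : Integrable (fun x => |heat s φ x|) :=
    ((OB.wt_bound weight_wt.heat_pos weight_wt.heat_wt le_rfl
      ((ctrl_schwartz φ).ob weight_wt one_pos le_rfl)).integrable
        (continuous_heat_schwartz φ s)).abs
  have h1 : ‖∫ x, heat s (∂_{ee i} (∂_{ee j} W) : 𝓢(Eu N, ℝ)) x * heat s φ x‖ ≤
      ∫ x, C / s * |heat s φ x| :=
    norm_integral_le_of_norm_le (hinteg.const_mul _) (Eventually.of_forall fun x => by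
      rw [norm_mul]
      exact mul_le_mul_of_nonneg_right (hC s hs x) (abs_nonneg _))
  rw [integral_const_mul] at h1
  refine h1.trans (mul_le_mul_of_nonneg_left (integral_abs_heat_le φ s) ?_)
  exact (abs_nonneg _).trans (hC s hs 0)

/-! ### The bilinear estimate for second derivatives -/

lemma Ctrl.of_wt_le {κ h : Eu N → ℝ} (hh : Ctrl 1 (wt N) h) {β D : ℝ} (hD : 0 ≤ D)
    (h' : ∀ x, wt N x ≤ D * κ x ^ β) : Ctrl β κ h := by
  obtain ⟨C, hC, hb⟩ := hh.bound
  simp only [rpow_one] at hb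
  have : ∀ x, C * wt N x ≤ C * D * κ x ^ β := fun x => by
    rw [mul_assoc]; exact mul_le_mul_of_nonneg_left (h' x) hC
  exact ⟨hh.contDiff, C * D, by positivity, fun x => ⟨(hb x).1.trans (this x), fun j =>
    ⟨((hb x).2 j).1.trans (this x), ((hb x).2 j).2.trans (this x)⟩⟩⟩

lemma sqrt_pow_le (u w δ r : ℝ) (hw : 0 ≤ w) (hδ : 0 < δ) (hr : 0 < r) :
    (u * u + δ ^ 2 * (w * w)) ^ (r / 2) ≤ 2 ^ r * (|u| ^ r + δ ^ r * w ^ r) := by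
  have h1 : u * u + δ ^ 2 * (w * w) ≤ (|u| + δ * w) ^ 2 := by
    have : 0 ≤ |u| * (δ * w) := by positivity
    nlinarith [abs_mul_abs_self u]
  have h0 : 0 ≤ u * u + δ ^ 2 * (w * w) := add_nonneg (mul_self_nonneg _) (by positivity)
  have hs : 0 ≤ |u| + δ * w := by positivity
  calc (u * u + δ ^ 2 * (w * w)) ^ (r / 2) ≤ ((|u| + δ * w) ^ 2) ^ (r / 2) :=
        rpow_le_rpow h0 h1 (by positivity)
    _ = (|u| + δ * w) ^ r := by
        rw [← rpow_two, ← rpow_mul hs]; congr 1; ring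
    _ ≤ (2 * max |u| (δ * w)) ^ r := by
        refine rpow_le_rpow hs ?_ hr.le
        linarith [le_max_left |u| (δ * w), le_max_right |u| (δ * w)]
    _ = 2 ^ r * max |u| (δ * w) ^ r := mul_rpow (by norm_num) (le_max_of_le_left (abs_nonneg _))
    _ ≤ 2 ^ r * (|u| ^ r + (δ * w) ^ r) := by
        gcongr
        rcases max_choice |u| (δ * w) with h | h <;> rw [h]
        · exact le_add_of_nonneg_right (by positivity)
        · exact le_add_of_nonneg_left (by positivity)
    _ = _ := by rw [mul_rpow hδ.le hw]

lemma add_rpow_le {a b p : ℝ} (ha : 0 ≤ a) (hb : 0 ≤ b) (hp : 0 ≤ p) :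
    (a + b) ^ p ≤ 2 ^ p * (a ^ p + b ^ p) := by
  calc (a + b) ^ p ≤ (2 * max a b) ^ p := by
        refine rpow_le_rpow (by positivity) ?_ hp
        linarith [le_max_left a b, le_max_right a b]
    _ = 2 ^ p * max a b ^ p := mul_rpow (by norm_num) (le_max_of_le_left ha)
    _ ≤ 2 ^ p * (a ^ p + b ^ p) := by
        gcongr
        rcases max_choice a b with h | h <;> rw [h]
        · exact le_add_of_nonneg_right (by positivity)
        · exact le_add_of_nonneg_left (by positivity)

lemma integrable_abs_rpow_schwartz {F : Type*} [NormedAddCommGroup F] [NormedSpace ℝ F]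
    (f : 𝓢(Eu N, F)) {r : ℝ} (hr : 1 ≤ r) : Integrable (fun x => ‖f x‖ ^ r) := by
  obtain ⟨C, hC, h⟩ := exists_le_wt f
  have hc : Continuous fun x => ‖f x‖ ^ r :=
    f.continuous.norm.rpow_const fun _ => Or.inr (by linarith)
  refine (integrable_wt.const_mul (C ^ r)).mono' hc.aestronglyMeasurable
    (Eventually.of_forall fun x => ?_)
  rw [norm_of_nonneg (by positivity)]
  calc ‖f x‖ ^ r ≤ (C * wt N x) ^ r := rpow_le_rpow (norm_nonneg _) (h x) (by linarith)
    _ = C ^ r * wt N x ^ r := mul_rpow hC (wt_pos x).le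
    _ ≤ C ^ r * wt N x ^ (1 : ℝ) := by
        exact mul_le_mul_of_nonneg_left
          (rpow_le_rpow_of_exponent_ge (wt_pos x) (wt_le_one x) hr) (by positivity)
    _ = _ := by rw [rpow_one]

lemma exists_weight {p δ : ℝ} (hp : 1 < p) (hp2 : p ≤ 2) (hδ : 0 < δ) (f φ : 𝓢(Eu N, ℝ)) :
    ∃ κ : Eu N → ℝ, Weight κ ∧ Ctrl 1 κ f ∧ Ctrl (p - 1) κ φ ∧ (∀ x, |f x| ≤ κ x) ∧
      (∀ x, |φ x| ≤ κ x ^ (p - 1)) ∧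
      ∀ x, κ x ^ p ≤ 2 ^ p * (2 ^ p * (|f x| ^ p + δ ^ p * wt N x) +
        2 ^ (p / (p - 1)) * (|φ x| ^ (p / (p - 1)) + δ ^ (p / (p - 1)) * wt N x)) := by
  have hp1 : 0 < p - 1 := by linarith
  have hp' : 1 ≤ p / (p - 1) := by rw [one_le_div hp1]; linarith
  set r := p / (p - 1) with hr
  have g1 := SelfCtrl.wt.sq_add_sq (ctrl_schwartz f) (pow_pos hδ 2)
  have g2 := SelfCtrl.wt.sq_add_sq (ctrl_schwartz φ) (pow_pos hδ 2)
  set G1 : Eu N → ℝ := fun x => f x * f x + δ ^ 2 * (wt N x * wt N x) with hG1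
  set G2 : Eu N → ℝ := fun x => φ x * φ x + δ ^ 2 * (wt N x * wt N x) with hG2
  set b : ℝ := 1 / (2 * (p - 1)) with hb
  have hbpos : 0 < b := by positivity
  have hκ := (g1.rpow (1 / 2)).add (g2.rpow b)
  have p1 : ∀ x, 0 < G1 x ^ (1 / 2 : ℝ) := fun x => rpow_pos_of_pos (g1.pos x) _
  have p2 : ∀ x, 0 < G2 x ^ b := fun x => rpow_pos_of_pos (g2.pos x) _
  have le1 : ∀ x, G1 x ^ (1 / 2 : ℝ) ≤ G1 x ^ (1 / 2 : ℝ) + G2 x ^ b := fun x => by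
    linarith [p2 x]
  have le2 : ∀ x, G2 x ^ (1 / 2 : ℝ) ≤ (G1 x ^ (1 / 2 : ℝ) + G2 x ^ b) ^ (p - 1) := fun x => by
    have : G2 x ^ (1 / 2 : ℝ) = (G2 x ^ b) ^ (p - 1) := by
      rw [← rpow_mul (g2.pos x).le]; congr 1; rw [hb]; field_simp
    rw [this]
    exact rpow_le_rpow (p2 x).le (by linarith [p1 x]) hp1.le
  have sq_le : ∀ (u : 𝓢(Eu N, ℝ)) x,
      |u x| ≤ (u x * u x + δ ^ 2 * (wt N x * wt N x)) ^ (1 / 2 : ℝ) ∧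
      δ * wt N x ≤ (u x * u x + δ ^ 2 * (wt N x * wt N x)) ^ (1 / 2 : ℝ) := fun u x => by
    have hw := wt_pos x
    rw [← sqrt_eq_rpow]
    constructor
    · refine abs_le_sqrt ?_
      nlinarith [mul_pos (pow_pos hδ 2) (mul_pos hw hw)]
    · refine le_sqrt_of_sq_le ?_
      nlinarith [mul_self_nonneg (u x)]
  refine ⟨fun x => G1 x ^ (1 / 2 : ℝ) + G2 x ^ b, ⟨hκ.pos, ?_, hκ.ctrl⟩,
    (ctrl_schwartz f).of_wt_le (inv_pos.2 hδ).le (fun x => ?_),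
    (ctrl_schwartz φ).of_wt_le (inv_pos.2 hδ).le (fun x => ?_),
    fun x => (sq_le f x).1.trans (le1 x), fun x => (sq_le φ x).1.trans (le2 x), fun x => ?_⟩
  · obtain ⟨C, hC, h1⟩ := exists_le_wt f
    obtain ⟨D, hD, h2⟩ := exists_le_wt φ
    have up : ∀ (u : ℝ) (C : ℝ) (x : Eu N) (c : ℝ), 0 ≤ C → 1 / 2 ≤ c → ‖u‖ ≤ C * wt N x →
        (u * u + δ ^ 2 * (wt N x * wt N x)) ^ c ≤ (C * C + δ ^ 2) ^ c * wt N x := by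
      intro u C x c hC hc hu
      have hw := wt_pos x
      have hu' : u * u ≤ (C * wt N x) * (C * wt N x) := by
        rw [← abs_mul_abs_self u]
        exact mul_self_le_mul_self (abs_nonneg _) hu
      calc (u * u + δ ^ 2 * (wt N x * wt N x)) ^ c ≤ ((C * C + δ ^ 2) * wt N x ^ (2 : ℝ)) ^ c := by
            refine rpow_le_rpow (add_nonneg (mul_self_nonneg _) (by positivity)) ?_ (by linarith)
            rw [rpow_two]
            nlinarith
        _ = (C * C + δ ^ 2) ^ c * wt N x ^ (2 * c) := by
            rw [mul_rpow (by positivity) (by positivity), ← rpow_mul hw.le]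
        _ ≤ (C * C + δ ^ 2) ^ c * wt N x ^ (1 : ℝ) := by
            exact mul_le_mul_of_nonneg_left
              (rpow_le_rpow_of_exponent_ge hw (wt_le_one x) (by linarith)) (by positivity)
        _ = _ := by rw [rpow_one]
    refine ⟨(C * C + δ ^ 2) ^ (1 / 2 : ℝ) + (D * D + δ ^ 2) ^ b, by positivity, fun x => ?_⟩
    rw [add_mul]
    refine add_le_add (up _ C x _ hC le_rfl (h1 x)) (up _ D x _ hD ?_ (h2 x))
    rw [hb]
    exact one_div_le_one_div_of_le (by linarith) (by linarith)
  · rw [rpow_one, inv_mul_eq_div, le_div_iff₀ hδ, mul_comm]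
    exact (sq_le f x).2.trans (le1 x)
  · rw [inv_mul_eq_div, le_div_iff₀ hδ, mul_comm]
    exact (sq_le φ x).2.trans (le2 x)
  · have hw := wt_pos x
    have e1 : (G1 x ^ (1 / 2 : ℝ)) ^ p = G1 x ^ (p / 2) := by
      rw [← rpow_mul (g1.pos x).le]; congr 1; ring
    have e2 : (G2 x ^ b) ^ p = G2 x ^ (r / 2) := by
      rw [← rpow_mul (g2.pos x).le]; congr 1; rw [hb, hr]; field_simp
    have hwp : ∀ c : ℝ, 1 ≤ c → wt N x ^ c ≤ wt N x := fun c hc =>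
      (rpow_le_rpow_of_exponent_ge hw (wt_le_one x) hc).trans_eq (rpow_one _)
    refine (add_rpow_le (p1 x).le (p2 x).le (by linarith)).trans ?_
    rw [e1, e2]
    have b1 := sqrt_pow_le (f x) (wt N x) δ p hw.le hδ (by linarith)
    have b2 := sqrt_pow_le (φ x) (wt N x) δ r hw.le hδ (by linarith)
    have w1 := hwp p hp.le
    have w2 := hwp r hp'
    gcongr
    · exact b1.trans (by gcongr)
    · exact b2.trans (by gcongr)

/-- The constant in the bilinear estimate for exponents `p ∈ (1, 2]`. -/
noncomputable def bellmanConst (p : ℝ) : ℝ :=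
  (9 / (p * (p - 1)) + 2) * (2 ^ p * (2 ^ p + 2 ^ (p / (p - 1))))

lemma bellmanConst_pos {p : ℝ} (hp : 1 < p) : 0 < bellmanConst p := by
  have : 0 < p - 1 := by linarith
  unfold bellmanConst
  positivity

lemma bellman_schwartz {p : ℝ} (hp : 1 < p) (hp2 : p ≤ 2) (f φ : 𝓢(Eu N, ℝ)) {i j : Fin N}
    {A : ℝ → ℝ}
    (hA : ∀ s, HasDerivAt A (-2 * s * ∫ x, heat s (pd i f) x * heat s (pd j φ) x) s)
    (hlim : Tendsto A atTop (𝓝 0)) :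
    |A 0| ≤ bellmanConst p * ((∫ x, |f x| ^ p) + ∫ x, |φ x| ^ (p / (p - 1))) := by
  have hp1 : 0 < p - 1 := by linarith
  have hp' : 1 ≤ p / (p - 1) := by rw [one_le_div hp1]; linarith
  set r := p / (p - 1) with hr
  have hfi := integrable_abs_rpow_schwartz f hp.le
  have hφi := integrable_abs_rpow_schwartz φ hp'
  simp only [norm_eq_abs] at hfi hφi
  set K := 9 / (p * (p - 1)) + 2 with hK
  have hKpos : 0 ≤ K := by positivity
  set a := ∫ x, |f x| ^ p with ha
  set b := ∫ x, |φ x| ^ r with hb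
  set I := ∫ x, wt N x with hI
  have ha0 : 0 ≤ a := integral_nonneg fun x => by positivity
  have hb0 : 0 ≤ b := integral_nonneg fun x => by positivity
  have step : ∀ δ : ℝ, 0 < δ → |A 0| ≤ K * (2 ^ p * (2 ^ p * (a + δ ^ p * I) +
      2 ^ r * (b + δ ^ r * I))) := by
    intro δ hδ
    obtain ⟨κ, hκ, h1, h2, h3, h4, h5⟩ := exists_weight hp hp2 hδ f φ
    refine (bellman_bound hp hp2 hκ h1 h2 h3 h4 hA hlim).trans
      (mul_le_mul_of_nonneg_left ?_ hKpos)
    have i1 := (hfi.add (integrable_wt.const_mul (δ ^ p))).const_mul (2 ^ p)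
    have i2 := (hφi.add (integrable_wt.const_mul (δ ^ r))).const_mul (2 ^ r)
    simp only [Pi.add_apply] at i1 i2
    refine (integral_mono (hκ.integrable_rpow hp.le) ((i1.add i2).const_mul (2 ^ p)) h5).trans_eq ?_
    simp only [Pi.add_apply]
    rw [integral_const_mul, integral_add i1 i2, integral_const_mul, integral_const_mul,
      integral_add hfi (integrable_wt.const_mul _), integral_add hφi (integrable_wt.const_mul _),
      integral_const_mul, integral_const_mul]
  have hcont : ContinuousAt (fun δ : ℝ => K * (2 ^ p * (2 ^ p * (a + δ ^ p * I) +
      2 ^ r * (b + δ ^ r * I)))) 0 := by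
    have c1 : ContinuousAt (fun δ : ℝ => δ ^ p) 0 :=
      (Real.continuous_rpow_const (by linarith)).continuousAt
    have c2 : ContinuousAt (fun δ : ℝ => δ ^ r) 0 :=
      (Real.continuous_rpow_const (by linarith)).continuousAt
    fun_prop
  have hl := ge_of_tendsto (hcont.tendsto.mono_left (nhdsWithin_le_nhds (s := Set.Ioi 0)))
    (Filter.eventually_of_mem self_mem_nhdsWithin step)
  rw [zero_rpow (by linarith), zero_rpow (by linarith), zero_mul, add_zero, add_zero] at hl
  refine hl.trans ?_
  rw [bellmanConst, ← hK, mul_assoc]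
  refine mul_le_mul_of_nonneg_left ?_ hKpos
  rw [mul_assoc, ← hr]
  refine mul_le_mul_of_nonneg_left ?_ (by positivity)
  have : 0 ≤ (2 : ℝ) ^ p * b := by positivity
  have : 0 ≤ (2 : ℝ) ^ r * a := by positivity
  linarith

lemma exists_bilinear_const {q r : ℝ} (hqr : q.HolderConjugate r) :
    ∃ C : ℝ, 0 < C ∧ ∀ (N : ℕ) (W φ : 𝓢(Eu N, ℝ)) (i j : Fin N),
      |∫ x, (∂_{ee i} (∂_{ee j} W) : 𝓢(Eu N, ℝ)) x * φ x| ≤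
        C * ((∫ x, |lapS W x| ^ q) + ∫ x, |φ x| ^ r) := by
  rcases le_total q 2 with hq | hq
  · refine ⟨bellmanConst q, bellmanConst_pos hqr.lt, fun N W φ i j => ?_⟩
    have := bellman_schwartz hqr.lt hq (lapS W) φ (i := i) (j := j)
      (hasDerivAt_heat_form W φ i j) (tendsto_heat_form W φ i j)
    rw [← hqr.conjugate_eq] at this
    simpa only [heat_zero] using this
  · have hr : r ≤ 2 := by
      rw [hqr.conjugate_eq, div_le_iff₀ hqr.sub_one_pos]; linarith
    refine ⟨bellmanConst r, bellmanConst_pos hqr.symm.lt, fun N W φ i j => ?_⟩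
    have := bellman_schwartz hqr.symm.lt hr φ (lapS W) (i := j) (j := i)
      (A := fun s => ∫ x, heat s (∂_{ee i} (∂_{ee j} W) : 𝓢(Eu N, ℝ)) x * heat s φ x)
      (fun s => (hasDerivAt_heat_form W φ i j s).congr_deriv (by simp only [mul_comm]))
      (tendsto_heat_form W φ i j)
    rw [← hqr.symm.conjugate_eq] at this
    simp only [heat_zero] at this
    rwa [add_comm]

/-! ### Boundedness of `Δ W ↦ ∂ᵢ ∂ⱼ W` on `L^q` -/

section LqNorm

variable {α E F : Type*} [MeasurableSpace α] [NormedAddCommGroup E] [NormedAddCommGroup F]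
  {μ : Measure α} {p : ℝ}

lemma LqNorm_nonneg (f : α → E) : 0 ≤ LqNorm μ p f :=
  rpow_nonneg (integral_nonneg fun _ => by positivity) _

lemma LqNorm_eq_lpNorm (hp : 0 < p) {f : α → E} (hf : AEStronglyMeasurable f μ) :
    LqNorm μ p f = lpNorm f (ENNReal.ofReal p) μ := by
  rw [lpNorm_eq_integral_norm_rpow_toReal (by simpa using hp) ENNReal.ofReal_ne_top hf,
    ENNReal.toReal_ofReal hp.le, LqNorm, one_div]

lemma LqNorm_mono (hp : 0 < p) {f : α → E} {g : α → F} (hg : Integrable (fun x => ‖g x‖ ^ p) μ)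
    (h : ∀ x, ‖f x‖ ≤ ‖g x‖) : LqNorm μ p f ≤ LqNorm μ p g := by
  refine rpow_le_rpow (integral_nonneg fun _ => by positivity) ?_ (by positivity)
  exact integral_mono_of_nonneg (Eventually.of_forall fun x => by positivity) hg
    (Eventually.of_forall fun x => rpow_le_rpow (norm_nonneg _) (h x) hp.le)

lemma LqNorm_rpow (hp : 0 < p) (f : α → E) : LqNorm μ p f ^ p = ∫ x, ‖f x‖ ^ p ∂μ := by
  rw [LqNorm, ← rpow_mul (integral_nonneg fun _ => by positivity), one_div_mul_cancel hp.ne',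
    rpow_one]

lemma LqNorm_le_of_integral_le (hp : 0 < p) {f : α → E} {a : ℝ} (ha : 0 ≤ a)
    (h : ∫ x, ‖f x‖ ^ p ∂μ ≤ a ^ p) : LqNorm μ p f ≤ a := by
  rw [← LqNorm_rpow hp] at h
  exact (rpow_le_rpow_iff (LqNorm_nonneg f) ha hp).1 h

end LqNorm

lemma lapS_smul (W : 𝓢(Eu N, ℝ)) (a : ℝ) : lapS (a • W) = a • lapS W := by
  simp only [lapS, LineDeriv.lineDerivOp_smul, Finset.smul_sum]

lemma integral_abs_smul_rpow_le {q a : ℝ} (hq : 0 < q) (ha : 0 < a) (f : 𝓢(Eu N, ℝ))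
    (h : LqNorm volume q f ≤ a) : ∫ x, |(a⁻¹ • f) x| ^ q ≤ 1 := by
  have e : ∀ x, |(a⁻¹ • f) x| ^ q = (a ^ q)⁻¹ * ‖f x‖ ^ q := fun x => by
    rw [smul_apply, smul_eq_mul, abs_mul, abs_of_pos (inv_pos.2 ha),
      mul_rpow (inv_pos.2 ha).le (abs_nonneg _), inv_rpow ha.le, Real.norm_eq_abs]
  simp only [e]
  rw [integral_const_mul, ← LqNorm_rpow hq, inv_mul_le_one₀ (by positivity)]
  exact rpow_le_rpow (LqNorm_nonneg _) h hq.le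

lemma exists_pairing_const {q r : ℝ} (hqr : q.HolderConjugate r) :
    ∃ C : ℝ, 0 < C ∧ ∀ (N : ℕ) (W φ : 𝓢(Eu N, ℝ)) (i j : Fin N),
      |∫ x, (∂_{ee i} (∂_{ee j} W) : 𝓢(Eu N, ℝ)) x * φ x| ≤
        C * LqNorm volume q (lapS W) * LqNorm volume r φ := by
  obtain ⟨C, hC, h⟩ := exists_bilinear_const hqr
  refine ⟨2 * C, by positivity, fun N W φ i j => ?_⟩
  have step : ∀ η : ℝ, 0 < η → |∫ x, (∂_{ee i} (∂_{ee j} W) : 𝓢(Eu N, ℝ)) x * φ x| ≤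
      2 * C * (LqNorm volume q (lapS W) + η) * (LqNorm volume r φ + η) := by
    intro η hη
    set a := LqNorm volume q (lapS W) + η with ha
    set b := LqNorm volume r φ + η with hb
    have ha0 : 0 < a := add_pos_of_nonneg_of_pos (LqNorm_nonneg _) hη
    have hb0 : 0 < b := add_pos_of_nonneg_of_pos (LqNorm_nonneg _) hη
    have h1 := h N (a⁻¹ • W) (b⁻¹ • φ) i j
    have e : ∀ x, (∂_{ee i} (∂_{ee j} (a⁻¹ • W)) : 𝓢(Eu N, ℝ)) x * (b⁻¹ • φ) x =
        a⁻¹ * b⁻¹ * ((∂_{ee i} (∂_{ee j} W) : 𝓢(Eu N, ℝ)) x * φ x) := fun x => by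
      simp only [LineDeriv.lineDerivOp_smul, smul_apply, smul_eq_mul]; ring
    simp only [e] at h1
    rw [integral_const_mul, abs_mul, abs_of_pos (by positivity : 0 < a⁻¹ * b⁻¹), lapS_smul] at h1
    have h2 := integral_abs_smul_rpow_le hqr.pos ha0 (lapS W) (by linarith)
    have h3 := integral_abs_smul_rpow_le hqr.symm.pos hb0 φ (by linarith)
    have h4 := h1.trans (mul_le_mul_of_nonneg_left (add_le_add h2 h3) hC.le)
    rw [← mul_inv, inv_mul_le_iff₀ (by positivity)] at h4
    linarith
  have hcont : ContinuousAt (fun η : ℝ => 2 * C * (LqNorm volume q (lapS W) + η) *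
      (LqNorm volume r φ + η)) 0 := by fun_prop
  have hl := ge_of_tendsto (hcont.tendsto.mono_left (nhdsWithin_le_nhds (s := Set.Ioi 0)))
    (Filter.eventually_of_mem self_mem_nhdsWithin step)
  simpa using hl

lemma LqNorm_le_of_pairing {q r : ℝ} (hqr : q.HolderConjugate r) (h : 𝓢(Eu N, ℝ)) {K : ℝ}
    (hK : ∀ φ : 𝓢(Eu N, ℝ), |∫ x, h x * φ x| ≤ K * LqNorm volume r φ) (hK0 : 0 ≤ K) :
    LqNorm volume q h ≤ K := by
  have hq0 := hqr.pos
  have hr0 := hqr.symm.pos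
  have := hqr.ennrealOfReal
  have f1 : Fact (1 ≤ ENNReal.ofReal q) := ⟨by simpa using hqr.lt.le⟩
  have f2 : Fact (1 ≤ ENNReal.ofReal r) := ⟨by simpa using hqr.symm.lt.le⟩
  set B := (ContinuousLinearMap.mul ℝ ℝ) with hB
  set L : Lp ℝ (ENNReal.ofReal r) (volume : Measure (Eu N)) →L[ℝ] ℝ :=
    B.lpPairing volume (ENNReal.ofReal q) (ENNReal.ofReal r) (h.toLp _ _) with hL
  have hLi : ∀ g, L g = ∫ x, h x * g x := fun g => by
    rw [hL, ContinuousLinearMap.lpPairing_eq_integral]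
    refine integral_congr_ae ?_
    filter_upwards [h.coeFn_toLp (ENNReal.ofReal q) volume] with x hx
    rw [hx]; rfl
  have main : ∀ g, |L g| ≤ K * ‖g‖ := by
    have hd : DenseRange (SchwartzMap.toLpCLM ℝ ℝ (ENNReal.ofReal r) (volume : Measure (Eu N))) :=
      SchwartzMap.denseRange_toLpCLM ENNReal.ofReal_ne_top
    refine fun g => hd.induction_on g (isClosed_le (by fun_prop) (by fun_prop)) fun φ => ?_
    rw [SchwartzMap.toLpCLM_apply, hLi,
      SchwartzMap.norm_toLp' (by simpa using hr0) ENNReal.ofReal_ne_top,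
      ENNReal.toReal_ofReal hr0.le, ← one_div]
    convert hK φ using 2
    refine integral_congr_ae ?_
    filter_upwards [φ.coeFn_toLp (ENNReal.ofReal r) volume] with x hx
    rw [hx]
    rfl
  set φ0 : Eu N → ℝ := fun x => SignType.sign (h x) * |h x| ^ (q - 1) with hφ0
  have hm : AEStronglyMeasurable φ0 volume := by
    have hh : Measurable h := h.continuous.measurable
    refine Measurable.aestronglyMeasurable ?_
    have hs : Measurable fun x => ((SignType.sign (h x) : SignType) : ℝ) := by
      have : (fun x => ((SignType.sign (h x) : SignType) : ℝ)) = fun x =>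
          if 0 < h x then 1 else if h x < 0 then -1 else 0 := by
        ext x
        rcases lt_trichotomy (h x) 0 with hx | hx | hx
        · simp [hx, not_lt.2 hx.le]
        · simp [hx]
        · simp [hx]
      rw [this]
      exact Measurable.ite (measurableSet_lt measurable_const hh) measurable_const
        (Measurable.ite (measurableSet_lt hh measurable_const) measurable_const measurable_const)
    exact hs.mul (hh.abs.pow_const _)
  have hpow : ∀ x, ‖φ0 x‖ ^ r = ‖h x‖ ^ q := fun x => by
    have e : ‖φ0 x‖ = |h x| ^ (q - 1) := by
      rcases eq_or_ne (h x) 0 with hx | hx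
      · simp [hφ0, hx, zero_rpow hqr.sub_one_pos.ne']
      · rw [hφ0]
        simp only [norm_mul, Real.norm_eq_abs]
        rw [abs_of_nonneg (rpow_nonneg (abs_nonneg (h x)) _)]
        rcases lt_or_gt_of_ne hx with hx | hx <;> simp [hx]
    rw [e, ← rpow_mul (abs_nonneg _), hqr.sub_one_mul_conj, Real.norm_eq_abs]
  have hi := integrable_abs_rpow_schwartz h hqr.lt.le
  have hmem : MemLp φ0 (ENNReal.ofReal r) volume := by
    rw [← integrable_norm_rpow_iff hm (by simpa using hr0) ENNReal.ofReal_ne_top,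
      ENNReal.toReal_ofReal hr0.le]
    simpa only [hpow] using hi
  have key := main hmem.toLp
  have e1 : L hmem.toLp = ∫ x, ‖h x‖ ^ q := by
    rw [hLi]
    refine integral_congr_ae ?_
    filter_upwards [hmem.coeFn_toLp] with x hx
    rw [hx, hφ0]
    simp only
    rw [← mul_assoc, mul_comm (h x), sign_mul_self, Real.norm_eq_abs]
    rcases eq_or_ne (h x) 0 with hx | hx
    · simp [hx, zero_rpow hq0.ne']
    · rw [rpow_sub_one (abs_ne_zero.2 hx)]
      field_simp
  have e2 : ‖hmem.toLp‖ = (∫ x, ‖h x‖ ^ q) ^ (1 / r) := by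
    rw [Lp.norm_toLp, hmem.eLpNorm_eq_integral_rpow_norm (by simpa using hr0) ENNReal.ofReal_ne_top,
      ENNReal.toReal_ofReal (by positivity), ENNReal.toReal_ofReal hr0.le, one_div]
    simp only [hpow]
  rw [e1, e2] at key
  have hI : 0 ≤ ∫ x, ‖h x‖ ^ q := integral_nonneg fun _ => by positivity
  rw [abs_of_nonneg hI] at key
  rcases hI.eq_or_lt with h0 | h0
  · rw [LqNorm, ← h0, zero_rpow (by positivity)]; exact hK0
  · rw [LqNorm]
    have e3 : 1 / q = 1 - 1 / r := by
      have := hqr.inv_add_inv_eq_one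
      rw [one_div, one_div]; linarith
    rw [e3, rpow_sub h0, rpow_one, div_le_iff₀ (by positivity)]
    exact key

lemma memLp_schwartz {F : Type*} [NormedAddCommGroup F] [NormedSpace ℝ F] (f : 𝓢(Eu N, F))
    {q : ℝ} : MemLp f (ENNReal.ofReal q) volume :=
  f.memLp _ _

lemma LqNorm_le_sum {α ι E F : Type*} [MeasurableSpace α] [NormedAddCommGroup E]
    [NormedAddCommGroup F] {μ : Measure α} {q : ℝ} (hq : 1 ≤ q) (s : Finset ι) {f : ι → α → F}
    {w : α → E} {c : ι → ℝ} (hc : ∀ i ∈ s, 0 ≤ c i)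
    (hf : ∀ i ∈ s, MemLp (f i) (ENNReal.ofReal q) μ) (h : ∀ x, ‖w x‖ ≤ ∑ i ∈ s, c i * ‖f i x‖) :
    LqNorm μ q w ≤ ∑ i ∈ s, c i * LqNorm μ q (f i) := by
  have hq0 : 0 < q := by linarith
  have hm : ∀ i ∈ s, MemLp (c i • fun x => ‖f i x‖) (ENNReal.ofReal q) μ := fun i hi =>
    (hf i hi).norm.const_smul (c i)
  have hsum := memLp_finsetSum' s hm
  have e : ∀ x, (∑ i ∈ s, c i • fun x => ‖f i x‖) x = ∑ i ∈ s, c i * ‖f i x‖ := fun x => by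
    simp
  have h1 : LqNorm μ q w ≤ LqNorm μ q (∑ i ∈ s, c i • fun x => ‖f i x‖) := by
    refine LqNorm_mono hq0 ?_ fun x => ?_
    · have := (integrable_norm_rpow_iff hsum.1 (by simpa using hq0) ENNReal.ofReal_ne_top).2 hsum
      rwa [ENNReal.toReal_ofReal hq0.le] at this
    · rw [e, Real.norm_eq_abs]
      exact (h x).trans (le_abs_self _)
  refine h1.trans ?_
  rw [LqNorm_eq_lpNorm hq0 hsum.1]
  refine (lpNorm_sum_le hm (by simpa using hq)).trans_eq (Finset.sum_congr rfl fun i hi => ?_)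
  rw [lpNorm_const_smul, lpNorm_norm (hf i hi).1, LqNorm_eq_lpNorm hq0 (hf i hi).1, coe_nnnorm,
    Real.norm_of_nonneg (hc i hi)]

lemma postcomp_lineDeriv {F G : Type*} [NormedAddCommGroup F] [NormedSpace ℝ F]
    [NormedAddCommGroup G] [NormedSpace ℝ G] (L : F →L[ℝ] G) (W : 𝓢(Eu N, F)) (v : Eu N) :
    (∂_{v} (W.postcompCLM L) : 𝓢(Eu N, G)) = (∂_{v} W : 𝓢(Eu N, F)).postcompCLM L := by
  ext x
  rw [SchwartzMap.postcompCLM_apply, SchwartzMap.lineDerivOp_apply_eq_fderiv,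
    SchwartzMap.lineDerivOp_apply_eq_fderiv]
  have h := (L.hasFDerivAt (x := W x)).comp x (W.differentiableAt (x := x)).hasFDerivAt
  have e : ⇑(W.postcompCLM L) = L ∘ W := rfl
  rw [e, h.fderiv]
  rfl

lemma postcomp_lapS {F G : Type*} [NormedAddCommGroup F] [NormedSpace ℝ F]
    [NormedAddCommGroup G] [NormedSpace ℝ G] (L : F →L[ℝ] G) (W : 𝓢(Eu N, F)) :
    lapS (W.postcompCLM L) = (lapS W).postcompCLM L := by
  simp only [lapS, postcomp_lineDeriv, map_sum]

/-- The second derivatives of a Schwartz function are bounded in `L^q` by its Laplacian. -/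
lemma exists_LqNorm_lineDeriv_le {q : ℝ} (hq : 1 < q) :
    ∃ C : ℝ, 0 < C ∧ ∀ (N : ℕ) (W : 𝓢(Eu N, ℂ)) (i j : Fin N),
      LqNorm volume q (∂_{ee i} (∂_{ee j} W) : 𝓢(Eu N, ℂ)) ≤ C * LqNorm volume q (lapS W) := by
  have hqr := Real.HolderConjugate.conjExponent hq
  obtain ⟨C, hC, h⟩ := exists_pairing_const hqr
  have hreal : ∀ (N : ℕ) (W : 𝓢(Eu N, ℝ)) (i j : Fin N),
      LqNorm volume q (∂_{ee i} (∂_{ee j} W) : 𝓢(Eu N, ℝ)) ≤ C * LqNorm volume q (lapS W) :=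
    fun N W i j => LqNorm_le_of_pairing hqr _ (fun φ => h N W φ i j)
      (mul_nonneg hC.le (LqNorm_nonneg _))
  refine ⟨2 * C, by positivity, fun N W i j => ?_⟩
  let L : Fin 2 → ℂ →L[ℝ] ℝ := ![Complex.reCLM, Complex.imCLM]
  have hL : ∀ k z, ‖L k z‖ ≤ ‖z‖ := fun k z => by
    fin_cases k
    · exact Complex.abs_re_le_norm z
    · exact Complex.abs_im_le_norm z
  have h1 : LqNorm volume q (∂_{ee i} (∂_{ee j} W) : 𝓢(Eu N, ℂ)) ≤ ∑ k : Fin 2, 1 *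
      LqNorm volume q ((∂_{ee i} (∂_{ee j} W) : 𝓢(Eu N, ℂ)).postcompCLM (L k)) := by
    refine LqNorm_le_sum hq.le Finset.univ (fun _ _ => zero_le_one)
      (fun _ _ => memLp_schwartz _) fun x => ?_
    rw [Fin.sum_univ_two, one_mul, one_mul]
    exact Complex.norm_le_abs_re_add_abs_im _
  have h2 : ∀ k, LqNorm volume q ((∂_{ee i} (∂_{ee j} W) : 𝓢(Eu N, ℂ)).postcompCLM (L k)) ≤
      C * LqNorm volume q (lapS W) := fun k => by
    rw [← postcomp_lineDeriv, ← postcomp_lineDeriv]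
    refine (hreal N _ i j).trans (mul_le_mul_of_nonneg_left ?_ hC.le)
    rw [postcomp_lapS]
    exact LqNorm_mono (by linarith) (integrable_abs_rpow_schwartz _ hq.le) fun x => hL k _
  refine h1.trans ?_
  rw [Fin.sum_univ_two, one_mul, one_mul]
  linarith [h2 0, h2 1]

/-! ### The `L^q` bound for the resolvent -/

lemma norm_integral_gaussian_mul_fourier_le (g : 𝓢(Eu N, ℂ)) {z : ℂ} (hz : ‖z‖ = 1) (hre : 0 < z.re)
    {τ : ℝ} (hτ : 0 < τ) (x : Eu N) :
    ‖∫ η : Eu N, Complex.exp (-(4 * π ^ 2 * τ * z) * ‖η‖ ^ 2 + 2 * π * Complex.I * ⟪x, η⟫) *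
      𝓕 (⇑g) η‖ ≤
      (1 / z.re) ^ (N / 2 : ℝ) *
        ∫ u : Eu N, rexp (-π * ‖u‖ ^ 2) * ‖g (x + √(4 * π * τ / z.re) • u)‖ := by
  set b : ℂ := 4 * π ^ 2 * τ * z with hb
  have hbe : b = ((4 * π ^ 2 * τ : ℝ) : ℂ) * z := by rw [hb]; push_cast; ring
  have hbre : 0 < b.re := by
    rw [hbe, Complex.re_ofReal_mul]; positivity
  have hbn : ‖b‖ = 4 * π ^ 2 * τ := by
    rw [hbe, norm_mul, hz, mul_one, Complex.norm_real, norm_of_nonneg (by positivity)]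
  set f : Eu N → ℂ := fun η => Complex.exp (-b * ‖η‖ ^ 2 + 2 * π * Complex.I * ⟪x, η⟫) with hf
  have hfi : Integrable f := by
    have := GaussianFourier.integrable_cexp_neg_mul_sq_norm_add hbre (2 * π * Complex.I) x
    exact this
  have h1 : ∫ η, f η * 𝓕 (⇑g) η = ∫ y, 𝓕 f y * g y := by
    simpa using! (VectorFourier.integral_fourierIntegral_smul_eq_flip (L := innerₗ (Eu N))
      Real.continuous_fourierChar continuous_inner hfi g.integrable).symm
  rw [h1]
  have h2 : ∀ y, ‖𝓕 f y * g y‖ = (π / (4 * π ^ 2 * τ)) ^ (N / 2 : ℝ) *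
      (rexp (-(z.re / (4 * τ)) * ‖x - y‖ ^ 2) * ‖g y‖) := fun y => by
    rw [hf, fourier_gaussian_innerProductSpace' hbre, norm_mul, norm_mul, Complex.norm_exp,
      mul_assoc]
    congr 1
    · have e : ((Module.finrank ℝ (Eu N) / 2 : ℂ)) = ((N / 2 : ℝ) : ℂ) := by simp
      rw [e, Complex.norm_cpow_real, norm_div, hbn, Complex.norm_real, norm_of_nonneg pi_pos.le]
    · congr 2
      have e : (-(π : ℂ) ^ 2 * ‖x - y‖ ^ 2 / b) =
          ((-(1 / (4 * τ)) * ‖x - y‖ ^ 2 : ℝ) : ℂ) * z⁻¹ := by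
        have hz0 : z ≠ 0 := by rintro rfl; simp at hz
        have : (τ : ℂ) ≠ 0 := by exact_mod_cast hτ.ne'
        have : (π : ℂ) ≠ 0 := by exact_mod_cast pi_pos.ne'
        rw [hb]
        push_cast
        field_simp
      rw [e, Complex.re_ofReal_mul, Complex.inv_re, Complex.normSq_eq_norm_sq, hz]
      ring
  refine (norm_integral_le_integral_norm _).trans_eq ?_
  simp only [h2]
  rw [integral_const_mul]
  set s := √(4 * π * τ / z.re) with hs
  have hs0 : 0 < s := Real.sqrt_pos.2 (by positivity)
  have hs2 : s ^ 2 = 4 * π * τ / z.re := Real.sq_sqrt (by positivity)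
  set Φ : Eu N → ℝ := fun y => rexp (-(z.re / (4 * τ)) * ‖y‖ ^ 2) * ‖g (x + y)‖ with hΦ
  have h3 : ∫ y, rexp (-(z.re / (4 * τ)) * ‖x - y‖ ^ 2) * ‖g y‖ = ∫ y, Φ y := by
    rw [← integral_add_left_eq_self _ x]
    simp [hΦ]
  have h4 : ∀ u, rexp (-π * ‖u‖ ^ 2) * ‖g (x + s • u)‖ = Φ (s • u) := fun u => by
    simp only [hΦ]
    congr 2
    rw [norm_smul, norm_of_nonneg hs0.le, mul_pow, hs2]
    field_simp
  simp only [h4]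
  rw [h3, Measure.integral_comp_smul, abs_of_pos (by positivity), smul_eq_mul, ← mul_assoc]
  congr 1
  have h5 : s ^ Module.finrank ℝ (Eu N) = (4 * π * τ / z.re) ^ (N / 2 : ℝ) := by
    rw [← hs2, ← rpow_natCast, ← rpow_natCast, ← rpow_mul hs0.le]
    congr 1
    simp; ring
  rw [h5, ← inv_rpow (by positivity), ← mul_rpow (by positivity) (by positivity)]
  congr 1
  field_simp

lemma integral_exp_neg_pi_mul_norm_sq : ∫ u : Eu N, rexp (-π * ‖u‖ ^ 2) = 1 := by
  rw [GaussianFourier.integral_rexp_neg_mul_sq_norm pi_pos, div_self pi_pos.ne', one_rpow]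

lemma integrable_exp_neg_pi_mul_norm_sq : Integrable fun u : Eu N => rexp (-π * ‖u‖ ^ 2) :=
  integrable_exp_neg_mul_norm_sq pi_pos

lemma inv_eq_integral_exp {w z : ℂ} (hz : z ≠ 0) (h : 0 < (w * z).re) :
    w⁻¹ = ∫ τ in Set.Ioi (0 : ℝ), z * Complex.exp (-(w * z) * τ) := by
  have hw : w ≠ 0 := by rintro rfl; simp at h
  rw [integral_const_mul, integral_exp_mul_complex_Ioi (by simpa using h)]
  simp
  field_simp

lemma norm_resolvent_le (g : 𝓢(Eu N, ℂ)) {μ z : ℂ} (hz : ‖z‖ = 1) (hre : 0 < z.re)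
    (hμ : 0 < (μ * z).re) (x : Eu N) :
    ‖∫ η : Eu N, Complex.exp (2 * π * Complex.I * ⟪x, η⟫) *
      ((μ + 4 * π ^ 2 * ‖η‖ ^ 2)⁻¹ * 𝓕 (⇑g) η)‖ ≤
    ∫ p : ℝ × Eu N, (rexp (-(μ * z).re * p.1) * rexp (-π * ‖p.2‖ ^ 2)) *
      ((1 / z.re) ^ (N / 2 : ℝ) * ‖g (x + √(4 * π * p.1 / z.re) • p.2)‖)
        ∂((volume.restrict (Set.Ioi (0 : ℝ))).prod volume) := by
  have hE : Integrable (fun τ : ℝ => rexp (-(μ * z).re * τ)) (volume.restrict (Set.Ioi 0)) :=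
    integrableOn_exp_mul_Ioi (by linarith) 0
  have hz0 : z ≠ 0 := by rintro rfl; simp at hz
  have hG : Integrable (𝓕 (⇑g)) := by
    rw [← SchwartzMap.fourier_coe]; exact (𝓕 g).integrable
  set F : ℝ → Eu N → ℂ := fun τ η => z * Complex.exp (-(μ * z) * τ) *
    (Complex.exp (-(4 * π ^ 2 * τ * z) * ‖η‖ ^ 2 + 2 * π * Complex.I * ⟪x, η⟫) * 𝓕 (⇑g) η) with hF
  have hFn : ∀ τ η, ‖F τ η‖ = rexp (-(μ * z).re * τ) * (rexp (-(4 * π ^ 2 * τ * z.re) * ‖η‖ ^ 2) *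
      ‖𝓕 (⇑g) η‖) := fun τ η => by
    simp only [hF, norm_mul, hz, one_mul, Complex.norm_exp]
    congr 2
    · simp; ring
    · congr 1
      simp [← Complex.ofReal_pow]
  have h1 : ∀ η : Eu N, Complex.exp (2 * π * Complex.I * ⟪x, η⟫) *
      ((μ + 4 * π ^ 2 * ‖η‖ ^ 2)⁻¹ * 𝓕 (⇑g) η) = ∫ τ in Set.Ioi (0 : ℝ), F τ η := fun η => by
    have hw : 0 < ((μ + 4 * π ^ 2 * ‖η‖ ^ 2) * z).re := by
      have e : (μ + 4 * π ^ 2 * ‖η‖ ^ 2) * z = μ * z + ((4 * π ^ 2 * ‖η‖ ^ 2 : ℝ) : ℂ) * z := by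
        push_cast; ring
      rw [e, Complex.add_re, Complex.re_ofReal_mul]
      positivity
    rw [inv_eq_integral_exp hz0 hw, ← integral_mul_const, ← integral_const_mul]
    congr 1; ext τ
    simp only [hF]
    rw [Complex.exp_add, ← mul_assoc, ← mul_assoc, ← mul_assoc]
    have : -((μ + 4 * π ^ 2 * ‖η‖ ^ 2) * z) * τ = -(μ * z) * τ + -(4 * π ^ 2 * τ * z) * ‖η‖ ^ 2 := by
      ring
    rw [this, Complex.exp_add]
    ring
  simp only [h1]
  have hinteg : Integrable (Function.uncurry fun η τ => F τ η)
      ((volume : Measure (Eu N)).prod (volume.restrict (Set.Ioi (0 : ℝ)))) := by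
    have hc : AEStronglyMeasurable (Function.uncurry fun η τ => F τ η)
        ((volume : Measure (Eu N)).prod (volume.restrict (Set.Ioi (0 : ℝ)))) := by
      have : Continuous (𝓕 (⇑g)) := by
        rw [← SchwartzMap.fourier_coe]; exact (𝓕 g).continuous
      refine Continuous.aestronglyMeasurable ?_
      simp only [hF, Function.uncurry_def]
      fun_prop
    refine (hG.norm.mul_prod hE).mono' hc ?_
    have : ∀ᵐ p ∂((volume : Measure (Eu N)).prod (volume.restrict (Set.Ioi (0 : ℝ)))), 0 < p.2 :=
      Measure.quasiMeasurePreserving_snd.ae (ae_restrict_mem measurableSet_Ioi)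
    filter_upwards [this] with p hp
    rw [Function.uncurry_def, hFn, mul_comm]
    refine mul_le_mul_of_nonneg_right ?_ (by positivity)
    refine mul_le_of_le_one_left (norm_nonneg _) (exp_le_one_iff.2 ?_)
    rw [neg_mul, neg_nonpos]
    positivity
  rw [integral_integral_swap hinteg]
  have hΨ : Integrable (fun p : ℝ × Eu N => (rexp (-(μ * z).re * p.1) * rexp (-π * ‖p.2‖ ^ 2)) *
      ((1 / z.re) ^ (N / 2 : ℝ) * ‖g (x + √(4 * π * p.1 / z.re) • p.2)‖))
        ((volume.restrict (Set.Ioi (0 : ℝ))).prod volume) := by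
    obtain ⟨C, hC, hgC⟩ := bdd_schwartz g
    refine (hE.mul_prod integrable_exp_neg_pi_mul_norm_sq).mul_bdd
      (c := (1 / z.re) ^ (N / 2 : ℝ) * C) ?_ (Eventually.of_forall fun p => ?_)
    · have := g.continuous
      exact Continuous.aestronglyMeasurable (by fun_prop)
    · rw [norm_mul, norm_norm, norm_of_nonneg (by positivity)]
      exact mul_le_mul_of_nonneg_left (hgC _) (by positivity)
  rw [integral_prod _ hΨ]
  have e : ∀ τ : ℝ, ∫ u : Eu N, (rexp (-(μ * z).re * τ) * rexp (-π * ‖u‖ ^ 2)) *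
      ((1 / z.re) ^ (N / 2 : ℝ) * ‖g (x + √(4 * π * τ / z.re) • u)‖) =
      rexp (-(μ * z).re * τ) * ((1 / z.re) ^ (N / 2 : ℝ) *
        ∫ u : Eu N, rexp (-π * ‖u‖ ^ 2) * ‖g (x + √(4 * π * τ / z.re) • u)‖) := fun τ => by
    rw [← integral_const_mul, ← integral_const_mul]
    congr 1; ext u; ring
  simp only [e]
  refine norm_integral_le_of_norm_le (f := fun τ => ∫ η, F τ η) ?_
    ((ae_restrict_mem measurableSet_Ioi).mono fun τ hτ => ?_)
  · simpa only [e] using hΨ.integral_prod_left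
  · simp only [hF]
    rw [integral_const_mul, norm_mul, norm_mul, hz, one_mul, Complex.norm_exp]
    refine mul_le_mul (le_of_eq (by simp; ring)) (norm_integral_gaussian_mul_fourier_le g hz hre hτ x)
      (norm_nonneg _) (exp_nonneg _)

/-- The `L^q` bound for the resolvent of the Laplacian. -/
lemma LqNorm_resolvent_le {q : ℝ} (hq : 1 ≤ q) (g W : 𝓢(Eu N, ℂ)) {μ z : ℂ} (hz : ‖z‖ = 1)
    (hre : 0 < z.re) (hμ : 0 < (μ * z).re)
    (hW : ∀ x, W x = ∫ η : Eu N, Complex.exp (2 * π * Complex.I * ⟪x, η⟫) *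
      ((μ + 4 * π ^ 2 * ‖η‖ ^ 2)⁻¹ * 𝓕 (⇑g) η)) :
    LqNorm volume q W ≤ (1 / z.re) ^ (N / 2 : ℝ) / (μ * z).re * LqNorm volume q g := by
  have hq0 : 0 < q := by linarith
  have hE : Integrable (fun τ : ℝ => rexp (-(μ * z).re * τ)) (volume.restrict (Set.Ioi 0)) :=
    integrableOn_exp_mul_Ioi (by linarith) 0
  set d : ℝ × Eu N → ℝ := fun p => rexp (-(μ * z).re * p.1) * rexp (-π * ‖p.2‖ ^ 2) with hd
  have hdi : Integrable d ((volume.restrict (Set.Ioi (0 : ℝ))).prod volume) :=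
    hE.mul_prod integrable_exp_neg_pi_mul_norm_sq
  have hdm : Measurable fun p => ENNReal.ofReal (d p) := by
    have : Continuous d := by fun_prop
    exact this.measurable.ennreal_ofReal
  set ν := ((volume.restrict (Set.Ioi (0 : ℝ))).prod (volume : Measure (Eu N))).withDensity
    fun p => ENNReal.ofReal (d p) with hν
  have hd0 : ∀ p, 0 ≤ d p := fun p => by positivity
  have hνi : ∀ h : ℝ × Eu N → ℝ, ∫ p, h p ∂ν =
      ∫ p, d p * h p ∂((volume.restrict (Set.Ioi (0 : ℝ))).prod volume) := fun h => by
    rw [hν, integral_withDensity_eq_integral_toReal_smul hdm (by simp)]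
    simp only [ENNReal.toReal_ofReal (hd0 _), smul_eq_mul]
  have : IsFiniteMeasure ν := isFiniteMeasure_withDensity_ofReal hdi.2
  have hmass : ν.real Set.univ = ((μ * z).re)⁻¹ := by
    have := hνi fun _ => 1
    rw [integral_const, smul_eq_mul, mul_one] at this
    rw [this]
    simp only [mul_one, hd]
    rw [integral_prod_mul (fun τ : ℝ => rexp (-(μ * z).re * τ))
      (fun u : Eu N => rexp (-π * ‖u‖ ^ 2)), integral_exp_neg_pi_mul_norm_sq,
      integral_exp_mul_Ioi (by linarith)]
    rw [mul_zero, exp_zero, mul_one, neg_div_neg_eq, one_div]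
  obtain ⟨C, hC, hgC⟩ := bdd_schwartz g
  set K := (1 / z.re) ^ (N / 2 : ℝ) with hK
  have hK0 : 0 ≤ K := by positivity
  have hGq : ∀ x, (K * ‖g x‖) ^ q = K ^ q * ‖g x‖ ^ q := fun x => mul_rpow hK0 (norm_nonneg _)
  have key := integral_rpow_le_of_le_integral_translate (ν := ν)
    (T := fun p : ℝ × Eu N => √(4 * π * p.1 / z.re) • p.2)
    (Continuous.measurable (by fun_prop)) (G := fun x => K * ‖g x‖) (w := fun x => ‖W x‖)
    (continuous_const.mul g.continuous.norm) (fun _ => by positivity)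
    (fun x => mul_le_mul_of_nonneg_left (hgC x) hK0) hq
    (by simpa only [hGq] using (integrable_abs_rpow_schwartz g hq).const_mul (K ^ q))
    (fun _ => norm_nonneg _) (fun x => by
      rw [hνi, hW]
      exact norm_resolvent_le g hz hre hμ x)
  refine LqNorm_le_of_integral_le hq0 (mul_nonneg (by positivity) (LqNorm_nonneg _)) ?_
  refine key.trans_eq ?_
  simp only [hGq]
  rw [integral_const_mul, hmass, mul_rpow (by positivity) (LqNorm_nonneg _), LqNorm_rpow hq0,
    div_eq_inv_mul, mul_rpow (by positivity) hK0, mul_assoc]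

/-! ### Interpolation of first derivatives -/

lemma hasDerivAt_schwartz_line {F : Type*} [NormedAddCommGroup F] [NormedSpace ℝ F]
    (W : 𝓢(Eu N, F)) (x v : Eu N) (t : ℝ) :
    HasDerivAt (fun t : ℝ => W (x + t • v)) ((∂_{v} W : 𝓢(Eu N, F)) (x + t • v)) t := by
  rw [SchwartzMap.lineDerivOp_apply_eq_fderiv]
  have h1 : HasDerivAt (fun t : ℝ => x + t • v) v t := by
    simpa using ((hasDerivAt_id t).smul_const v).const_add x
  exact (W.differentiableAt.hasFDerivAt (x := x + t • v)).comp_hasDerivAt t h1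

lemma norm_lineDeriv_le {F : Type*} [NormedAddCommGroup F] [NormedSpace ℝ F] [CompleteSpace F]
    (W : 𝓢(Eu N, F)) (x v : Eu N) :
    ‖(∂_{v} W : 𝓢(Eu N, F)) x‖ ≤ ‖W (x + v)‖ + ‖W x‖ +
      ∫ t in Set.Ioc (0 : ℝ) 1, ‖(∂_{v} (∂_{v} W) : 𝓢(Eu N, F)) (x + t • v)‖ := by
  set W1 : 𝓢(Eu N, F) := ∂_{v} W with hW1
  set W2 : 𝓢(Eu N, F) := ∂_{v} W1 with hW2
  have hd : ∀ t : ℝ, HasDerivAt (fun t : ℝ => W (x + t • v) + (1 - t) • W1 (x + t • v))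
      ((1 - t) • W2 (x + t • v)) t := fun t => by
    have h1 := hasDerivAt_schwartz_line W x v t
    have h2 := hasDerivAt_schwartz_line W1 x v t
    have h3 : HasDerivAt (fun t : ℝ => 1 - t) (-1) t := by
      simpa using (hasDerivAt_id t).const_sub 1
    refine (h1.add (h3.smul h2)).congr_deriv ?_
    simp only [← hW1, ← hW2]
    module
  have hc2 : Continuous W2 := W2.continuous
  have hc : Continuous fun t : ℝ => (1 - t) • W2 (x + t • v) := by fun_prop
  have hI := intervalIntegral.integral_eq_sub_of_hasDerivAt (fun t _ => hd t)
    (hc.intervalIntegrable 0 1)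
  simp only [one_smul, zero_smul, add_zero, sub_self, sub_zero] at hI
  have e : W1 x = W (x + v) - W x - ∫ t in (0 : ℝ)..1, (1 - t) • W2 (x + t • v) := by
    rw [hI]; abel
  have hle : ‖∫ t in (0 : ℝ)..1, (1 - t) • W2 (x + t • v)‖ ≤
      ∫ t in Set.Ioc (0 : ℝ) 1, ‖W2 (x + t • v)‖ := by
    rw [intervalIntegral.integral_of_le zero_le_one]
    refine norm_integral_le_of_norm_le (f := fun t : ℝ => (1 - t) • W2 (x + t • v)) ?_
      ((ae_restrict_mem measurableSet_Ioc).mono fun t ht => ?_)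
    · have : Continuous fun t : ℝ => ‖W2 (x + t • v)‖ := by fun_prop
      exact this.integrableOn_Ioc
    · rw [norm_smul]
      refine mul_le_of_le_one_left (norm_nonneg _) ?_
      rw [Real.norm_eq_abs, abs_le]
      constructor <;> linarith [ht.1, ht.2]
  rw [e]
  exact (norm_sub_le _ _).trans (add_le_add (norm_sub_le _ _) hle)

lemma LqNorm_lineDeriv_le {F : Type*} [NormedAddCommGroup F] [NormedSpace ℝ F] [CompleteSpace F]
    {q : ℝ} (hq : 1 ≤ q) (W : 𝓢(Eu N, F)) (v : Eu N) :
    LqNorm volume q (∂_{v} W : 𝓢(Eu N, F)) ≤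
      3 * (LqNorm volume q W + LqNorm volume q (∂_{v} (∂_{v} W) : 𝓢(Eu N, F))) := by
  have hq0 : 0 < q := by linarith
  set W2 : 𝓢(Eu N, F) := ∂_{v} (∂_{v} W) with hW2
  obtain ⟨C, hC, h1⟩ := bdd_schwartz W
  obtain ⟨D, hD, h2⟩ := bdd_schwartz W2
  set G : Eu N → ℝ := fun x => ‖W x‖ + ‖W2 x‖ with hG
  have hGc : Continuous G := W.continuous.norm.add W2.continuous.norm
  have hG0 : ∀ x, 0 ≤ G x := fun x => by positivity
  have hGC : ∀ x, G x ≤ C + D := fun x => add_le_add (h1 x) (h2 x)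
  have hm : MemLp G (ENNReal.ofReal q) volume := (memLp_schwartz W).norm.add (memLp_schwartz W2).norm
  have hGi : Integrable (fun x => G x ^ q) := by
    have := (integrable_norm_rpow_iff hm.1 (by simpa using hq0) ENNReal.ofReal_ne_top).2 hm
    rw [ENNReal.toReal_ofReal hq0.le] at this
    simpa only [norm_of_nonneg (hG0 _)] using this
  set ν : Measure ℝ := Measure.dirac 0 + Measure.dirac 1 + volume.restrict (Set.Ioc 0 1) with hν
  have hGint : ∀ (x : Eu N) (κ : Measure ℝ) [IsFiniteMeasure κ],
      Integrable (fun t : ℝ => G (x + t • v)) κ := fun x κ _ => by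
    refine Integrable.of_bound (C := C + D) (Continuous.aestronglyMeasurable (by fun_prop))
      (Eventually.of_forall fun t => ?_)
    rw [norm_of_nonneg (hG0 _)]
    exact hGC _
  have key := integral_rpow_le_of_le_integral_translate (ν := ν) (T := fun t : ℝ => t • v)
    (Continuous.measurable (by fun_prop)) hGc hG0 hGC hq hGi
    (w := fun x => ‖(∂_{v} W : 𝓢(Eu N, F)) x‖) (fun _ => norm_nonneg _) (fun x => by
      rw [hν, integral_add_measure (hGint x _) (hGint x _),
        integral_add_measure (hGint x _) (hGint x _), integral_dirac, integral_dirac, zero_smul,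
        one_smul, add_zero]
      have h3 : ∫ t in Set.Ioc (0 : ℝ) 1, ‖W2 (x + t • v)‖ ≤
          ∫ t in Set.Ioc (0 : ℝ) 1, G (x + t • v) := by
        refine integral_mono_of_nonneg (Eventually.of_forall fun t => norm_nonneg _)
          (hGint x _) (Eventually.of_forall fun t => ?_)
        exact le_add_of_nonneg_left (norm_nonneg _)
      refine (norm_lineDeriv_le W x v).trans (add_le_add ?_ h3)
      have a1 : ‖W (x + v)‖ ≤ G (x + v) := le_add_of_nonneg_right (norm_nonneg _)
      have a2 : ‖W x‖ ≤ G x := le_add_of_nonneg_right (norm_nonneg _)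
      linarith)
  have hmass : ν.real Set.univ = 3 := by
    rw [hν, measureReal_add_apply, measureReal_add_apply]
    simp
    norm_num
  rw [hmass] at key
  have hGs : LqNorm volume q G ≤ LqNorm volume q W + LqNorm volume q W2 := by
    have := LqNorm_le_sum (μ := (volume : Measure (Eu N))) hq (Finset.univ : Finset (Fin 2))
      (f := ![W, W2]) (w := G) (c := fun _ => 1) (fun _ _ => zero_le_one)
      (fun i _ => by fin_cases i; exacts [memLp_schwartz W, memLp_schwartz W2]) (fun x => by
        simp [Fin.sum_univ_two, hG]
        rw [abs_of_nonneg (by positivity)])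
    simpa [Fin.sum_univ_two] using this
  refine (LqNorm_le_of_integral_le hq0 (a := 3 * LqNorm volume q G)
    (mul_nonneg (by norm_num) (LqNorm_nonneg _)) ?_).trans
    (mul_le_mul_of_nonneg_left hGs (by norm_num))
  rw [mul_rpow (by norm_num) (LqNorm_nonneg _), LqNorm_rpow hq0]
  simpa only [norm_of_nonneg (hG0 _)] using key

lemma LqNorm_smul_le {α E : Type*} [MeasurableSpace α] {μ : Measure α} [NormedAddCommGroup E]
    [NormedSpace ℝ E] {q : ℝ} (hq : 0 < q) (f : α → E) (c : ℝ) :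
    LqNorm μ q (c • f) = |c| * LqNorm μ q f := by
  have e : ∀ x, ‖(c • f) x‖ ^ q = |c| ^ q * ‖f x‖ ^ q := fun x => by
    rw [Pi.smul_apply, norm_smul, Real.norm_eq_abs, mul_rpow (abs_nonneg _) (norm_nonneg _)]
  unfold LqNorm
  simp only [e]
  rw [integral_const_mul, mul_rpow (by positivity) (integral_nonneg fun _ => by positivity),
    ← rpow_mul (abs_nonneg _), mul_one_div_cancel hq.ne', rpow_one]

lemma mul_LqNorm_lineDeriv_le {F : Type*} [NormedAddCommGroup F] [NormedSpace ℝ F]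
    [CompleteSpace F] {q : ℝ} (hq : 1 ≤ q) (W : 𝓢(Eu N, F)) (v : Eu N) {a : ℝ} (ha : 0 < a) :
    a * LqNorm volume q (∂_{v} W : 𝓢(Eu N, F)) ≤
      3 * (a ^ 2 * LqNorm volume q W + LqNorm volume q (∂_{v} (∂_{v} W) : 𝓢(Eu N, F))) := by
  have hq0 : 0 < q := by linarith
  have h := LqNorm_lineDeriv_le hq W (a⁻¹ • v)
  have e1 : ∀ V : 𝓢(Eu N, F), ⇑(∂_{a⁻¹ • v} V : 𝓢(Eu N, F)) = a⁻¹ • ⇑(∂_{v} V : 𝓢(Eu N, F)) :=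
    fun V => by
      ext x
      simp [SchwartzMap.lineDerivOp_apply_eq_fderiv]
  have e2 : ⇑(∂_{a⁻¹ • v} (∂_{a⁻¹ • v} W) : 𝓢(Eu N, F)) =
      (a⁻¹ ^ 2) • ⇑(∂_{v} (∂_{v} W) : 𝓢(Eu N, F)) := by
    have : (∂_{a⁻¹ • v} W : 𝓢(Eu N, F)) = a⁻¹ • (∂_{v} W : 𝓢(Eu N, F)) := by
      ext x; rw [e1]; rfl
    rw [this, LineDeriv.lineDerivOp_smul]
    ext x
    rw [smul_apply, e1, Pi.smul_apply, Pi.smul_apply, smul_smul, sq]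
  rw [e1, e2, LqNorm_smul_le hq0, LqNorm_smul_le hq0, abs_of_pos (by positivity),
    abs_of_pos (by positivity)] at h
  have := mul_le_mul_of_nonneg_left h (sq_nonneg a)
  calc _ = a ^ 2 * (a⁻¹ * LqNorm volume q (∂_{v} W : 𝓢(Eu N, F))) := by field_simp
    _ ≤ _ := this
    _ = _ := by field_simp

/-! ### The Fourier multiplier -/

lemma hasTemperateGrowth_inv_sq_add_sq {E : Type*} [NormedAddCommGroup E] [NormedSpace ℝ E]
    {u : E → ℝ} (hu : u.HasTemperateGrowth) {b : ℝ} (hb : b ≠ 0) :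
    (fun x => (u x ^ 2 + b ^ 2)⁻¹).HasTemperateGrowth := by
  have h1 : (fun x => b⁻¹ * u x).HasTemperateGrowth := (Function.HasTemperateGrowth.const _).mul hu
  have h2 := (Function.hasTemperateGrowth_one_add_norm_sq_rpow ℝ (-1)).comp h1
  have h3 : (fun x => (b ^ 2)⁻¹ * ((fun x : ℝ => (1 + ‖x‖ ^ 2) ^ (-1 : ℝ)) ∘
      (fun x => b⁻¹ * u x)) x).HasTemperateGrowth := (Function.HasTemperateGrowth.const _).mul h2
  convert h3 using 2 with x
  simp only [Function.comp, Real.rpow_neg_one, ← mul_inv, Real.norm_eq_abs, sq_abs]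
  congr 1
  field_simp
  ring

lemma symbol_ne_zero {μ z : ℂ} (hre : 0 < z.re) (hμ : 0 < (μ * z).re) (t : ℝ) (ht : 0 ≤ t) :
    μ + t ≠ 0 := by
  intro h
  have h1 : ((μ + t) * z).re = (μ * z).re + t * z.re := by
    rw [add_mul, Complex.add_re, Complex.re_ofReal_mul]
  rw [h, zero_mul, Complex.zero_re] at h1
  have := mul_nonneg ht hre.le
  linarith

lemma hasTemperateGrowth_symbol {μ : ℂ} (hμ : ∀ t : ℝ, 0 ≤ t → μ + t ≠ 0) :
    (fun η : Eu N => (μ + 4 * π ^ 2 * ‖η‖ ^ 2 : ℂ)⁻¹).HasTemperateGrowth := by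
  by_cases him : μ.im = 0
  · have hpos : 0 < μ.re := by
      by_contra hcon
      refine hμ (-μ.re) (by linarith) (Complex.ext ?_ ?_) <;> simp [him]
    have h1 : (fun η : Eu N => (2 * π / √μ.re) • η).HasTemperateGrowth := by fun_prop
    have h2 := (Function.hasTemperateGrowth_one_add_norm_sq_rpow (Eu N) (-1)).comp h1
    have h3 : (fun η : Eu N => (((μ.re)⁻¹ * ((fun x : Eu N => (1 + ‖x‖ ^ 2) ^ (-1 : ℝ)) ∘
        (fun η : Eu N => (2 * π / √μ.re) • η)) η : ℝ) : ℂ)).HasTemperateGrowth :=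
      Function.Complex.hasTemperateGrowth_ofReal.comp ((Function.HasTemperateGrowth.const _).mul h2)
    convert h3 using 2 with η
    have h4 : μ = (μ.re : ℂ) := Complex.ext (by simp) (by simp [him])
    have h5 : (μ.re)⁻¹ * ((fun x : Eu N => (1 + ‖x‖ ^ 2) ^ (-1 : ℝ)) ∘
        (fun η : Eu N => (2 * π / √μ.re) • η)) η = (μ.re + 4 * π ^ 2 * ‖η‖ ^ 2)⁻¹ := by
      simp only [Function.comp, Real.rpow_neg_one, ← mul_inv, norm_smul, mul_pow, Real.norm_eq_abs,
        sq_abs, div_pow, Real.sq_sqrt hpos.le]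
      congr 1
      field_simp
      ring
    rw [h5, h4]
    push_cast
    simp
  · have hu : (fun η : Eu N => μ.re + 4 * π ^ 2 * ‖η‖ ^ 2).HasTemperateGrowth :=
      (Function.HasTemperateGrowth.const _).add
        ((Function.HasTemperateGrowth.const _).mul (Function.hasTemperateGrowth_norm_sq _))
    have h1 := hasTemperateGrowth_inv_sq_add_sq hu him
    have h2 : (fun η : Eu N => (((μ.re + 4 * π ^ 2 * ‖η‖ ^ 2 : ℝ) : ℂ) - μ.im * Complex.I) *
        (((((μ.re + 4 * π ^ 2 * ‖η‖ ^ 2) ^ 2 + μ.im ^ 2)⁻¹ : ℝ)) : ℂ)).HasTemperateGrowth :=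
      ((Function.Complex.hasTemperateGrowth_ofReal.comp hu).sub (Function.HasTemperateGrowth.const _)).mul
        (Function.Complex.hasTemperateGrowth_ofReal.comp h1)
    convert h2 using 2 with η
    have h3 : (μ + 4 * π ^ 2 * ‖η‖ ^ 2 : ℂ) =
        (μ.re + 4 * π ^ 2 * ‖η‖ ^ 2 : ℝ) + μ.im * Complex.I := by
      conv_lhs => rw [← Complex.re_add_im μ]
      push_cast
      ring
    have h4 : (0 : ℝ) < (μ.re + 4 * π ^ 2 * ‖η‖ ^ 2) ^ 2 + μ.im ^ 2 := by positivity
    have h5 : (((μ.re + 4 * π ^ 2 * ‖η‖ ^ 2 : ℝ) : ℂ) + μ.im * Complex.I) *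
        (((μ.re + 4 * π ^ 2 * ‖η‖ ^ 2 : ℝ) : ℂ) - μ.im * Complex.I) =
        (((μ.re + 4 * π ^ 2 * ‖η‖ ^ 2) ^ 2 + μ.im ^ 2 : ℝ) : ℂ) := by
      generalize (μ.re + 4 * π ^ 2 * ‖η‖ ^ 2) = s
      push_cast
      linear_combination (-(μ.im : ℂ) ^ 2) * Complex.I_sq
    rw [h3]
    refine inv_eq_of_mul_eq_one_right ?_
    rw [← mul_assoc, h5, Complex.ofReal_inv]
    exact mul_inv_cancel₀ (Complex.ofReal_ne_zero.2 h4.ne')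

/-- The solution of `μ W - Δ W = g`, as a Fourier multiplier. -/
noncomputable def resolvent (μ : ℂ) (g : 𝓢(Eu N, ℂ)) : 𝓢(Eu N, ℂ) :=
  SchwartzMap.fourierMultiplierCLM ℂ (fun η : Eu N => (μ + 4 * π ^ 2 * ‖η‖ ^ 2 : ℂ)⁻¹) g

lemma fourier_resolvent {μ : ℂ} (hμ : ∀ t : ℝ, 0 ≤ t → μ + t ≠ 0) (g : 𝓢(Eu N, ℂ)) (η : Eu N) :
    𝓕 (resolvent μ g) η = (μ + 4 * π ^ 2 * ‖η‖ ^ 2 : ℂ)⁻¹ * 𝓕 (⇑g) η := by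
  rw [resolvent, SchwartzMap.fourierMultiplierCLM_apply, FourierTransform.fourier_fourierInv_eq,
    SchwartzMap.smulLeftCLM_apply_apply (hasTemperateGrowth_symbol hμ), smul_eq_mul,
    SchwartzMap.fourier_coe]

lemma resolvent_apply {μ : ℂ} (hμ : ∀ t : ℝ, 0 ≤ t → μ + t ≠ 0) (g : 𝓢(Eu N, ℂ)) (x : Eu N) :
    resolvent μ g x = ∫ η : Eu N, Complex.exp (2 * π * Complex.I * ⟪x, η⟫) *
      ((μ + 4 * π ^ 2 * ‖η‖ ^ 2 : ℂ)⁻¹ * 𝓕 (⇑g) η) := by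
  rw [← FourierTransform.fourierInv_fourier_eq (F := 𝓢(Eu N, ℂ)) (resolvent μ g),
    SchwartzMap.fourierInv_coe,
    Real.fourierInv_eq']
  refine integral_congr_ae (.of_forall fun η => ?_)
  simp only [smul_eq_mul]
  rw [fourier_resolvent hμ, real_inner_comm]
  congr 2
  push_cast
  ring

lemma laplacian_eq_lapS (W : 𝓢(Eu N, ℂ)) : Δ W = lapS W := by
  rw [SchwartzMap.laplacian_eq_sum (EuclideanSpace.basisFun (Fin N) ℝ)]
  simp [lapS]

lemma resolvent_sub_lapS {μ : ℂ} (hμ : ∀ t : ℝ, 0 ≤ t → μ + t ≠ 0) (g : 𝓢(Eu N, ℂ)) :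
    μ • resolvent μ g - lapS (resolvent μ g) = g := by
  have hns : (fun η : Eu N => (‖η‖ : ℂ) ^ 2).HasTemperateGrowth := by
    have := Function.Complex.hasTemperateGrowth_ofReal.comp (Function.hasTemperateGrowth_norm_sq (Eu N))
    simpa [Function.comp_def] using this
  have hF : 𝓕 (μ • resolvent μ g - lapS (resolvent μ g)) = 𝓕 g := by
    ext η
    have h0 : (μ + 4 * π ^ 2 * ‖η‖ ^ 2 : ℂ) ≠ 0 := by
      have := hμ (4 * π ^ 2 * ‖η‖ ^ 2) (by positivity)
      push_cast at this
      exact this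
    have h1 : 𝓕 (lapS (resolvent μ g)) η =
        -(4 * π ^ 2 * ‖η‖ ^ 2 : ℂ) * 𝓕 (resolvent μ g) η := by
      rw [← laplacian_eq_lapS, SchwartzMap.laplacian_eq_fourierMultiplierCLM,
        FourierTransform.fourier_smul, SchwartzMap.fourierMultiplierCLM_apply,
        FourierTransform.fourier_fourierInv_eq, smul_apply,
        SchwartzMap.smulLeftCLM_apply_apply (by fun_prop)]
      simp only [Complex.real_smul]
      push_cast
      ring
    rw [sub_eq_add_neg, ← neg_one_smul ℂ (lapS _), FourierTransform.fourier_add,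
      FourierTransform.fourier_smul, FourierTransform.fourier_smul, add_apply,
      smul_apply, smul_apply, h1, fourier_resolvent hμ,
      smul_eq_mul, smul_eq_mul, SchwartzMap.fourier_coe]
    field_simp
  rw [← FourierTransform.fourierInv_fourier_eq (F := 𝓢(Eu N, ℂ))
    (μ • resolvent μ g - lapS (resolvent μ g)), hF,
    FourierTransform.fourierInv_fourier_eq]

lemma lapl_eq_lapS (W : 𝓢(Eu N, ℂ)) (x : Eu N) : lapl (fun y => W y) x = lapS W x := by
  simp only [lapl, lapS, sum_apply]
  refine Finset.sum_congr rfl fun i _ => ?_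
  rw [SchwartzMap.lineDerivOp_apply_eq_fderiv]
  rfl

/-- The integrand of the Fourier inversion formula for the resolvent, in the angular frequency
normalization. -/
lemma resolvent_integrand_eq (μ : ℂ) (g : 𝓢(Eu N, ℂ)) (x ξ : Eu N) :
    Complex.exp (Complex.I * (⟪x, ξ⟫ : ℂ)) *
      (∫ y : Eu N, Complex.exp (-Complex.I * (⟪y, ξ⟫ : ℂ)) * g y) / (μ + (‖ξ‖ : ℂ) ^ 2) =
    (fun η : Eu N => Complex.exp (2 * π * Complex.I * ⟪x, η⟫) *
      ((μ + 4 * π ^ 2 * ‖η‖ ^ 2 : ℂ)⁻¹ * 𝓕 (⇑g) η)) ((2 * π)⁻¹ • ξ) := by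
  have hπ : (π : ℂ) ≠ 0 := Complex.ofReal_ne_zero.2 Real.pi_ne_zero
  have h1 : 𝓕 (⇑g) ((2 * π)⁻¹ • ξ) = ∫ y : Eu N, Complex.exp (-Complex.I * (⟪y, ξ⟫ : ℂ)) * g y := by
    rw [Real.fourier_eq']
    refine integral_congr_ae (.of_forall fun y => ?_)
    simp only [smul_eq_mul, real_inner_smul_right]
    congr 2
    push_cast
    field_simp
  have h2 : Complex.exp (2 * π * Complex.I * (⟪x, (2 * π)⁻¹ • ξ⟫ : ℝ)) =
      Complex.exp (Complex.I * (⟪x, ξ⟫ : ℂ)) := by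
    rw [real_inner_smul_right]
    congr 1
    push_cast
    field_simp
  have h3 : (4 * π ^ 2 * (‖(2 * π)⁻¹ • ξ‖ : ℝ) ^ 2 : ℂ) = (‖ξ‖ : ℂ) ^ 2 := by
    rw [norm_smul, Real.norm_of_nonneg (by positivity)]
    push_cast
    field_simp
    norm_num
  simp only [h1, h2, h3]
  ring

lemma integrable_resolvent_integrand {μ : ℂ} (hμ : ∀ t : ℝ, 0 ≤ t → μ + t ≠ 0) (g : 𝓢(Eu N, ℂ))
    (x : Eu N) :
    Integrable (fun ξ : Eu N => Complex.exp (Complex.I * (⟪x, ξ⟫ : ℂ)) *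
      (∫ y : Eu N, Complex.exp (-Complex.I * (⟪y, ξ⟫ : ℂ)) * g y) / (μ + (‖ξ‖ : ℂ) ^ 2)) := by
  simp_rw [resolvent_integrand_eq]
  refine Integrable.comp_smul (f := fun η : Eu N => Complex.exp (2 * π * Complex.I * ⟪x, η⟫) *
      ((μ + 4 * π ^ 2 * ‖η‖ ^ 2 : ℂ)⁻¹ * 𝓕 (⇑g) η)) ?_ (by positivity)
  simp_rw [← fourier_resolvent hμ]
  refine (SchwartzMap.integrable (𝓕 (resolvent μ g))).bdd_mul (c := 1) ?_ (.of_forall fun η => ?_)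
  · exact Continuous.aestronglyMeasurable (by fun_prop)
  · rw [Complex.norm_exp]
    simp

lemma resolvent_eq_integral {μ : ℂ} (hμ : ∀ t : ℝ, 0 ≤ t → μ + t ≠ 0) (g : 𝓢(Eu N, ℂ))
    (x : Eu N) :
    resolvent μ g x = (((2 * π) ^ N : ℝ) : ℂ)⁻¹ *
      ∫ ξ : Eu N, Complex.exp (Complex.I * (⟪x, ξ⟫ : ℂ)) *
        (∫ y : Eu N, Complex.exp (-Complex.I * (⟪y, ξ⟫ : ℂ)) * g y) / (μ + (‖ξ‖ : ℂ) ^ 2) := by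
  simp_rw [resolvent_integrand_eq]
  have h := Measure.integral_comp_smul (volume : Measure (Eu N)) (fun η : Eu N =>
    Complex.exp (2 * π * Complex.I * ⟪x, η⟫) *
      ((μ + 4 * π ^ 2 * ‖η‖ ^ 2 : ℂ)⁻¹ * 𝓕 (⇑g) η)) (2 * π)⁻¹
  rw [h, ← resolvent_apply hμ, finrank_euclideanSpace_fin, inv_pow,
    inv_inv, abs_of_pos (by positivity), Complex.real_smul, inv_mul_cancel_left₀]
  exact Complex.ofReal_ne_zero.2 (by positivity)

/-! ### Total derivatives in terms of directional derivatives -/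

lemma norm_fderiv_schwartz_le (W : 𝓢(Eu N, ℂ)) (x : Eu N) :
    ‖fderiv ℝ (fun y => W y) x‖ ≤ ∑ i : Fin N, ‖(∂_{ee i} W : 𝓢(Eu N, ℂ)) x‖ := by
  refine ContinuousLinearMap.opNorm_le_bound _ (by positivity) fun v => ?_
  have hv : v = ∑ i : Fin N, v i • ee i := by
    simpa using ((EuclideanSpace.basisFun (Fin N) ℝ).sum_repr v).symm
  conv_lhs => rw [hv]
  rw [map_sum, Finset.sum_mul]
  refine (norm_sum_le _ _).trans (Finset.sum_le_sum fun i _ => ?_)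
  rw [map_smul, norm_smul, mul_comm, SchwartzMap.lineDerivOp_apply_eq_fderiv]
  exact mul_le_mul_of_nonneg_left (PiLp.norm_apply_le v i) (norm_nonneg _)

lemma norm_iteratedFDeriv_two_schwartz_le (W : 𝓢(Eu N, ℂ)) (x : Eu N) :
    ‖iteratedFDeriv ℝ 2 (fun y => W y) x‖ ≤
      ∑ p : Fin N × Fin N, ‖(∂_{ee p.1} (∂_{ee p.2} W) : 𝓢(Eu N, ℂ)) x‖ := by
  refine ContinuousMultilinearMap.opNorm_le_bound (by positivity) fun m => ?_
  have hv (v : Eu N) : v = ∑ i : Fin N, v i • ee i := by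
    simpa using ((EuclideanSpace.basisFun (Fin N) ℝ).sum_repr v).symm
  have h1 (u v : Eu N) : fderiv ℝ (fderiv ℝ (fun y => W y)) x u v =
      ∑ p : Fin N × Fin N, (u p.1 * v p.2) • (∂_{ee p.1} (∂_{ee p.2} W) : 𝓢(Eu N, ℂ)) x := by
    have h2 (i j : Fin N) : (∂_{ee i} (∂_{ee j} W) : 𝓢(Eu N, ℂ)) x =
        fderiv ℝ (fderiv ℝ (fun y => W y)) x (ee i) (ee j) := by
      rw [SchwartzMap.lineDerivOp_apply_eq_fderiv]
      have h3 : ⇑(∂_{ee j} W : 𝓢(Eu N, ℂ)) = fun y => fderiv ℝ (fun y => W y) y (ee j) := by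
        ext y
        rw [SchwartzMap.lineDerivOp_apply_eq_fderiv]
      have h4 : DifferentiableAt ℝ (fderiv ℝ (fun y => W y)) x :=
        ((W.smooth 2).fderiv_right (m := 1) (by norm_num)).differentiable (by norm_num) x
      rw [h3, fderiv_clm_apply h4 (by fun_prop)]
      simp
    conv_lhs => rw [hv u, hv v]
    rw [map_sum, Fintype.sum_prod_type_right]
    refine Finset.sum_congr rfl fun j _ => ?_
    rw [map_smul, map_sum, sum_apply, Finset.smul_sum]
    refine Finset.sum_congr rfl fun i _ => ?_
    rw [map_smul, smul_apply, h2, smul_smul, mul_comm]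
  rw [iteratedFDeriv_two_apply, h1, Finset.sum_mul, Fin.prod_univ_two]
  refine (norm_sum_le _ _).trans (Finset.sum_le_sum fun p _ => ?_)
  rw [norm_smul, norm_mul, mul_comm]
  gcongr
  · exact PiLp.norm_apply_le (m 0) p.1
  · exact PiLp.norm_apply_le (m 1) p.2

/-! ### The sector -/

lemma exists_rotation {σ : ℝ} (hσ : σ ∈ Set.Ioo 0 (π / 2)) {lam : ℂ} (harg : |lam.arg| < π - σ) :
    ∃ z : ℂ, ‖z‖ = 1 ∧ sin (σ / 2) ≤ z.re ∧ (lam * z).re = ‖lam‖ * z.re := by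
  refine ⟨Complex.exp ((-(lam.arg / 2) : ℝ) * Complex.I), Complex.norm_exp_ofReal_mul_I _, ?_, ?_⟩
  · rw [Complex.exp_ofReal_mul_I_re, Real.cos_neg, ← Real.cos_abs, ← Real.cos_pi_div_two_sub]
    refine Real.cos_le_cos_of_nonneg_of_le_pi (abs_nonneg _) ?_ ?_
    · linarith [hσ.1, Real.pi_pos]
    · rw [abs_div, abs_two]
      linarith
  · have h : lam * Complex.exp ((-(lam.arg / 2) : ℝ) * Complex.I) =
        ‖lam‖ * Complex.exp ((lam.arg / 2 : ℝ) * Complex.I) := by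
      conv_lhs => rw [← Complex.norm_mul_exp_arg_mul_I lam]
      rw [mul_assoc, ← Complex.exp_add]
      congr 2
      rw [Complex.norm_mul_exp_arg_mul_I lam]
      push_cast
      ring
    rw [h, Complex.re_ofReal_mul, Complex.exp_ofReal_mul_I_re, Complex.exp_ofReal_mul_I_re,
      Real.cos_neg]

lemma norm_mul_LqNorm_resolvent_le {q : ℝ} (hq : 1 ≤ q) {ρ k : ℝ} (hρ : 0 < ρ) (hk : 0 < k)
    {lam z : ℂ} (hlam : lam ≠ 0) (hz : ‖z‖ = 1) (hkz : k ≤ z.re)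
    (hlz : (lam * z).re = ‖lam‖ * z.re) (hμ : ∀ t : ℝ, 0 ≤ t → (ρ : ℂ) * lam + t ≠ 0)
    (g : 𝓢(Eu N, ℂ)) :
    ‖lam‖ * LqNorm volume q (resolvent (ρ * lam) g) ≤
      (1 / k) ^ (N / 2 : ℝ) / (ρ * k) * LqNorm volume q g := by
  have hl : 0 < ‖lam‖ := norm_pos_iff.2 hlam
  have hre : 0 < z.re := hk.trans_le hkz
  have h1 : ((ρ : ℂ) * lam * z).re = ρ * (‖lam‖ * z.re) := by
    rw [mul_assoc, Complex.re_ofReal_mul, hlz]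
  have h2 := LqNorm_resolvent_le hq g (resolvent (ρ * lam) g) hz hre (by rw [h1]; positivity)
    (resolvent_apply hμ g)
  rw [h1] at h2
  calc ‖lam‖ * LqNorm volume q (resolvent (ρ * lam) g)
      ≤ ‖lam‖ * ((1 / z.re) ^ (N / 2 : ℝ) / (ρ * (‖lam‖ * z.re)) * LqNorm volume q g) := by gcongr
    _ = (1 / z.re) ^ (N / 2 : ℝ) / (ρ * z.re) * LqNorm volume q g := by field_simp
    _ ≤ _ := by
      have := LqNorm_nonneg (μ := (volume : Measure (Eu N))) (p := q) g
      gcongr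

lemma LqNorm_lapS_resolvent_le {q : ℝ} (hq : 1 ≤ q) {μ : ℂ}
    (hμ : ∀ t : ℝ, 0 ≤ t → μ + t ≠ 0) (g : 𝓢(Eu N, ℂ)) :
    LqNorm volume q (lapS (resolvent μ g)) ≤
      ‖μ‖ * LqNorm volume q (resolvent μ g) + LqNorm volume q g := by
  have h := LqNorm_le_sum (μ := volume) hq Finset.univ
    (f := ![⇑(resolvent μ g), ⇑g]) (w := lapS (resolvent μ g)) (c := ![‖μ‖, 1])
    (by simp [Fin.forall_fin_two]) (by simp [Fin.forall_fin_two, memLp_schwartz]) fun x => ?_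
  · simpa [Fin.sum_univ_two] using h
  · have h1 : lapS (resolvent μ g) x = μ * resolvent μ g x - g x := by
      conv_rhs => rw [← resolvent_sub_lapS hμ g]
      rw [sub_apply, smul_apply, smul_eq_mul, resolvent_sub_lapS hμ g]
      ring
    rw [h1]
    simpa [Fin.sum_univ_two] using norm_sub_le (μ * resolvent μ g x) (g x)

lemma LqNorm_fderiv_le {q : ℝ} (hq : 1 ≤ q) (W : 𝓢(Eu N, ℂ)) :
    LqNorm volume q (fun x => fderiv ℝ (fun y => W y) x) ≤
      ∑ i : Fin N, LqNorm volume q (∂_{ee i} W : 𝓢(Eu N, ℂ)) := by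
  have h := LqNorm_le_sum (μ := volume) hq Finset.univ
    (f := fun i : Fin N => ⇑(∂_{ee i} W : 𝓢(Eu N, ℂ)))
    (w := fun x => fderiv ℝ (fun y => W y) x) (c := fun _ => 1)
    (by simp) (fun i _ => memLp_schwartz _)
    (fun x => by simpa using norm_fderiv_schwartz_le W x)
  simpa using h

lemma LqNorm_iteratedFDeriv_two_le {q : ℝ} (hq : 1 ≤ q) (W : 𝓢(Eu N, ℂ)) :
    LqNorm volume q (fun x => iteratedFDeriv ℝ 2 (fun y => W y) x) ≤
      ∑ p : Fin N × Fin N, LqNorm volume q (∂_{ee p.1} (∂_{ee p.2} W) : 𝓢(Eu N, ℂ)) := by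
  have h := LqNorm_le_sum (μ := volume) hq Finset.univ
    (f := fun p : Fin N × Fin N => ⇑(∂_{ee p.1} (∂_{ee p.2} W) : 𝓢(Eu N, ℂ)))
    (w := fun x => iteratedFDeriv ℝ 2 (fun y => W y) x) (c := fun _ => 1)
    (by simp) (fun i _ => memLp_schwartz _)
    (fun x => by simpa using norm_iteratedFDeriv_two_schwartz_le W x)
  simpa using h

lemma exists_resolvent_estimate (N : ℕ) {q : ℝ} (hq : 1 < q) {ρ k : ℝ} (hρ : 0 < ρ) (hk : 0 < k) :
    ∃ C : ℝ, 0 < C ∧ ∀ lam z : ℂ, lam ≠ 0 → ‖z‖ = 1 → k ≤ z.re →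
      (lam * z).re = ‖lam‖ * z.re → (∀ t : ℝ, 0 ≤ t → (ρ : ℂ) * lam + t ≠ 0) →
      ∀ g : 𝓢(Eu N, ℂ),
        ‖lam‖ * LqNorm volume q (resolvent (ρ * lam) g) +
            ‖lam‖ ^ ((1 : ℝ) / 2) *
              LqNorm volume q (fun x => fderiv ℝ (fun y => resolvent (ρ * lam) g y) x) +
            LqNorm volume q (fun x => iteratedFDeriv ℝ 2 (fun y => resolvent (ρ * lam) g y) x) ≤
          C * LqNorm volume q g := by
  obtain ⟨C₀, hC₀, hlap⟩ := exists_LqNorm_lineDeriv_le hq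
  set A : ℝ := (1 / k) ^ (N / 2 : ℝ) / (ρ * k) with hA
  have hApos : 0 < A := by positivity
  set B : ℝ := C₀ * (ρ * A + 1) with hB
  have hBpos : 0 < B := by positivity
  refine ⟨A + N * (3 * (A + B)) + (N * N) * B, by positivity,
    fun lam z hlam hz hkz hlz hμ g => ?_⟩
  set W := resolvent (ρ * lam) g
  set G := LqNorm volume q g with hG
  have hl : 0 < ‖lam‖ := norm_pos_iff.2 hlam
  have h1 : ‖lam‖ * LqNorm volume q W ≤ A * G :=
    norm_mul_LqNorm_resolvent_le hq.le hρ hk hlam hz hkz hlz hμ g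
  have h2 : LqNorm volume q (lapS W) ≤ (ρ * A + 1) * G := by
    refine (LqNorm_lapS_resolvent_le hq.le hμ g).trans ?_
    rw [norm_mul, Complex.norm_real, Real.norm_of_nonneg hρ.le, mul_assoc, add_mul, one_mul,
      mul_assoc]
    gcongr
  have h3 (i j : Fin N) : LqNorm volume q (∂_{ee i} (∂_{ee j} W) : 𝓢(Eu N, ℂ)) ≤ B * G := by
    refine (hlap N W i j).trans ?_
    rw [hB, mul_assoc]
    gcongr
  have h4 (i : Fin N) : ‖lam‖ ^ ((1 : ℝ) / 2) * LqNorm volume q (∂_{ee i} W : 𝓢(Eu N, ℂ)) ≤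
      3 * (A + B) * G := by
    have h5 := mul_LqNorm_lineDeriv_le hq.le W (ee i) (Real.rpow_pos_of_pos hl (1 / 2))
    rw [← Real.sqrt_eq_rpow, Real.sq_sqrt hl.le] at h5
    rw [← Real.sqrt_eq_rpow]
    linarith [h3 i i]
  have h6 : ‖lam‖ ^ ((1 : ℝ) / 2) * LqNorm volume q (fun x => fderiv ℝ (fun y => W y) x) ≤
      N * (3 * (A + B)) * G := by
    calc _ ≤ ‖lam‖ ^ ((1 : ℝ) / 2) * ∑ i : Fin N, LqNorm volume q (∂_{ee i} W : 𝓢(Eu N, ℂ)) := by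
          gcongr
          exact LqNorm_fderiv_le hq.le W
      _ ≤ ∑ _i : Fin N, 3 * (A + B) * G := by
          rw [Finset.mul_sum]
          exact Finset.sum_le_sum fun i _ => h4 i
      _ = _ := by
          rw [Finset.sum_const, Finset.card_univ, Fintype.card_fin, nsmul_eq_mul, ← mul_assoc]
  have h7 : LqNorm volume q (fun x => iteratedFDeriv ℝ 2 (fun y => W y) x) ≤
      (N * N) * B * G := by
    refine (LqNorm_iteratedFDeriv_two_le hq.le W).trans
      ((Finset.sum_le_sum fun p _ => h3 p.1 p.2).trans_eq ?_)
    rw [Finset.sum_const, Finset.card_univ, Fintype.card_prod, Fintype.card_fin, nsmul_eq_mul]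
    push_cast
    ring
  linarith

end ResolventEstimate

/-- Resolvent estimate (3.7): the solution `W` of `ρλW − ΔW = g` given by the Fourier
formula is a Schwartz function satisfying
`|λ|‖W‖_q + |λ|^{1/2}‖∇W‖_q + ‖D²W‖_q ≤ C‖g‖_q` uniformly in `λ` in the sector. -/
theorem stmt_8 (N : ℕ) (hN : 1 ≤ N) (q : ℝ) (hq : 1 < q) (σ : ℝ)
    (hσ : σ ∈ Set.Ioo 0 (π / 2)) (ρ : ℝ) (hρ : 0 < ρ) :
    ∃ C : ℝ, 0 < C ∧ ∀ lam : ℂ, lam ≠ 0 → |lam.arg| < π - σ →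
      ∀ g : SchwartzMap (EuclideanSpace ℝ (Fin N)) ℂ,
        ∃ W : SchwartzMap (EuclideanSpace ℝ (Fin N)) ℂ,
          (∀ x, Integrable (fun ξ : EuclideanSpace ℝ (Fin N) =>
              Complex.exp (Complex.I * (⟪x, ξ⟫ : ℂ)) *
                (∫ y : EuclideanSpace ℝ (Fin N),
                  Complex.exp (-Complex.I * (⟪y, ξ⟫ : ℂ)) * g y) /
                ((ρ : ℂ) * lam + (‖ξ‖ : ℂ) ^ 2))) ∧
          (∀ x, W x = (((2 * π) ^ N : ℝ) : ℂ)⁻¹ *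
              ∫ ξ : EuclideanSpace ℝ (Fin N),
                Complex.exp (Complex.I * (⟪x, ξ⟫ : ℂ)) *
                  (∫ y : EuclideanSpace ℝ (Fin N),
                    Complex.exp (-Complex.I * (⟪y, ξ⟫ : ℂ)) * g y) /
                  ((ρ : ℂ) * lam + (‖ξ‖ : ℂ) ^ 2)) ∧
          (∀ x, (ρ : ℂ) * lam * W x - lapl (fun y => W y) x = g x) ∧
          ‖lam‖ * LqNorm volume q (fun x => W x) +
              ‖lam‖ ^ ((1 : ℝ) / 2) *
                LqNorm volume q (fun x => fderiv ℝ (fun y => W y) x) +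
              LqNorm volume q (fun x => iteratedFDeriv ℝ 2 (fun y => W y) x) ≤
            C * LqNorm volume q (fun x => g x) := by
  obtain ⟨hσ0, hσ1⟩ := hσ
  have hk : 0 < sin (σ / 2) := Real.sin_pos_of_pos_of_lt_pi (by linarith) (by linarith)
  obtain ⟨C, hC, hest⟩ := ResolventEstimate.exists_resolvent_estimate N hq hρ hk
  refine ⟨C, hC, fun lam hlam harg g => ?_⟩
  obtain ⟨z, hz, hkz, hlz⟩ := ResolventEstimate.exists_rotation ⟨hσ0, hσ1⟩ harg
  have hre : 0 < z.re := hk.trans_le hkz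
  have hμ : ∀ t : ℝ, 0 ≤ t → (ρ : ℂ) * lam + t ≠ 0 := by
    refine ResolventEstimate.symbol_ne_zero hre ?_
    rw [mul_assoc, Complex.re_ofReal_mul, hlz]
    have := norm_pos_iff.2 hlam
    positivity
  refine ⟨ResolventEstimate.resolvent (ρ * lam) g,
    ResolventEstimate.integrable_resolvent_integrand hμ g,
    ResolventEstimate.resolvent_eq_integral hμ g, fun x => ?_, hest lam z hlam hz hkz hlz hμ g⟩
  rw [ResolventEstimate.lapl_eq_lapS]
  exact congrArg (fun f : SchwartzMap (EuclideanSpace ℝ (Fin N)) ℂ => f x)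
    (ResolventEstimate.resolvent_sub_lapS hμ g)
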